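/- arXiv:1106.1249 — 5 statements merged into one kernel-verified Lean document; each statement's English description precedes it below -/
import Mathlib

section
/- Let f : ℝ → ℝ be a continuous nonnegative function, let 0 < T_0 < T_1 be real numbers, and let m ≥ 1 and d ≥ 1 be integers. Then ∫_{T_0}^{T_1} ( Σ_{l=m+1}^{m+d} f(l·h) ) dh ≤ (d/2) · ∫_{(m+1)T_0}^{(m+d)T_1} f(h) dh. -/
/-- For a continuous nonnegative `f : ℝ → ℝ`, reals `0 < T₀ < T₁` and integers `m, d ≥ 1`,
`∫_{T₀}^{T₁} (∑_{l=m+1}^{m+d} f (l·h)) dh ≤ (d/2) · ∫_{(m+1)T₀}^{(m+d)T₁} f(h) dh`. -/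
theorem integral_sum_dilations_le
    (f : ℝ → ℝ) (hf : Continuous f) (hf0 : ∀ x, 0 ≤ f x)
    (T₀ T₁ : ℝ) (hT₀ : 0 < T₀) (hT : T₀ < T₁)
    (m d : ℕ) (hm : 1 ≤ m) (hd : 1 ≤ d) :
    (∫ h in T₀..T₁, ∑ l ∈ Finset.Icc (m + 1) (m + d), f ((l : ℝ) * h)) ≤
      ((d : ℝ) / 2) * ∫ h in (((m : ℝ) + 1) * T₀)..(((m : ℝ) + d) * T₁), f h := by
  rw [intervalIntegral.integral_finsetSum
    (fun (l : ℕ) _ => (by fun_prop : Continuous fun h : ℝ => f ((l : ℝ) * h)).intervalIntegrable _ _)]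
  set I := ∫ h in (((m : ℝ) + 1) * T₀)..(((m : ℝ) + d) * T₁), f h with hI
  have key : ∀ l ∈ Finset.Icc (m + 1) (m + d),
      (∫ h in T₀..T₁, f ((l : ℝ) * h)) ≤ 1 / 2 * I := by
    intro l hl
    rw [Finset.mem_Icc] at hl
    have h1 : (m : ℝ) + 1 ≤ l := by exact_mod_cast hl.1
    have h2 : (l : ℝ) ≤ m + d := by exact_mod_cast hl.2
    have hm' : (1 : ℝ) ≤ m := by exact_mod_cast hm
    have hl2 : (2 : ℝ) ≤ l := by linarith
    have hl0 : (l : ℝ) ≠ 0 := by linarith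
    have a1 : ((m : ℝ) + 1) * T₀ ≤ l * T₀ := mul_le_mul_of_nonneg_right h1 hT₀.le
    have a2 : (l : ℝ) * T₀ ≤ l * T₁ := mul_le_mul_of_nonneg_left hT.le (by linarith)
    have a3 : (l : ℝ) * T₁ ≤ (m + d) * T₁ := mul_le_mul_of_nonneg_right h2 (by linarith)
    have hmono : (∫ h in ((l : ℝ) * T₀)..(l * T₁), f h) ≤ I :=
      intervalIntegral.integral_mono_interval a1 a2 a3
        (Filter.Eventually.of_forall hf0) (hf.intervalIntegrable _ _)
    have hn : 0 ≤ ∫ h in ((l : ℝ) * T₀)..(l * T₁), f h :=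
      intervalIntegral.integral_nonneg a2 (fun x _ => hf0 x)
    rw [intervalIntegral.integral_comp_mul_left f hl0, smul_eq_mul]
    have hinv : (l : ℝ)⁻¹ ≤ 1 / 2 := by
      rw [one_div]
      exact inv_anti₀ (by norm_num) hl2
    exact mul_le_mul hinv hmono hn (by norm_num)
  refine (Finset.sum_le_card_nsmul _ _ _ key).trans (le_of_eq ?_)
  rw [Nat.card_Icc, nsmul_eq_mul, show m + d + 1 - (m + 1) = d by omega]
  ring
end

section
/- Let n > 2 and let k be an integer with either 1 ≤ k ≤ n/2 − 1, or k = 1 when n = 3. Let ρ > 0 and let h : ℝ^n ∖ B_ρ(0) → Sym(n, ℝ) be a smooth symmetric-matrix-valued function (a symmetric 2-tensor field on Euclidean space) satisfying, componentwise with respect to the Euclidean Laplacian Δ = Σ_i ∂_i^2: (i) Δ^{k+1} h = 0 on ℝ^n ∖ B_ρ(0); (ii) the divergence vanishes, Σ_i ∂_i h_{ij} = 0 for every j; (iii) |h(x)| = O(|x|^{1−ε}) as |x| → ∞ for some ε > 0. Then there exists a constant symmetric matrix h_c such that |h(x) − h_c| = O(|x|^{2k−n}) as |x| → ∞. -/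
/-- The Euclidean Laplacian `Δ f = ∑ i ∂ᵢ² f` of a scalar function on `ℝⁿ`,
acting via Fréchet derivatives in the coordinate directions. -/
noncomputable def eucLap {n : ℕ} (f : EuclideanSpace ℝ (Fin n) → ℝ) :
    EuclideanSpace ℝ (Fin n) → ℝ :=
  fun x => ∑ i, fderiv ℝ (fun y => fderiv ℝ f y (EuclideanSpace.single i 1)) x
    (EuclideanSpace.single i 1)

open MeasureTheory Filter Topology

noncomputable def pd {n : ℕ} (i : Fin n) (f : EuclideanSpace ℝ (Fin n) → ℝ) :
    EuclideanSpace ℝ (Fin n) → ℝ :=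
  fun x => fderiv ℝ f x (EuclideanSpace.single i 1)

def Sm {n : ℕ} (f : EuclideanSpace ℝ (Fin n) → ℝ) : Prop := ContDiff ℝ (⊤ : ℕ∞) f

theorem lap_eq {n : ℕ} (f : EuclideanSpace ℝ (Fin n) → ℝ) :
    eucLap f = fun x => ∑ i, pd i (pd i f) x := rfl

theorem Sm.diff {n : ℕ} {f : EuclideanSpace ℝ (Fin n) → ℝ} (h : Sm f) : Differentiable ℝ f :=
  ContDiff.differentiable h (by simp)

theorem Sm.cont {n : ℕ} {f : EuclideanSpace ℝ (Fin n) → ℝ} (h : Sm f) : Continuous f :=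
  ContDiff.continuous h

theorem Sm.pd {n : ℕ} {f : EuclideanSpace ℝ (Fin n) → ℝ} (h : Sm f) (i : Fin n) :
    Sm (pd i f) := by
  unfold Sm at *
  exact (h.fderiv_right (m := (⊤ : ℕ∞)) (by simp)).clm_apply contDiff_const

theorem Sm.sum {n : ℕ} {ι : Type*} (s : Finset ι) {f : ι → EuclideanSpace ℝ (Fin n) → ℝ}
    (h : ∀ i, Sm (f i)) : Sm (fun x => ∑ i ∈ s, f i x) :=
  ContDiff.sum (fun i _ => h i)

theorem Sm.lap {n : ℕ} {f : EuclideanSpace ℝ (Fin n) → ℝ} (h : Sm f) : Sm (eucLap f) := by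
  rw [lap_eq]
  exact Sm.sum _ (fun i => (h.pd i).pd i)

theorem Sm.lapi {n : ℕ} {f : EuclideanSpace ℝ (Fin n) → ℝ} (h : Sm f) (m : ℕ) :
    Sm (eucLap^[m] f) := by
  induction m generalizing f with
  | zero => exact h
  | succ m ih => exact ih h.lap

theorem pd_congr {n : ℕ} {f g : EuclideanSpace ℝ (Fin n) → ℝ} {U : Set (EuclideanSpace ℝ (Fin n))}
    (hU : IsOpen U) (h : ∀ x ∈ U, f x = g x) (i : Fin n) : ∀ x ∈ U, pd i f x = pd i g x := by
  intro x hx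
  have : f =ᶠ[𝓝 x] g := by
    filter_upwards [hU.mem_nhds hx] with y hy using h y hy
  unfold pd
  rw [this.fderiv_eq]

theorem lapi_congr {n : ℕ} {f g : EuclideanSpace ℝ (Fin n) → ℝ}
    {U : Set (EuclideanSpace ℝ (Fin n))}
    (hU : IsOpen U) (h : ∀ x ∈ U, f x = g x) (m : ℕ) :
    ∀ x ∈ U, eucLap^[m] f x = eucLap^[m] g x := by
  induction m generalizing f g with
  | zero => exact h
  | succ m ih =>
    apply ih
    intro x hx
    rw [lap_eq, lap_eq]
    exact Finset.sum_congr rfl fun i _ => pd_congr hU (pd_congr hU h i) i x hx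

theorem hcs_pd {n : ℕ} {f : EuclideanSpace ℝ (Fin n) → ℝ} (h : HasCompactSupport f) (i : Fin n) :
    HasCompactSupport (pd i f) := h.fderiv_apply ℝ _

theorem hcs_sum {n : ℕ} {ι : Type*} (s : Finset ι) {f : ι → EuclideanSpace ℝ (Fin n) → ℝ}
    (h : ∀ i, HasCompactSupport (f i)) : HasCompactSupport (fun x => ∑ i ∈ s, f i x) := by
  classical
  induction s using Finset.induction_on with
  | empty => simp; exact HasCompactSupport.zero
  | insert a s ha ih =>
    simp_rw [Finset.sum_insert ha]
    exact (h a).add ih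

theorem hcs_lap {n : ℕ} {f : EuclideanSpace ℝ (Fin n) → ℝ} (h : HasCompactSupport f) :
    HasCompactSupport (eucLap f) := by
  rw [lap_eq]
  exact hcs_sum _ (fun i => hcs_pd (hcs_pd h i) i)

theorem hcs_lapi {n : ℕ} {f : EuclideanSpace ℝ (Fin n) → ℝ} (h : HasCompactSupport f) (m : ℕ) :
    HasCompactSupport (eucLap^[m] f) := by
  induction m generalizing f with
  | zero => exact h
  | succ m ih => exact ih (hcs_lap h)

theorem int_mul {n : ℕ} {f c : EuclideanSpace ℝ (Fin n) → ℝ} (hf : Continuous f)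
    (hc : Continuous c) (hcc : HasCompactSupport c) : Integrable (fun x => f x * c x) :=
  (hf.mul hc).integrable_of_hasCompactSupport hcc.mul_left

theorem ibp {n : ℕ} {f c : EuclideanSpace ℝ (Fin n) → ℝ} (hf : Sm f) (hc : Sm c)
    (hcc : HasCompactSupport c) (i : Fin n) :
    ∫ x, f x * pd i c x = - ∫ x, pd i f x * c x := by
  exact integral_mul_fderiv_eq_neg_fderiv_mul_of_integrable
    (int_mul (hf.pd i).cont hc.cont hcc)
    (int_mul hf.cont (hc.pd i).cont (hcs_pd hcc i))
    (int_mul hf.cont hc.cont hcc) (fun x _ => hf.diff x) (fun x _ => hc.diff x)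

theorem ibp_lap {n : ℕ} {f c : EuclideanSpace ℝ (Fin n) → ℝ} (hf : Sm f) (hc : Sm c)
    (hcc : HasCompactSupport c) :
    ∫ x, f x * eucLap c x = ∫ x, eucLap f x * c x := by
  simp only [lap_eq, Finset.mul_sum, Finset.sum_mul]
  rw [integral_finset_sum, integral_finset_sum]
  · refine Finset.sum_congr rfl fun i _ => ?_
    rw [ibp hf (hc.pd i) (hcs_pd hcc i), ibp (hf.pd i) hc hcc, neg_neg]
  · intro i _
    exact int_mul ((hf.pd i).pd i).cont hc.cont hcc
  · intro i _
    exact int_mul hf.cont ((hc.pd i).pd i).cont (hcs_pd (hcs_pd hcc i) i)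

theorem ibp_lapi {n : ℕ} {f c : EuclideanSpace ℝ (Fin n) → ℝ} (hf : Sm f) (hc : Sm c)
    (hcc : HasCompactSupport c) (m : ℕ) :
    ∫ x, f x * eucLap^[m] c x = ∫ x, eucLap^[m] f x * c x := by
  induction m generalizing f with
  | zero => rfl
  | succ m ih =>
    rw [Function.iterate_succ_apply', ibp_lap hf (hc.lapi m) (hcs_lapi hcc m), ih hf.lap]
    rfl

theorem pd_comm {n : ℕ} {f : EuclideanSpace ℝ (Fin n) → ℝ} (hf : Sm f) (i j : Fin n) :
    pd i (pd j f) = pd j (pd i f) := by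
  have key : ∀ (i j : Fin n) x, pd i (pd j f) x
      = fderiv ℝ (fderiv ℝ f) x (EuclideanSpace.single i 1) (EuclideanSpace.single j 1) := by
    intro i j x
    have hd : DifferentiableAt ℝ (fderiv ℝ f) x :=
      ((ContDiff.fderiv_right (m := (⊤ : ℕ∞)) hf (by simp)).differentiable (by simp)) x
    unfold pd
    rw [fderiv_clm_apply hd (differentiableAt_const _)]
    simp
  funext x
  rw [key, key]
  have hs : IsSymmSndFDerivAt ℝ f x :=
    ContDiffAt.isSymmSndFDerivAt (ContDiff.contDiffAt hf) (by simp; exact WithTop.coe_le_coe.2 le_top)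
  exact hs _ _

theorem pd_sum {n : ℕ} {ι : Type*} (s : Finset ι) {f : ι → EuclideanSpace ℝ (Fin n) → ℝ}
    (h : ∀ i, Sm (f i)) (j : Fin n) :
    pd j (fun x => ∑ i ∈ s, f i x) = fun x => ∑ i ∈ s, pd j (f i) x := by
  funext x
  unfold pd
  rw [fderiv_fun_sum (fun i _ => (h i).diff x)]
  simp

theorem lap_sum {n : ℕ} {ι : Type*} (s : Finset ι) {f : ι → EuclideanSpace ℝ (Fin n) → ℝ}
    (h : ∀ i, Sm (f i)) :
    eucLap (fun x => ∑ i ∈ s, f i x) = fun x => ∑ i ∈ s, eucLap (f i) x := by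
  simp only [lap_eq]
  funext x
  rw [Finset.sum_comm]
  refine Finset.sum_congr rfl fun i _ => ?_
  rw [pd_sum s h, pd_sum s (fun j => (h j).pd i)]

theorem lapi_sum {n : ℕ} {ι : Type*} (s : Finset ι) {f : ι → EuclideanSpace ℝ (Fin n) → ℝ}
    (h : ∀ i, Sm (f i)) (m : ℕ) :
    eucLap^[m] (fun x => ∑ i ∈ s, f i x) = fun x => ∑ i ∈ s, eucLap^[m] (f i) x := by
  induction m generalizing f with
  | zero => rfl
  | succ m ih =>
    rw [Function.iterate_succ_apply, lap_sum s h, ih (fun i => (h i).lap)]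
    rfl

theorem pd_lap {n : ℕ} {f : EuclideanSpace ℝ (Fin n) → ℝ} (h : Sm f) (i : Fin n) :
    pd i (eucLap f) = eucLap (pd i f) := by
  simp only [lap_eq]
  rw [pd_sum _ (fun j => (h.pd j).pd j)]
  funext x
  refine Finset.sum_congr rfl fun j _ => ?_
  rw [pd_comm (h.pd j), pd_comm h]

theorem pd_lapi {n : ℕ} {f : EuclideanSpace ℝ (Fin n) → ℝ} (h : Sm f) (i : Fin n) (m : ℕ) :
    pd i (eucLap^[m] f) = eucLap^[m] (pd i f) := by
  induction m generalizing f with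
  | zero => rfl
  | succ m ih =>
    rw [Function.iterate_succ_apply, ih h.lap, pd_lap h]
    rfl

theorem pd_affine {n : ℕ} {f : EuclideanSpace ℝ (Fin n) → ℝ} (h : Sm f) (i : Fin n) (t : ℝ)
    (x : EuclideanSpace ℝ (Fin n)) :
    pd i (fun y => f (x + t • y)) = fun y => t * pd i f (x + t • y) := by
  funext y
  unfold pd
  have h1 : HasFDerivAt (fun y : EuclideanSpace ℝ (Fin n) => x + t • y)
      (t • ContinuousLinearMap.id ℝ _) y :=
    ((hasFDerivAt_id y).const_smul t).const_add x
  have h2 := ((h.diff (x + t • y)).hasFDerivAt).comp y h1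
  have h3 : fderiv ℝ (fun y => f (x + t • y)) y = _ := h2.fderiv
  rw [h3]
  simp

theorem Sm.affine {n : ℕ} {f : EuclideanSpace ℝ (Fin n) → ℝ} (h : Sm f) (t : ℝ)
    (x : EuclideanSpace ℝ (Fin n)) : Sm (fun y => f (x + t • y)) := by
  unfold Sm at *
  exact h.comp (contDiff_const.add (contDiff_id.const_smul t))

theorem pd_const_mul {n : ℕ} {f : EuclideanSpace ℝ (Fin n) → ℝ} (h : Sm f) (i : Fin n) (t : ℝ) :
    pd i (fun y => t * f y) = fun y => t * pd i f y := by
  funext y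
  unfold pd
  rw [fderiv_const_mul (h.diff y)]
  simp

theorem Sm.const_mul {n : ℕ} {f : EuclideanSpace ℝ (Fin n) → ℝ} (h : Sm f) (t : ℝ) :
    Sm (fun y => t * f y) := by
  unfold Sm at *
  exact contDiff_const.mul h

theorem lap_affine {n : ℕ} {f : EuclideanSpace ℝ (Fin n) → ℝ} (h : Sm f) (t : ℝ)
    (x : EuclideanSpace ℝ (Fin n)) :
    eucLap (fun y => f (x + t • y)) = fun y => t ^ 2 * eucLap f (x + t • y) := by
  simp only [lap_eq]
  funext y
  rw [Finset.mul_sum]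
  refine Finset.sum_congr rfl fun i _ => ?_
  rw [pd_affine h, pd_const_mul ((h.pd i).affine t x), pd_affine (h.pd i)]
  ring

theorem lap_const_mul {n : ℕ} {f : EuclideanSpace ℝ (Fin n) → ℝ} (h : Sm f) (t : ℝ) :
    eucLap (fun y => t * f y) = fun y => t * eucLap f y := by
  simp only [lap_eq]
  funext y
  rw [Finset.mul_sum]
  refine Finset.sum_congr rfl fun i _ => ?_
  rw [pd_const_mul h, pd_const_mul (h.pd i)]

theorem lapi_affine {n : ℕ} {f : EuclideanSpace ℝ (Fin n) → ℝ} (h : Sm f) (t : ℝ)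
    (x : EuclideanSpace ℝ (Fin n)) (m : ℕ) :
    eucLap^[m] (fun y => f (x + t • y)) = fun y => t ^ (2 * m) * eucLap^[m] f (x + t • y) := by
  induction m with
  | zero => simp
  | succ m ih =>
    rw [Function.iterate_succ_apply', ih, lap_const_mul ((h.lapi m).affine t x),
      lap_affine (h.lapi m)]
    funext y
    rw [Function.iterate_succ_apply']
    ring

noncomputable def cv {n : ℕ} (F c : EuclideanSpace ℝ (Fin n) → ℝ) :
    EuclideanSpace ℝ (Fin n) → ℝ := fun x => ∫ y, F y * c (x - y)

theorem cv_eq {n : ℕ} (F c : EuclideanSpace ℝ (Fin n) → ℝ) :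
    cv F c = convolution F c (ContinuousLinearMap.mul ℝ ℝ) volume := rfl

theorem cv_comm {n : ℕ} (F c : EuclideanSpace ℝ (Fin n) → ℝ) : cv F c = cv c F := by
  funext x
  unfold cv
  rw [← integral_sub_left_eq_self _ _ x]
  simp [mul_comm]

theorem Sm.cv {n : ℕ} {F c : EuclideanSpace ℝ (Fin n) → ℝ} (hF : Continuous F) (hc : Sm c)
    (hcc : HasCompactSupport c) : Sm (cv F c) := by
  rw [cv_eq]
  exact hcc.contDiff_convolution_right _ hF.locallyIntegrable hc

theorem pd_cv {n : ℕ} {F c : EuclideanSpace ℝ (Fin n) → ℝ} (hF : Continuous F) (hc : Sm c)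
    (hcc : HasCompactSupport c) (i : Fin n) : pd i (_root_.cv F c) = _root_.cv F (pd i c) := by
  funext x
  have h1 := hcc.hasFDerivAt_convolution_right (ContinuousLinearMap.mul ℝ ℝ)
    (μ := volume) hF.locallyIntegrable (ContDiff.of_le hc (by simp)) x
  unfold pd
  rw [cv_eq, h1.fderiv]
  rw [convolution_precompR_apply _ hF.locallyIntegrable (hcc.fderiv ℝ)
    (ContDiff.continuous_fderiv hc (by simp))]
  rfl

theorem lap_cv {n : ℕ} {F c : EuclideanSpace ℝ (Fin n) → ℝ} (hF : Continuous F) (hc : Sm c)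
    (hcc : HasCompactSupport c) : eucLap (cv F c) = cv F (eucLap c) := by
  simp only [lap_eq]
  funext x
  have : ∀ i, pd i (pd i (cv F c)) = cv F (pd i (pd i c)) := by
    intro i
    rw [pd_cv hF hc hcc, pd_cv hF (hc.pd i) (hcs_pd hcc i)]
  simp only [this]
  unfold cv
  simp only [Finset.mul_sum]
  rw [integral_finset_sum]
  intro i _
  refine int_mul hF ?_ ?_
  · exact ((hc.pd i).pd i).cont.comp (by fun_prop)
  · exact (hcs_pd (hcs_pd hcc i) i).comp_homeomorph (Homeomorph.subLeft x)

theorem lapi_cv {n : ℕ} {F c : EuclideanSpace ℝ (Fin n) → ℝ} (hF : Continuous F) (hc : Sm c)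
    (hcc : HasCompactSupport c) (m : ℕ) : eucLap^[m] (cv F c) = cv F (eucLap^[m] c) := by
  induction m generalizing c with
  | zero => rfl
  | succ m ih =>
    rw [Function.iterate_succ_apply, lap_cv hF hc hcc, ih hc.lap (hcs_lap hcc)]
    rfl

theorem cv_lapi {n : ℕ} {F c : EuclideanSpace ℝ (Fin n) → ℝ} (hF : Sm F) (hc : Sm c)
    (hcc : HasCompactSupport c) (m : ℕ) : cv F (eucLap^[m] c) = cv (eucLap^[m] F) c := by
  funext x
  unfold cv
  have h1 := lapi_affine hc (-1) x m
  have e : ∀ y : EuclideanSpace ℝ (Fin n), x + (-1 : ℝ) • y = x - y := by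
    intro y; simp [sub_eq_add_neg]
  have h2 := hc.affine (-1) x
  simp only [e] at h1 h2
  have h3 := ibp_lapi hF h2 (hcc.comp_homeomorph (Homeomorph.subLeft x)) m
  rw [h1] at h3
  simpa [pow_mul] using h3

theorem exists_primitive (F : ℝ → ℝ) (hF : ContDiff ℝ (⊤ : ℕ∞) F) (a : ℝ) :
    ∃ G : ℝ → ℝ, ContDiff ℝ (⊤ : ℕ∞) G ∧ (∀ t, deriv G t = F t) ∧
      ∀ t, G t = ∫ x in a..t, F x := by
  have h1 : ∀ t, HasDerivAt (fun t => ∫ x in a..t, F x) (F t) t := fun t =>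
    (intervalIntegral.integral_hasDerivAt_right (hF.continuous.intervalIntegrable _ _)
      (hF.continuous.stronglyMeasurableAtFilter _ _) hF.continuous.continuousAt)
  refine ⟨fun t => ∫ x in a..t, F x, ?_, fun t => (h1 t).deriv, fun t => rfl⟩
  rw [contDiff_infty_iff_deriv]
  refine ⟨fun t => (h1 t).differentiableAt, ?_⟩
  have : deriv (fun t => ∫ x in a..t, F x) = F := funext fun t => (h1 t).deriv
  rw [this]; exact hF

theorem Sm.radial {n : ℕ} {G : ℝ → ℝ} (hG : ContDiff ℝ (⊤ : ℕ∞) G) :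
    Sm (fun y : EuclideanSpace ℝ (Fin n) => G (‖y‖ ^ 2)) := by
  unfold Sm
  exact hG.comp (contDiff_norm_sq ℝ)

theorem hasFDerivAt_radial {n : ℕ} {G : ℝ → ℝ} (hG : ContDiff ℝ (⊤ : ℕ∞) G)
    (y : EuclideanSpace ℝ (Fin n)) :
    HasFDerivAt (fun y : EuclideanSpace ℝ (Fin n) => G (‖y‖ ^ 2))
      (deriv G (‖y‖ ^ 2) • (2 • innerSL ℝ y)) y := by
  have h1 := (hasStrictFDerivAt_norm_sq y).hasFDerivAt
  have h2 : HasDerivAt G (deriv G (‖y‖ ^ 2)) (‖y‖ ^ 2) :=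
    ((hG.differentiable (by simp)) _).hasDerivAt
  exact h2.comp_hasFDerivAt y h1

theorem pd_radial {n : ℕ} {G : ℝ → ℝ} (hG : ContDiff ℝ (⊤ : ℕ∞) G) (i : Fin n) :
    pd i (fun y : EuclideanSpace ℝ (Fin n) => G (‖y‖ ^ 2))
      = fun y => 2 * y i * deriv G (‖y‖ ^ 2) := by
  funext y
  unfold pd
  rw [(hasFDerivAt_radial hG y).fderiv]
  simp [EuclideanSpace.inner_single_right]
  ring

theorem hasFDerivAt_coord {n : ℕ} (i : Fin n) (y : EuclideanSpace ℝ (Fin n)) :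
    HasFDerivAt (fun y : EuclideanSpace ℝ (Fin n) => y i)
      (EuclideanSpace.proj i : EuclideanSpace ℝ (Fin n) →L[ℝ] ℝ) y :=
  (EuclideanSpace.proj i : EuclideanSpace ℝ (Fin n) →L[ℝ] ℝ).hasFDerivAt

noncomputable def Lop (n : ℕ) (G : ℝ → ℝ) : ℝ → ℝ :=
  fun t => 2 * n * deriv G t + 4 * t * deriv (deriv G) t

theorem cd_deriv {G : ℝ → ℝ} (hG : ContDiff ℝ (⊤ : ℕ∞) G) : ContDiff ℝ (⊤ : ℕ∞) (deriv G) :=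
  (contDiff_infty_iff_deriv.1 hG).2

theorem cd_Lop (n : ℕ) {G : ℝ → ℝ} (hG : ContDiff ℝ (⊤ : ℕ∞) G) :
    ContDiff ℝ (⊤ : ℕ∞) (Lop n G) := by
  have h1 := cd_deriv hG
  have h2 := cd_deriv h1
  unfold Lop
  fun_prop

theorem cd_Lopi (n : ℕ) {G : ℝ → ℝ} (hG : ContDiff ℝ (⊤ : ℕ∞) G) (m : ℕ) :
    ContDiff ℝ (⊤ : ℕ∞) ((Lop n)^[m] G) := by
  induction m generalizing G with
  | zero => exact hG
  | succ m ih => exact ih (cd_Lop n hG)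

theorem lap_radial {n : ℕ} {G : ℝ → ℝ} (hG : ContDiff ℝ (⊤ : ℕ∞) G) :
    eucLap (fun y : EuclideanSpace ℝ (Fin n) => G (‖y‖ ^ 2))
      = fun y => Lop n G (‖y‖ ^ 2) := by
  rw [lap_eq]
  funext y
  have key : ∀ i, pd i (pd i (fun y : EuclideanSpace ℝ (Fin n) => G (‖y‖ ^ 2))) y
      = 2 * deriv G (‖y‖ ^ 2) + 4 * (y i) ^ 2 * deriv (deriv G) (‖y‖ ^ 2) := by
    intro i
    rw [pd_radial hG]
    unfold pd
    have h1 := ((hasFDerivAt_coord i y).const_mul 2).mul (hasFDerivAt_radial (cd_deriv hG) y)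
    have h2 : fderiv ℝ (fun y : EuclideanSpace ℝ (Fin n) => 2 * y i * deriv G (‖y‖ ^ 2)) y = _ :=
      h1.fderiv
    rw [h2]
    simp [EuclideanSpace.inner_single_right]
    ring
  simp only [key]
  rw [Finset.sum_add_distrib, ← Finset.sum_mul, ← Finset.sum_mul, ← Finset.mul_sum,
    ← EuclideanSpace.real_norm_sq_eq]
  simp only [Lop, Finset.sum_const, Finset.card_univ, Fintype.card_fin, nsmul_eq_mul]
  ring

theorem lapi_radial {n : ℕ} {G : ℝ → ℝ} (hG : ContDiff ℝ (⊤ : ℕ∞) G) (m : ℕ) :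
    eucLap^[m] (fun y : EuclideanSpace ℝ (Fin n) => G (‖y‖ ^ 2))
      = fun y => (Lop n)^[m] G (‖y‖ ^ 2) := by
  induction m generalizing G with
  | zero => rfl
  | succ m ih =>
    rw [Function.iterate_succ_apply, lap_radial hG, ih (cd_Lop n hG)]
    rfl

theorem hcs_of_vanish {n : ℕ} {f : EuclideanSpace ℝ (Fin n) → ℝ} (r : ℝ)
    (h : ∀ x, r < ‖x‖ → f x = 0) : HasCompactSupport f := by
  refine HasCompactSupport.intro (isCompact_closedBall 0 r) fun x hx => h x ?_
  simpa using hx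

theorem hcs_radial {n : ℕ} {F : ℝ → ℝ} (h : ∀ t, 1 ≤ t → F t = 0) :
    HasCompactSupport (fun y : EuclideanSpace ℝ (Fin n) => F (‖y‖ ^ 2)) :=
  hcs_of_vanish 1 fun x hx => h _ (by nlinarith)

theorem poly_primitive (S : Polynomial ℝ) : ∃ R : Polynomial ℝ, R.derivative = S := by
  induction S using Polynomial.induction_on' with
  | add p q hp hq =>
    obtain ⟨a, ha⟩ := hp
    obtain ⟨b, hb⟩ := hq
    exact ⟨a + b, by simp [ha, hb]⟩
  | monomial m a =>
    refine ⟨Polynomial.monomial (m + 1) (a / (m + 1)), ?_⟩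
    rw [Polynomial.derivative_monomial]
    congr 1
    have : (m : ℝ) + 1 ≠ 0 := by positivity
    push_cast
    field_simp

theorem avg_deriv {n : ℕ} {w φ : EuclideanSpace ℝ (Fin n) → ℝ} (hw : Sm w) (hφ : Continuous φ)
    (hc : ∀ y, 1 < ‖y‖ → φ y = 0) (x : EuclideanSpace ℝ (Fin n)) (t : ℝ) :
    HasDerivAt (fun t => ∫ y, φ y * w (x + t • y))
      (∫ y, φ y * ∑ i, y i * pd i w (x + t • y)) t := by
  have hcs := hcs_of_vanish 1 hc
  have hpt : ∀ (s : ℝ) (y : EuclideanSpace ℝ (Fin n)),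
      HasDerivAt (fun s => φ y * w (x + s • y)) (φ y * ∑ i, y i * pd i w (x + s • y)) s := by
    intro s y
    have h1 : HasDerivAt (fun s : ℝ => x + s • y) y s := by
      simpa using ((hasDerivAt_id s).smul_const y).const_add x
    have h2 := (hw.diff (x + s • y)).hasFDerivAt.comp_hasDerivAt s h1
    have h3 : fderiv ℝ w (x + s • y) y = ∑ i, y i * pd i w (x + s • y) := by
      have hy : y = ∑ i, y i • EuclideanSpace.single i (1 : ℝ) := by
        ext j
        simp [Pi.single_apply]
      conv_lhs => rw [hy]
      rw [map_sum]
      simp only [map_smul, smul_eq_mul]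
      rw [← hy]
      rfl
    rw [← h3]
    exact h2.const_mul _
  have hcont : Continuous (fun p : ℝ × EuclideanSpace ℝ (Fin n) =>
      φ p.2 * ∑ i, p.2 i * pd i w (x + p.1 • p.2)) := by
    have : ∀ i, Continuous (pd i w) := fun i => (hw.pd i).cont
    refine (hφ.comp continuous_snd).mul (continuous_finsetSum _ fun i _ => ?_)
    refine Continuous.mul ?_ ((this i).comp (by fun_prop))
    fun_prop
  obtain ⟨B, hB⟩ := ((isCompact_closedBall t 1).prod
    (isCompact_closedBall (0 : EuclideanSpace ℝ (Fin n)) 1)).exists_bound_of_continuousOn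
    hcont.continuousOn
  have := hasDerivAt_integral_of_dominated_loc_of_deriv_le (μ := volume)
    (F := fun s y => φ y * w (x + s • y))
    (F' := fun s y => φ y * ∑ i, y i * pd i w (x + s • y)) (x₀ := t)
    (bound := (Metric.closedBall (0 : EuclideanSpace ℝ (Fin n)) 1).indicator fun _ => B)
    (s := Metric.ball t 1) (Metric.ball_mem_nhds t one_pos) ?_ ?_ ?_ ?_ ?_ ?_
  · exact this.2
  · refine Eventually.of_forall fun s => ?_
    have := hw.cont
    exact Continuous.aestronglyMeasurable (by fun_prop)
  · simp_rw [mul_comm (φ _)]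
    exact int_mul (hw.affine t x).cont hφ hcs
  · exact (hcont.comp (Continuous.prodMk_right t)).aestronglyMeasurable
  · refine Eventually.of_forall fun y s hs => ?_
    by_cases hy : y ∈ Metric.closedBall (0 : EuclideanSpace ℝ (Fin n)) 1
    · rw [Set.indicator_of_mem hy]
      exact hB (s, y) ⟨Metric.ball_subset_closedBall hs, hy⟩
    · rw [Set.indicator_of_notMem hy, hc y (by simpa using hy)]
      simp
  · rw [integrable_indicator_iff Metric.isClosed_closedBall.measurableSet]
    refine integrableOn_const ?_
    exact (isCompact_closedBall _ _).measure_lt_top.ne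
  · exact Eventually.of_forall fun y s _ => hpt s y

theorem avg_poly {n : ℕ} (N : ℕ) : ∀ (w : EuclideanSpace ℝ (Fin n) → ℝ), Sm w →
    (eucLap^[N] w = fun _ => 0) → ∀ F : ℝ → ℝ, ContDiff ℝ (⊤ : ℕ∞) F → (∀ t, 1 ≤ t → F t = 0) →
    ∀ x, ∃ P : Polynomial ℝ, ∀ t : ℝ, ∫ y, F (‖y‖ ^ 2) * w (x + t • y) = P.eval t := by
  induction N with
  | zero =>
    intro w hw h0 F hF hF1 x
    refine ⟨0, fun t => ?_⟩
    have : w = fun _ => 0 := h0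
    simp [this]
  | succ N ih =>
    intro w hw h0 F hF hF1 x
    obtain ⟨G, hG, hG', hGi⟩ := exists_primitive (fun t => F t / 2) (hF.div_const 2) 1
    have hG1 : ∀ t, 1 ≤ t → G t = 0 := by
      intro t ht
      rw [hGi]
      rw [intervalIntegral.integral_congr (g := fun _ => 0)]
      · simp
      · intro s hs
        rw [Set.uIcc_of_le ht] at hs
        simp [hF1 s hs.1]
    obtain ⟨Q, hQ⟩ := ih (eucLap w) hw.lap h0 G hG hG1 x
    obtain ⟨P, hP⟩ := poly_primitive (-(Polynomial.X * Q))
    set ψ := fun y : EuclideanSpace ℝ (Fin n) => G (‖y‖ ^ 2) with hψ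
    have hψs : Sm ψ := Sm.radial hG
    have hψc : HasCompactSupport ψ := hcs_radial hG1
    have hd : ∀ t, HasDerivAt (fun t => ∫ y, F (‖y‖ ^ 2) * w (x + t • y)) (P.derivative.eval t) t := by
      intro t
      have h1 := avg_deriv (φ := fun y => F (‖y‖ ^ 2)) hw (Sm.radial hF).cont
        (fun y hy => hF1 _ (by nlinarith)) x t
      convert h1 using 1
      rw [hP]
      simp only [Polynomial.eval_neg, Polynomial.eval_mul, Polynomial.eval_X]
      rw [← hQ]
      have e1 : ∀ y : EuclideanSpace ℝ (Fin n), F (‖y‖ ^ 2) * ∑ i, y i * pd i w (x + t • y)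
          = ∑ i, pd i w (x + t • y) * pd i ψ y := by
        intro y
        rw [Finset.mul_sum]
        refine Finset.sum_congr rfl fun i _ => ?_
        rw [hψ, pd_radial hG]
        simp only [hG']
        ring
      simp only [e1]
      rw [integral_finsetSum]
      · have e2 : ∀ i, ∫ y, pd i w (x + t • y) * pd i ψ y
            = - ∫ y, t * pd i (pd i w) (x + t • y) * ψ y := by
          intro i
          rw [ibp ((hw.pd i).affine t x) hψs hψc, pd_affine (hw.pd i)]
        simp only [e2, Finset.sum_neg_distrib]
        rw [← integral_finsetSum]
        · rw [← integral_const_mul]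
          congr 1
          congr 1
          funext y
          rw [lap_eq, ← Finset.sum_mul, ← Finset.mul_sum]
          simp only [hψ]
          ring
        · intro i _
          refine int_mul ?_ hψs.cont hψc
          exact continuous_const.mul ((((hw.pd i).pd i).affine t x).cont)
      · intro i _
        exact int_mul (((hw.pd i).affine t x).cont) (hψs.pd i).cont (hcs_pd hψc i)
    refine ⟨P + Polynomial.C ((∫ y, F (‖y‖ ^ 2) * w (x + (0 : ℝ) • y)) - P.eval 0), fun t => ?_⟩
    have hd2 : ∀ t, HasDerivAt (fun t => (∫ y, F (‖y‖ ^ 2) * w (x + t • y)) - P.eval t) 0 t := by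
      intro t
      have := (hd t).sub (P.hasDerivAt t)
      rw [sub_self] at this
      exact this
    have := is_const_of_deriv_eq_zero (fun t => (hd2 t).differentiableAt)
      (fun t => (hd2 t).deriv) t 0
    simp only [Polynomial.eval_add, Polynomial.eval_C]
    linarith

theorem liouville {n : ℕ} (N : ℕ) (w : EuclideanSpace ℝ (Fin n) → ℝ) (hw : Sm w)
    (h0 : eucLap^[N] w = fun _ => 0) (C β : ℝ) (hβ0 : 0 ≤ β) (hβ : β < 1)
    (hg : ∀ x, |w x| ≤ C * (1 + ‖x‖) ^ β) (x : EuclideanSpace ℝ (Fin n)) : w x = w 0 := by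
  set F : ℝ → ℝ := fun t => Real.smoothTransition (1 - t) with hFdef
  have hF : ContDiff ℝ (⊤ : ℕ∞) F := Real.smoothTransition.contDiff.comp (by fun_prop)
  have hF1 : ∀ t, 1 ≤ t → F t = 0 := fun t ht =>
    Real.smoothTransition.zero_of_nonpos (by linarith)
  set φ := fun y : EuclideanSpace ℝ (Fin n) => F (‖y‖ ^ 2) with hφ
  have hφs : Sm φ := Sm.radial hF
  have hφc : HasCompactSupport φ := hcs_radial hF1
  obtain ⟨P, hP⟩ := avg_poly N w hw h0 F hF hF1 x
  obtain ⟨Q, hQ⟩ := avg_poly N w hw h0 F hF hF1 0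
  have hC : 0 ≤ C := by
    have := hg 0
    simp at this
    exact (abs_nonneg _).trans this
  obtain ⟨K, hK⟩ : ∃ K, LipschitzWith K φ :=
    ContDiff.lipschitzWith_of_hasCompactSupport hφc hφs (by simp)
  have hint : ∀ (t : ℝ) z, Integrable (fun y => φ y * w (z + t • y)) := by
    intro t z
    simp_rw [mul_comm (φ _)]
    exact int_mul (hw.affine t z).cont hφs.cont hφc
  set V := (volume (Metric.closedBall (0 : EuclideanSpace ℝ (Fin n)) 2)).toReal with hV
  have hbound : ∀ t : ℝ, 1 + ‖x‖ ≤ t →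
      |(P - Q).eval t| ≤ (K * ‖x‖ * C * V) * (t⁻¹ * (1 + 2 * t) ^ β) := by
    intro t ht
    have ht0 : 0 < t := by linarith [norm_nonneg x]
    have e1 : (P - Q).eval t = ∫ y, (φ (y - t⁻¹ • x) - φ y) * w (t • y) := by
      rw [Polynomial.eval_sub, ← hP, ← hQ]
      have : ∫ y, F (‖y‖ ^ 2) * w (x + t • y) = ∫ y, φ (y - t⁻¹ • x) * w (t • y) := by
        rw [← integral_sub_right_eq_self (fun y => F (‖y‖ ^ 2) * w (x + t • y)) (t⁻¹ • x)]
        congr 1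
        funext y
        rw [smul_sub, smul_inv_smul₀ ht0.ne']
        simp [hφ]
      rw [this, ← integral_sub]
      · simp [sub_mul, hφ]
      · have := (hint t x).comp_sub_right (t⁻¹ • x)
        refine this.congr (Eventually.of_forall fun y => ?_)
        simp only [smul_sub, smul_inv_smul₀ ht0.ne']
        simp
      · simpa using hint t 0
    have hxt : ‖t⁻¹ • x‖ ≤ 1 := by
      rw [norm_smul, norm_inv, Real.norm_of_nonneg ht0.le, inv_mul_le_iff₀ ht0]
      linarith
    have e2 : ∀ y, ‖(φ (y - t⁻¹ • x) - φ y) * w (t • y)‖ ≤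
        (Metric.closedBall (0 : EuclideanSpace ℝ (Fin n)) 2).indicator
          (fun _ => (K * ‖x‖ * C) * (t⁻¹ * (1 + 2 * t) ^ β)) y := by
      intro y
      by_cases hy : y ∈ Metric.closedBall (0 : EuclideanSpace ℝ (Fin n)) 2
      · rw [Set.indicator_of_mem hy, norm_mul]
        have hy' : ‖y‖ ≤ 2 := by simpa using hy
        have a1 : ‖φ (y - t⁻¹ • x) - φ y‖ ≤ K * (t⁻¹ * ‖x‖) := by
          have := hK.dist_le_mul (y - t⁻¹ • x) y
          rw [dist_eq_norm, dist_eq_norm] at this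
          simpa [norm_smul, abs_of_pos ht0] using this
        have a2 : ‖w (t • y)‖ ≤ C * (1 + 2 * t) ^ β := by
          refine (hg _).trans ?_
          have : ‖t • y‖ ≤ 2 * t := by
            rw [norm_smul, Real.norm_of_nonneg ht0.le]; nlinarith
          gcongr
        calc _ ≤ K * (t⁻¹ * ‖x‖) * (C * (1 + 2 * t) ^ β) := by gcongr
          _ = _ := by ring
      · rw [Set.indicator_of_notMem hy]
        have hy' : 2 < ‖y‖ := by simpa using hy
        have h1 : φ y = 0 := hF1 _ (by nlinarith)
        have h2 : φ (y - t⁻¹ • x) = 0 := by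
          have : 1 ≤ ‖y - t⁻¹ • x‖ := by
            have := norm_sub_norm_le y (t⁻¹ • x)
            linarith
          exact hF1 _ (by nlinarith)
        simp [h1, h2]
    rw [e1, ← Real.norm_eq_abs]
    refine (norm_integral_le_of_norm_le ?_ (Eventually.of_forall e2)).trans ?_
    · rw [integrable_indicator_iff Metric.isClosed_closedBall.measurableSet]
      exact integrableOn_const (isCompact_closedBall _ _).measure_lt_top.ne
    · rw [integral_indicator Metric.isClosed_closedBall.measurableSet, setIntegral_const]
      simp only [smul_eq_mul, Measure.real, ← hV]
      apply le_of_eq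
      ring
  have hlim : Tendsto (fun t => (P - Q).eval t) atTop (𝓝 0) := by
    have h1 : Tendsto (fun t : ℝ => (K * ‖x‖ * C * V) * (3 ^ β * t ^ (-(1 - β)))) atTop (𝓝 0) := by
      have := (tendsto_rpow_neg_atTop (y := 1 - β) (by linarith)).const_mul (3 ^ β)
      simpa using this.const_mul (K * ‖x‖ * C * V)
    refine squeeze_zero_norm' ?_ h1
    filter_upwards [eventually_ge_atTop (1 + ‖x‖)] with t ht
    refine (hbound t ht).trans ?_
    have ht1 : 1 ≤ t := by linarith [norm_nonneg x]
    have ht0 : 0 < t := by linarith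
    have : t⁻¹ * (1 + 2 * t) ^ β ≤ 3 ^ β * t ^ (-(1 - β)) := by
      calc t⁻¹ * (1 + 2 * t) ^ β ≤ t⁻¹ * (3 * t) ^ β := by
            gcongr; linarith
        _ = 3 ^ β * t ^ (-(1 - β)) := by
            rw [Real.mul_rpow (by norm_num) ht0.le, neg_sub, Real.rpow_sub ht0, Real.rpow_one]
            field_simp
    have hV0 : 0 ≤ V := ENNReal.toReal_nonneg
    gcongr
  have hzero := (Polynomial.tendsto_nhds_iff _).1 hlim
  have hPQ : P - Q = 0 := Polynomial.leadingCoeff_eq_zero.1 hzero.1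
  have h1 : P.eval 0 = Q.eval 0 := by rw [sub_eq_zero.1 hPQ]
  rw [← hP, ← hQ] at h1
  simp only [zero_smul, add_zero] at h1
  rw [integral_mul_const, integral_mul_const] at h1
  have hpos : 0 < ∫ y : EuclideanSpace ℝ (Fin n), F (‖y‖ ^ 2) := by
    refine hφs.cont.integral_pos_of_hasCompactSupport_nonneg_nonzero hφc
      (fun y => Real.smoothTransition.nonneg _) (x := 0) ?_
    simp [hFdef]
  exact mul_left_cancel₀ hpos.ne' h1

theorem cd_cut_rpow (b : ℝ) :
    ContDiff ℝ (⊤ : ℕ∞) (fun t : ℝ => Real.smoothTransition (4 * t - 1) * t ^ b) := by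
  rw [contDiff_iff_contDiffAt]
  intro t
  by_cases ht : t < 1 / 4
  · have : (fun t : ℝ => Real.smoothTransition (4 * t - 1) * t ^ b) =ᶠ[𝓝 t] fun _ => 0 := by
      filter_upwards [gt_mem_nhds ht] with s hs
      rw [Real.smoothTransition.zero_of_nonpos (by linarith), zero_mul]
    exact contDiffAt_const.congr_of_eventuallyEq this
  · have h1 : ContDiff ℝ (⊤ : ℕ∞) (fun t : ℝ => Real.smoothTransition (4 * t - 1)) :=
      Real.smoothTransition.contDiff.comp (by fun_prop)
    refine h1.contDiffAt.mul ?_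
    exact Real.contDiffAt_rpow_const_of_ne (by linarith)

theorem Lop_rpow (n : ℕ) {G : ℝ → ℝ} {c b : ℝ}
    (h : ∀ t, 1 / 2 < t → deriv G t = c * t ^ b) :
    ∀ t, 1 / 2 < t → Lop n G t = c * (2 * n + 4 * b) * t ^ b := by
  intro t ht
  have ht0 : 0 < t := by linarith
  have h2 : deriv (deriv G) t = c * (b * t ^ (b - 1)) := by
    have : deriv G =ᶠ[𝓝 t] fun t => c * t ^ b := by
      filter_upwards [lt_mem_nhds ht] with s hs using h s hs
    rw [this.deriv_eq]
    exact ((Real.hasDerivAt_rpow_const (Or.inl ht0.ne')).const_mul c).deriv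
  unfold Lop
  rw [h t ht, h2, Real.rpow_sub ht0, Real.rpow_one]
  field_simp

theorem kernel_exists (n k : ℕ) (hk : 1 ≤ k) (hkn : 2 * k < n) :
    ∃ G : ℝ → ℝ, ContDiff ℝ (⊤ : ℕ∞) G ∧
      (∀ t, 1 / 2 < t → deriv G t = t ^ ((k : ℝ) - n / 2)) ∧
      (∃ c, c ≠ 0 ∧ ∀ t, 1 / 2 < t → (Lop n)^[k] G t = c * t ^ (1 - (n : ℝ) / 2)) ∧
      (∀ t, 1 / 2 < t → (Lop n)^[k + 1] G t = 0) := by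
  obtain ⟨G, hG, hG', -⟩ := exists_primitive _ (cd_cut_rpow ((k : ℝ) - n / 2)) 0
  have h1 : ∀ t, 1 / 2 < t → deriv G t = t ^ ((k : ℝ) - n / 2) := by
    intro t ht
    rw [hG', Real.smoothTransition.one_of_one_le (by linarith), one_mul]
  have hkn' : (2 * k : ℝ) < n := by exact_mod_cast hkn
  have h2 : ∀ j : ℕ, j + 1 ≤ k → ∃ c, c ≠ 0 ∧ ∀ t, 1 / 2 < t →
      (Lop n)^[j + 1] G t = c * t ^ ((k : ℝ) - n / 2 - j) := by
    intro j
    induction j with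
    | zero =>
      intro _
      refine ⟨1 * (2 * n + 4 * ((k : ℝ) - n / 2)), ?_, ?_⟩
      · have : (0 : ℝ) < k := by exact_mod_cast hk
        have : (1 * (2 * n + 4 * ((k : ℝ) - n / 2))) = 4 * k := by ring
        rw [this]; positivity
      · intro t ht
        have := Lop_rpow n (G := G) (c := 1) (b := (k : ℝ) - n / 2)
          (by intro t ht; rw [h1 t ht, one_mul]) t ht
        simpa using this
    | succ j ih =>
      intro hj
      obtain ⟨c, hc, h⟩ := ih (by omega)
      have hjr : (j : ℝ) + 2 ≤ k := by exact_mod_cast hj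
      set e := (k : ℝ) - n / 2 - j with he
      have e1 : ∀ t, 1 / 2 < t → deriv ((Lop n)^[j + 1] G) t = (c * e) * t ^ (e - 1) := by
        intro t ht
        have ht0 : 0 < t := by linarith
        have : (Lop n)^[j + 1] G =ᶠ[𝓝 t] fun t => c * t ^ e := by
          filter_upwards [lt_mem_nhds ht] with s hs using h s hs
        rw [this.deriv_eq]
        rw [((Real.hasDerivAt_rpow_const (p := e) (Or.inl ht0.ne')).const_mul c).deriv]
        ring
      refine ⟨c * e * (2 * n + 4 * (e - 1)), ?_, ?_⟩
      · refine mul_ne_zero (mul_ne_zero hc ?_) ?_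
        · apply ne_of_lt
          have : (0 : ℝ) ≤ j := by positivity
          rw [he]; linarith
        · have : 2 * n + 4 * (e - 1) = 4 * ((k : ℝ) - j - 1) := by rw [he]; ring
          rw [this]
          apply ne_of_gt
          linarith
      · intro t ht
        rw [Function.iterate_succ_apply', Lop_rpow n e1 t ht]
        congr 2
        push_cast
        rw [he]; ring
  obtain ⟨c, hc, h3⟩ := h2 (k - 1) (by omega)
  have hk1 : k - 1 + 1 = k := by omega
  rw [hk1] at h3
  have hee : (k : ℝ) - n / 2 - ((k - 1 : ℕ) : ℝ) = 1 - (n : ℝ) / 2 := by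
    rw [Nat.cast_sub hk]; push_cast; ring
  rw [hee] at h3
  refine ⟨G, hG, h1, ⟨c, hc, h3⟩, ?_⟩
  intro t ht
  set e := 1 - (n : ℝ) / 2 with he
  have e1 : ∀ t, 1 / 2 < t → deriv ((Lop n)^[k] G) t = (c * e) * t ^ (e - 1) := by
    intro t ht
    have ht0 : 0 < t := by linarith
    have : (Lop n)^[k] G =ᶠ[𝓝 t] fun t => c * t ^ e := by
      filter_upwards [lt_mem_nhds ht] with s hs using h3 s hs
    rw [this.deriv_eq]
    rw [((Real.hasDerivAt_rpow_const (p := e) (Or.inl ht0.ne')).const_mul c).deriv]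
    ring
  rw [Function.iterate_succ_apply', Lop_rpow n e1 t ht]
  have : 2 * n + 4 * (e - 1) = 0 := by rw [he]; ring
  rw [this]; simp

theorem integral_Lop {n : ℕ} (hn : 2 < n) {G : ℝ → ℝ} (hG : ContDiff ℝ (⊤ : ℕ∞) G)
    (h0 : ∀ t, 1 / 2 < t → Lop n G t = 0) {c : ℝ} (hc : c ≠ 0)
    (h1 : ∀ t, 1 / 2 < t → G t = c * t ^ (1 - (n : ℝ) / 2)) :
    ∫ y : EuclideanSpace ℝ (Fin n), Lop n G (‖y‖ ^ 2) ≠ 0 := by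
  have : Nontrivial (EuclideanSpace ℝ (Fin n)) := by
    have : Nonempty (Fin n) := ⟨⟨0, by omega⟩⟩
    infer_instance
  have hp := integral_fun_norm_addHaar (volume : Measure (EuclideanSpace ℝ (Fin n)))
    (fun r => Lop n G (r ^ 2))
  rw [hp]
  simp only [finrank_euclideanSpace, Fintype.card_fin]
  have hnn : (2 : ℝ) < n := by exact_mod_cast hn
  have hderiv : ∀ r : ℝ, HasDerivAt (fun r : ℝ => 2 * (r ^ n * deriv G (r ^ 2)))
      (r ^ (n - 1) • Lop n G (r ^ 2)) r := by
    intro r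
    have a1 : HasDerivAt (fun r : ℝ => r ^ n) (n * r ^ (n - 1)) r := hasDerivAt_pow n r
    have a2 : HasDerivAt (deriv G) (deriv (deriv G) (r ^ 2)) (r ^ 2) :=
      (((cd_deriv hG).differentiable (by simp)) _).hasDerivAt
    have a3 : HasDerivAt (fun r : ℝ => r ^ 2) (2 * r) r := by simpa using hasDerivAt_pow 2 r
    have a4 := (a1.mul (HasDerivAt.comp (h₂ := deriv G) (h := fun r : ℝ => r ^ 2) r a2 a3)).const_mul 2
    have hrn : r ^ n = r ^ (n - 1) * r := by
      rw [← pow_succ]; congr 1; omega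
    refine HasDerivAt.congr_deriv a4 ?_
    unfold Lop
    simp only [smul_eq_mul, Function.comp, hrn]
    ring
  have hI : ∫ r in Set.Ioi (0 : ℝ), r ^ (n - 1) • Lop n G (r ^ 2)
      = ∫ r in (0 : ℝ)..1, r ^ (n - 1) • Lop n G (r ^ 2) := by
    rw [intervalIntegral.integral_of_le zero_le_one]
    refine setIntegral_eq_of_subset_of_forall_sdiff_eq_zero measurableSet_Ioi
      (fun x hx => hx.1) ?_
    · intro x hx
      have : (1 : ℝ) < x := by
        by_contra hcon
        exact hx.2 ⟨hx.1, not_lt.1 hcon⟩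
      rw [h0 _ (by nlinarith)]
      simp
  have hcont : Continuous (fun r : ℝ => r ^ (n - 1) • Lop n G (r ^ 2)) := by
    have := (cd_Lop n hG).continuous
    fun_prop
  rw [hI, intervalIntegral.integral_eq_sub_of_hasDerivAt (fun r _ => hderiv r)
    (hcont.intervalIntegrable _ _)]
  have hd1 : deriv G 1 = c * (1 - (n : ℝ) / 2) := by
    have : G =ᶠ[𝓝 1] fun t => c * t ^ (1 - (n : ℝ) / 2) := by
      filter_upwards [lt_mem_nhds (show (1 / 2 : ℝ) < 1 by norm_num)] with s hs using h1 s hs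
    rw [this.deriv_eq]
    rw [((Real.hasDerivAt_rpow_const (p := 1 - (n : ℝ) / 2) (Or.inl one_ne_zero)).const_mul c).deriv]
    simp
  have hn0 : n ≠ 0 := by omega
  simp only [one_pow, hd1, zero_pow hn0, one_mul, zero_mul, mul_zero, sub_zero]
  have hvol : (volume : Measure (EuclideanSpace ℝ (Fin n))).real (Metric.ball 0 1) ≠ 0 := by
    rw [Measure.real, ENNReal.toReal_ne_zero]
    exact ⟨(Metric.measure_ball_pos _ _ one_pos).ne', Metric.isBounded_ball.measure_lt_top.ne⟩
  have hx : (1 - (n : ℝ) / 2) ≠ 0 := by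
    apply ne_of_lt; linarith
  simp [hn0, hc, hx]
  intro h
  exact absurd h hvol

theorem taylor_bd {n k : ℕ} {G : ℝ → ℝ} (hkn : 2 * k < n) (hG : ContDiff ℝ (⊤ : ℕ∞) G)
    (h1 : ∀ t, 1 / 2 < t → deriv G t = t ^ ((k : ℝ) - n / 2))
    (x y : EuclideanSpace ℝ (Fin n)) (hx : 2 ≤ ‖x‖) (hxy : 2 * ‖y‖ ≤ ‖x‖) :
    |G (‖x - y‖ ^ 2) - G (‖x‖ ^ 2) + 2 * deriv G (‖x‖ ^ 2) * inner ℝ x y|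
      ≤ ((4 * |(k : ℝ) - n / 2| + 2) * 4 ^ (-((k : ℝ) - n / 2))) *
        (‖x‖ ^ ((2 * k : ℝ) - n) * ‖y‖ ^ 2) := by
  set b := (k : ℝ) - n / 2 with hb
  have hkn' : (2 * k : ℝ) < n := by exact_mod_cast hkn
  have hb0 : b < 0 := by rw [hb]; linarith
  set M := ((4 * |b| + 2) * 4 ^ (-b)) * (‖x‖ ^ ((2 * k : ℝ) - n) * ‖y‖ ^ 2) with hM
  have hx0 : 0 < ‖x‖ := by linarith
  have hM0 : 0 ≤ M := by positivity
  have hq : ∀ s : ℝ, HasDerivAt (fun s : ℝ => ‖x - s • y‖ ^ 2) (-2 * inner ℝ (x - s • y) y) s := by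
    intro s
    have a1 : HasDerivAt (fun s : ℝ => x - s • y) (-y) s := by
      simpa using ((hasDerivAt_id s).smul_const y).const_sub x
    have := a1.norm_sq
    convert this using 1
    simp [inner_neg_right]
  have hq' : ∀ s : ℝ, HasDerivAt (fun s : ℝ => -2 * inner ℝ (x - s • y) y) (2 * ‖y‖ ^ 2) s := by
    intro s
    have a1 : HasDerivAt (fun s : ℝ => x - s • y) (-y) s := by
      simpa using ((hasDerivAt_id s).smul_const y).const_sub x
    have := ((a1.inner ℝ (hasDerivAt_const s y)).const_mul (-2))
    have e : -2 * (inner ℝ (x - s • y) 0 + inner ℝ (-y) y) = 2 * ‖y‖ ^ 2 := by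
      rw [inner_neg_left, inner_zero_right, real_inner_self_eq_norm_sq]
      ring
    rw [e] at this
    exact this
  have hψ : ∀ s : ℝ, HasDerivAt (fun s : ℝ => G (‖x - s • y‖ ^ 2))
      (deriv G (‖x - s • y‖ ^ 2) * (-2 * inner ℝ (x - s • y) y)) s := by
    intro s
    have a2 : HasDerivAt G (deriv G (‖x - s • y‖ ^ 2)) (‖x - s • y‖ ^ 2) :=
      ((hG.differentiable (by simp)) _).hasDerivAt
    exact a2.comp s (hq s)
  have hψ' : ∀ s : ℝ, HasDerivAt
      (fun s : ℝ => deriv G (‖x - s • y‖ ^ 2) * (-2 * inner ℝ (x - s • y) y))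
      (deriv (deriv G) (‖x - s • y‖ ^ 2) * (-2 * inner ℝ (x - s • y) y) *
        (-2 * inner ℝ (x - s • y) y) + deriv G (‖x - s • y‖ ^ 2) * (2 * ‖y‖ ^ 2)) s := by
    intro s
    have a2 : HasDerivAt (deriv G) (deriv (deriv G) (‖x - s • y‖ ^ 2)) (‖x - s • y‖ ^ 2) :=
      (((cd_deriv hG).differentiable (by simp)) _).hasDerivAt
    exact (a2.comp s (hq s)).mul (hq' s)
  have hbd : ∀ s ∈ Set.Icc (0 : ℝ) 1,
      ‖deriv (deriv G) (‖x - s • y‖ ^ 2) * (-2 * inner ℝ (x - s • y) y) *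
        (-2 * inner ℝ (x - s • y) y) + deriv G (‖x - s • y‖ ^ 2) * (2 * ‖y‖ ^ 2)‖ ≤ M := by
    intro s hs
    have hz : ‖x‖ / 2 ≤ ‖x - s • y‖ := by
      have a := norm_sub_norm_le x (s • y)
      have : ‖s • y‖ ≤ ‖y‖ := by
        rw [norm_smul, Real.norm_of_nonneg hs.1]
        nlinarith [norm_nonneg y, hs.2]
      linarith
    set z := x - s • y with hzdef
    have hz1 : 1 ≤ ‖z‖ := by linarith
    have hz2 : 1 ≤ ‖z‖ ^ 2 := by nlinarith
    have hzp : 0 < ‖z‖ ^ 2 := by linarith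
    have d2 : deriv (deriv G) (‖z‖ ^ 2) = b * (‖z‖ ^ 2) ^ (b - 1) := by
      have : deriv G =ᶠ[𝓝 (‖z‖ ^ 2)] fun t => t ^ b := by
        filter_upwards [lt_mem_nhds (show 1 / 2 < ‖z‖ ^ 2 by linarith)] with u hu using h1 u hu
      rw [this.deriv_eq]
      exact (Real.hasDerivAt_rpow_const (Or.inl hzp.ne')).deriv
    rw [d2, h1 _ (by linarith)]
    have hin : (inner ℝ z y) ^ 2 ≤ ‖z‖ ^ 2 * ‖y‖ ^ 2 := by
      have := abs_real_inner_le_norm z y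
      rw [← mul_pow, ← sq_abs]
      gcongr
    have hsub : (‖z‖ ^ 2) ^ (b - 1) = (‖z‖ ^ 2) ^ b / ‖z‖ ^ 2 := by
      rw [Real.rpow_sub hzp, Real.rpow_one]
    set u := (‖z‖ ^ 2) ^ b with hu
    have hu0 : 0 ≤ u := by positivity
    have hstep : ‖b * (‖z‖ ^ 2) ^ (b - 1) * (-2 * inner ℝ z y) * (-2 * inner ℝ z y)
        + u * (2 * ‖y‖ ^ 2)‖ ≤ (4 * |b| + 2) * u * ‖y‖ ^ 2 := by
      refine (norm_add_le _ _).trans ?_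
      have t1 : ‖b * (‖z‖ ^ 2) ^ (b - 1) * (-2 * inner ℝ z y) * (-2 * inner ℝ z y)‖
          ≤ 4 * |b| * u * ‖y‖ ^ 2 := by
        have : b * (‖z‖ ^ 2) ^ (b - 1) * (-2 * inner ℝ z y) * (-2 * inner ℝ z y)
            = b * (4 * (u / ‖z‖ ^ 2) * (inner ℝ z y) ^ 2) := by rw [hsub]; ring
        rw [this, norm_mul, Real.norm_eq_abs, Real.norm_of_nonneg (by positivity)]
        calc |b| * (4 * (u / ‖z‖ ^ 2) * (inner ℝ z y) ^ 2)
            ≤ |b| * (4 * (u / ‖z‖ ^ 2) * (‖z‖ ^ 2 * ‖y‖ ^ 2)) := by gcongr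
          _ = _ := by field_simp
      have t2 : ‖u * (2 * ‖y‖ ^ 2)‖ = 2 * u * ‖y‖ ^ 2 := by
        rw [Real.norm_of_nonneg (by positivity)]; ring
      rw [t2]
      linarith
    refine hstep.trans ?_
    have hu2 : u ≤ 4 ^ (-b) * ‖x‖ ^ ((2 * k : ℝ) - n) := by
      have a1 : u ≤ (‖x‖ ^ 2 / 4) ^ b := by
        apply Real.rpow_le_rpow_of_nonpos (by positivity) _ hb0.le
        nlinarith
      refine a1.trans (le_of_eq ?_)
      rw [Real.div_rpow (by positivity) (by norm_num), Real.rpow_neg (by norm_num),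
        ← Real.rpow_natCast, ← Real.rpow_mul hx0.le]
      have : ((2 : ℕ) : ℝ) * b = 2 * k - n := by rw [hb]; push_cast; ring
      rw [this]
      ring
    calc (4 * |b| + 2) * u * ‖y‖ ^ 2
        ≤ (4 * |b| + 2) * (4 ^ (-b) * ‖x‖ ^ ((2 * k : ℝ) - n)) * ‖y‖ ^ 2 := by gcongr
      _ = M := by rw [hM]; ring
  set ψ' := fun s : ℝ => deriv G (‖x - s • y‖ ^ 2) * (-2 * inner ℝ (x - s • y) y) with hψ'def
  have s1 : ∀ s ∈ Set.Icc (0 : ℝ) 1, ‖ψ' s - ψ' 0‖ ≤ M := by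
    intro s hs
    have := (convex_Icc (0 : ℝ) 1).norm_image_sub_le_of_norm_hasDerivWithin_le
      (fun s _ => (hψ' s).hasDerivWithinAt) hbd (Set.left_mem_Icc.2 zero_le_one) hs
    refine this.trans ?_
    rw [sub_zero, Real.norm_of_nonneg hs.1]
    nlinarith [hs.2]
  have s2 := (convex_Icc (0 : ℝ) 1).norm_image_sub_le_of_norm_hasDerivWithin_le
    (f := fun s => G (‖x - s • y‖ ^ 2) - s * ψ' 0) (f' := fun s => ψ' s - ψ' 0) (C := M)
    (fun s _ => by
      have := ((hψ s).sub ((hasDerivAt_id s).mul_const (ψ' 0))).hasDerivWithinAt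
        (s := Set.Icc (0 : ℝ) 1)
      rw [one_mul] at this
      exact this) s1
    (Set.left_mem_Icc.2 zero_le_one) (Set.right_mem_Icc.2 zero_le_one)
  simp only [one_smul, one_mul, zero_smul, sub_zero, zero_mul, norm_one, mul_one,
    Real.norm_eq_abs] at s2
  convert s2 using 2
  simp only [hψ'def, zero_smul, sub_zero]
  ring

noncomputable def KK (n k : ℕ) : ℝ :=
  (4 * |(k : ℝ) - n / 2| + 2) * 4 ^ (-((k : ℝ) - n / 2))

theorem KK_nonneg (n k : ℕ) : 0 ≤ KK n k := by unfold KK; positivity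

theorem cvPhi_bd {n k : ℕ} {G : ℝ → ℝ} (hkn : 2 * k < n) (hG : ContDiff ℝ (⊤ : ℕ∞) G)
    (h1 : ∀ t, 1 / 2 < t → deriv G t = t ^ ((k : ℝ) - n / 2))
    {f : EuclideanSpace ℝ (Fin n) → ℝ} (hf : Continuous f) (r : ℝ)
    (hfr : ∀ x, r < ‖x‖ → f x = 0) (hm0 : ∫ y, f y = 0) (hm1 : ∀ i, ∫ y, y i * f y = 0)
    (x : EuclideanSpace ℝ (Fin n)) (hx : 2 ≤ ‖x‖) (hxr : 2 * r ≤ ‖x‖) :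
    |cv (fun y => G (‖y‖ ^ 2)) f x| ≤
      KK n k * (‖x‖ ^ ((2 * k : ℝ) - n) * r ^ 2) * ∫ y, |f y| := by
  have hfc := hcs_of_vanish r hfr
  have hfi : Integrable f := hf.integrable_of_hasCompactSupport hfc
  have hcoord : ∀ i, Integrable (fun y : EuclideanSpace ℝ (Fin n) => y i * f y) := fun i =>
    int_mul (by fun_prop) hf hfc
  have hΦ : Continuous (fun y : EuclideanSpace ℝ (Fin n) => G (‖x - y‖ ^ 2)) := by
    have := hG.continuous
    fun_prop
  have hin : ∀ y : EuclideanSpace ℝ (Fin n), inner ℝ x y * f y = ∑ i, x i * (y i * f y) := by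
    intro y
    rw [PiLp.inner_apply, Finset.sum_mul]
    refine Finset.sum_congr rfl fun i _ => ?_
    simp
    ring
  have hinner : ∫ y : EuclideanSpace ℝ (Fin n), inner ℝ x y * f y = 0 := by
    simp only [hin]
    rw [integral_finsetSum _ (fun i _ => (hcoord i).const_mul _)]
    refine Finset.sum_eq_zero fun i _ => ?_
    rw [integral_const_mul, hm1, mul_zero]
  have hinneri : Integrable (fun y : EuclideanSpace ℝ (Fin n) => inner ℝ x y * f y) := by
    simp only [hin]
    exact integrable_finsetSum _ (fun i _ => (hcoord i).const_mul _)
  have e1 : cv (fun y => G (‖y‖ ^ 2)) f x = ∫ y, (G (‖x - y‖ ^ 2) - G (‖x‖ ^ 2)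
      + 2 * deriv G (‖x‖ ^ 2) * inner ℝ x y) * f y := by
    have e2 : ∀ y, (G (‖x - y‖ ^ 2) - G (‖x‖ ^ 2)
      + 2 * deriv G (‖x‖ ^ 2) * inner ℝ x y) * f y = G (‖x - y‖ ^ 2) * f y - G (‖x‖ ^ 2) * f y
        + 2 * deriv G (‖x‖ ^ 2) * (inner ℝ x y * f y) := by intro y; ring
    simp only [e2]
    have hi1 : Integrable (fun y => G (‖x - y‖ ^ 2) * f y - G (‖x‖ ^ 2) * f y) :=
      (int_mul hΦ hf hfc).sub (hfi.const_mul _)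
    rw [integral_add hi1 (hinneri.const_mul _),
      integral_sub (int_mul hΦ hf hfc) (hfi.const_mul _), integral_const_mul, integral_const_mul,
      hm0, hinner, cv_comm]
    simp [cv, mul_comm]
  rw [e1, ← integral_const_mul, ← Real.norm_eq_abs]
  refine norm_integral_le_of_norm_le (hfi.abs.const_mul _) (Eventually.of_forall fun y => ?_)
  by_cases hy : r < ‖y‖
  · simp [hfr y hy]
  · push Not at hy
    rw [norm_mul, Real.norm_eq_abs, Real.norm_eq_abs]
    refine mul_le_mul_of_nonneg_right ?_ (abs_nonneg _)
    refine (taylor_bd hkn hG h1 x y hx (by linarith)).trans ?_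
    unfold KK
    have : ‖y‖ ^ 2 ≤ r ^ 2 := by gcongr
    gcongr

theorem cv_const {n k : ℕ} {G : ℝ → ℝ} (hkn : 2 * k < n) (hG : ContDiff ℝ (⊤ : ℕ∞) G)
    (h1 : ∀ t, 1 / 2 < t → deriv G t = t ^ ((k : ℝ) - n / 2))
    {μ : EuclideanSpace ℝ (Fin n) → ℝ}
    (hμ : μ = eucLap^[k + 1] (fun y => G (‖y‖ ^ 2))) (hμ1 : ∀ y, 1 < ‖y‖ → μ y = 0)
    {g f : EuclideanSpace ℝ (Fin n) → ℝ} (hg : Sm g) (hfg : f = eucLap^[k + 1] g) (r : ℝ)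
    (hfr : ∀ x, r < ‖x‖ → f x = 0) (hm0 : ∫ y, f y = 0) (hm1 : ∀ i, ∫ y, y i * f y = 0)
    (C β : ℝ) (hβ0 : 0 ≤ β) (hβ : β < 1) (hgr : ∀ x, |g x| ≤ C * (1 + ‖x‖) ^ β) :
    ∃ c, ∀ x, cv g μ x - cv (fun y => G (‖y‖ ^ 2)) f x = c := by
  set Φ := fun y : EuclideanSpace ℝ (Fin n) => G (‖y‖ ^ 2) with hΦ
  have hΦs : Sm Φ := Sm.radial hG
  have hμs : Sm μ := by rw [hμ]; exact hΦs.lapi _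
  have hfs : Sm f := by rw [hfg]; exact hg.lapi _
  have hμc := hcs_of_vanish 1 hμ1
  have hfc := hcs_of_vanish r hfr
  have hs1 : Sm (cv g μ) := Sm.cv hg.cont hμs hμc
  have hs2 : Sm (cv Φ f) := Sm.cv hΦs.cont hfs hfc
  have hC : 0 ≤ C := by
    have := hgr 0
    simp at this
    exact (abs_nonneg _).trans this
  have hμi : Integrable μ := hμs.cont.integrable_of_hasCompactSupport hμc
  have hsum : (fun x => cv g μ x - cv Φ f x)
      = fun x => ∑ b : Bool, (if b then cv g μ else fun x => (-1) * cv Φ f x) x := by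
    funext x
    simp [sub_eq_add_neg]
  have hsb : ∀ b : Bool, Sm (if b then cv g μ else fun x => (-1) * cv Φ f x) := by
    intro b
    cases b
    · simpa using hs2.const_mul (-1)
    · simpa using hs1
  have hw : Sm (fun x => cv g μ x - cv Φ f x) := by
    rw [hsum]; exact Sm.sum _ hsb
  have hlap : eucLap^[k + 1] (fun x => cv g μ x - cv Φ f x) = fun _ => 0 := by
    rw [hsum, lapi_sum _ hsb]
    have hneg : eucLap^[k + 1] (fun x => (-1) * cv Φ f x)
        = fun x => (-1) * eucLap^[k + 1] (cv Φ f) x := by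
      have : ∀ m, eucLap^[m] (fun x => (-1) * cv Φ f x)
        = fun x => (-1) * eucLap^[m] (cv Φ f) x := by
        intro m
        induction m with
        | zero => rfl
        | succ m ih =>
          rw [Function.iterate_succ_apply', ih, lap_const_mul (hs2.lapi m),
            Function.iterate_succ_apply']
      exact this _
    funext x
    have e1 : eucLap^[k + 1] (cv g μ) = cv f μ := by
      rw [lapi_cv hg.cont hμs hμc, cv_lapi hg hμs hμc, ← hfg]
    have e2 : eucLap^[k + 1] (cv Φ f) = cv μ f := by
      rw [lapi_cv hΦs.cont hfs hfc, cv_lapi hΦs hfs hfc, ← hμ]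
    simp only [Fintype.sum_bool, if_true, Bool.false_eq_true, if_false]
    rw [hneg, e1]
    simp only [e2]
    rw [cv_comm f μ]
    ring
  have hb1 : ∀ x, |cv g μ x| ≤ (C * 2 ^ β * ∫ y, |μ y|) * (1 + ‖x‖) ^ β := by
    intro x
    rw [cv_comm]
    unfold cv
    rw [← Real.norm_eq_abs]
    have : (C * 2 ^ β * ∫ y, |μ y|) * (1 + ‖x‖) ^ β
        = ∫ y, (C * 2 ^ β * (1 + ‖x‖) ^ β) * |μ y| := by
      rw [integral_const_mul]; ring
    rw [this]
    refine norm_integral_le_of_norm_le (hμi.abs.const_mul _) (Eventually.of_forall fun y => ?_)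
    by_cases hy : 1 < ‖y‖
    · simp [hμ1 y hy]
    · push Not at hy
      rw [norm_mul, Real.norm_eq_abs, Real.norm_eq_abs, mul_comm]
      refine mul_le_mul_of_nonneg_right ?_ (abs_nonneg _)
      refine (hgr _).trans ?_
      rw [mul_assoc, ← Real.mul_rpow (by norm_num) (by positivity)]
      have : ‖x - y‖ ≤ ‖x‖ + ‖y‖ := norm_sub_le _ _
      have : 1 + ‖x - y‖ ≤ 2 * (1 + ‖x‖) := by linarith [norm_nonneg x]
      gcongr
  have hkn' : (2 * k : ℝ) < n := by exact_mod_cast hkn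
  obtain ⟨B, hB0, hB⟩ : ∃ B, 0 ≤ B ∧ ∀ x, |cv Φ f x| ≤ B := by
    obtain ⟨B1, hB1⟩ := (isCompact_closedBall (0 : EuclideanSpace ℝ (Fin n))
      (max 2 (2 * r))).exists_bound_of_continuousOn hs2.cont.continuousOn
    refine ⟨max 0 (max B1 (KK n k * (1 * r ^ 2) * ∫ y, |f y|)), le_max_left _ _, fun x => ?_⟩
    by_cases hx : ‖x‖ ≤ max 2 (2 * r)
    · exact (hB1 x (by simpa using hx)).trans ((le_max_left _ _).trans (le_max_right _ _))
    · push Not at hx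
      have hx2 := (le_max_left _ _).trans hx.le
      have hxr := (le_max_right _ _).trans hx.le
      refine (cvPhi_bd hkn hG h1 hfs.cont r hfr hm0 hm1 x hx2 hxr).trans ?_
      refine le_trans ?_ ((le_max_right _ _).trans (le_max_right _ _))
      have a := KK_nonneg n k
      have b : 0 ≤ ∫ y, |f y| := integral_nonneg fun y => abs_nonneg _
      have c : ‖x‖ ^ ((2 * k : ℝ) - n) ≤ 1 :=
        Real.rpow_le_one_of_one_le_of_nonpos (by linarith) (by linarith)
      gcongr
  refine ⟨_, fun x => liouville (k + 1) _ hw hlap ((C * 2 ^ β * ∫ y, |μ y|) + B) β hβ0 hβ ?_ x⟩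
  intro x
  have h1x : 1 ≤ (1 + ‖x‖) ^ β := Real.one_le_rpow (by linarith [norm_nonneg x]) hβ0
  calc |cv g μ x - cv Φ f x| ≤ |cv g μ x| + |cv Φ f x| := abs_sub _ _
    _ ≤ (C * 2 ^ β * ∫ y, |μ y|) * (1 + ‖x‖) ^ β + B := add_le_add (hb1 x) (hB x)
    _ ≤ _ := by nlinarith

theorem scaled_bd {n k : ℕ} {G : ℝ → ℝ} (hkn : 2 * k < n) (hG : ContDiff ℝ (⊤ : ℕ∞) G)
    (h1 : ∀ t, 1 / 2 < t → deriv G t = t ^ ((k : ℝ) - n / 2))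
    {μ : EuclideanSpace ℝ (Fin n) → ℝ}
    (hμ : μ = eucLap^[k + 1] (fun y => G (‖y‖ ^ 2))) (hμ1 : ∀ y, 1 < ‖y‖ → μ y = 0)
    {g f : EuclideanSpace ℝ (Fin n) → ℝ} (hg : Sm g) (hfg : f = eucLap^[k + 1] g) (r : ℝ)
    (hfr : ∀ x, r < ‖x‖ → f x = 0) (hm0 : ∫ y, f y = 0) (hm1 : ∀ i, ∫ y, y i * f y = 0)
    (C β : ℝ) (hβ0 : 0 ≤ β) (hβ : β < 1) (hgr : ∀ x, |g x| ≤ C * (1 + ‖x‖) ^ β)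
    (t : ℝ) (ht0 : 0 < t) (ht1 : t ≤ 1) :
    ∃ c, ∀ x, 2 ≤ ‖x‖ → 2 * r ≤ ‖x‖ → |(∫ y, μ y * g (x + (-t) • y)) - c| ≤
      (KK n k * r ^ 2 * ∫ y, |f y|) * ‖x‖ ^ ((2 * k : ℝ) - n) := by
  have hC : 0 ≤ C := by
    have := hgr 0
    simp at this
    exact (abs_nonneg _).trans this
  set gt := fun y : EuclideanSpace ℝ (Fin n) => g (0 + t • y) with hgt
  set ft := fun y : EuclideanSpace ℝ (Fin n) => t ^ (2 * (k + 1)) * f (0 + t • y) with hft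
  have hgts : Sm gt := hg.affine t 0
  have hftg : ft = eucLap^[k + 1] gt := by
    rw [hgt, lapi_affine hg t 0 (k + 1), ← hfg]
  have hfts : Sm ft := by rw [hftg]; exact hgts.lapi _
  have hnorm : ∀ x : EuclideanSpace ℝ (Fin n), ‖t⁻¹ • x‖ = ‖x‖ / t := by
    intro x
    rw [norm_smul, norm_inv, Real.norm_of_nonneg ht0.le]
    field_simp
  have hfrt : ∀ x, r / t < ‖x‖ → ft x = 0 := by
    intro x hx
    simp only [hft, zero_add]
    rw [hfr, mul_zero]
    rw [norm_smul, Real.norm_of_nonneg ht0.le]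
    rw [div_lt_iff₀ ht0] at hx
    linarith
  have hm0t : ∫ y, ft y = 0 := by
    simp only [hft, zero_add]
    rw [integral_const_mul, Measure.integral_comp_smul, hm0]
    simp
  have hm1t : ∀ i, ∫ y : EuclideanSpace ℝ (Fin n), y i * ft y = 0 := by
    intro i
    have : ∀ y : EuclideanSpace ℝ (Fin n), y i * ft y
        = (t⁻¹ * t ^ (2 * (k + 1))) * ((fun z : EuclideanSpace ℝ (Fin n) => z i * f z) (t • y)) := by
      intro y
      simp only [hft, zero_add, PiLp.smul_apply, smul_eq_mul]
      field_simp
    simp only [this]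
    rw [integral_const_mul,
      Measure.integral_comp_smul volume (fun z : EuclideanSpace ℝ (Fin n) => z i * f z) t, hm1]
    simp
  have hgrt : ∀ x, |gt x| ≤ C * (1 + ‖x‖) ^ β := by
    intro x
    refine (hgr _).trans ?_
    have : ‖0 + t • x‖ ≤ ‖x‖ := by
      rw [zero_add, norm_smul, Real.norm_of_nonneg ht0.le]
      nlinarith [norm_nonneg x]
    gcongr
  have habs : ∫ y, |ft y| = t ^ (2 * (k + 1)) * ((t ^ n)⁻¹ * ∫ y, |f y|) := by
    simp only [hft, zero_add, abs_mul]
    rw [integral_const_mul,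
      Measure.integral_comp_smul volume (fun z : EuclideanSpace ℝ (Fin n) => |f z|) t]
    rw [finrank_euclideanSpace, Fintype.card_fin, abs_of_pos (by positivity : 0 < (t ^ n)⁻¹),
      abs_of_pos (by positivity), smul_eq_mul]
  obtain ⟨c, hc⟩ := cv_const hkn hG h1 hμ hμ1 hgts hftg (r / t) hfrt hm0t hm1t C β hβ0 hβ hgrt
  refine ⟨c, fun x hx hxr => ?_⟩
  have e1 : ∫ y, μ y * g (x + (-t) • y) = cv gt μ (t⁻¹ • x) := by
    rw [cv_comm]
    unfold cv
    congr 1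
    funext y
    simp only [hgt, zero_add, smul_sub, smul_inv_smul₀ ht0.ne', neg_smul]
    rw [sub_eq_add_neg]
  have e2 : cv gt μ (t⁻¹ • x) - c = cv (fun y => G (‖y‖ ^ 2)) ft (t⁻¹ • x) := by
    rw [← hc (t⁻¹ • x)]; ring
  rw [e1, e2]
  refine (cvPhi_bd hkn hG h1 hfts.cont (r / t) hfrt hm0t hm1t (t⁻¹ • x) ?_ ?_).trans ?_
  · rw [hnorm, le_div_iff₀ ht0]; nlinarith
  · rw [hnorm, le_div_iff₀ ht0]
    calc 2 * (r / t) * t = 2 * r := by field_simp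
      _ ≤ _ := hxr
  · rw [hnorm, habs, Real.div_rpow (norm_nonneg _) ht0.le]
    have hp : t ^ ((2 * k : ℝ) - n) = t ^ (2 * k) / t ^ n := by
      rw [Real.rpow_sub ht0, Real.rpow_natCast]
      congr 1
      rw [← Real.rpow_natCast]
      push_cast
      rfl
    rw [hp]
    apply le_of_eq
    rw [mul_add, pow_add]
    field_simp

theorem scalar_decay {n k : ℕ} (hk : 1 ≤ k) (hkn : 2 * k < n) (hn : 2 < n)
    {g f : EuclideanSpace ℝ (Fin n) → ℝ} (hg : Sm g) (hfg : f = eucLap^[k + 1] g) (r : ℝ)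
    (hfr : ∀ x, r < ‖x‖ → f x = 0) (hm0 : ∫ y, f y = 0) (hm1 : ∀ i, ∫ y, y i * f y = 0)
    (C β : ℝ) (hβ0 : 0 ≤ β) (hβ : β < 1) (hgr : ∀ x, |g x| ≤ C * (1 + ‖x‖) ^ β) :
    ∃ c D R : ℝ, ∀ x, R ≤ ‖x‖ → |g x - c| ≤ D * ‖x‖ ^ ((2 * k : ℝ) - n) := by
  obtain ⟨G, hG, h1, ⟨c0, hc0, h2⟩, h3⟩ := kernel_exists n k hk hkn
  set μ : EuclideanSpace ℝ (Fin n) → ℝ := eucLap^[k + 1] (fun y => G (‖y‖ ^ 2)) with hμ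
  have hμr : μ = fun y => (Lop n)^[k + 1] G (‖y‖ ^ 2) := lapi_radial hG (k + 1)
  have hμ1 : ∀ y, 1 < ‖y‖ → μ y = 0 := by
    intro y hy
    rw [hμr]
    exact h3 _ (by nlinarith)
  have hI : ∫ y, μ y ≠ 0 := by
    rw [hμr]
    simp only [Function.iterate_succ_apply']
    refine integral_Lop hn (cd_Lopi n hG k) ?_ hc0 h2
    intro t ht
    have := h3 t ht
    rwa [Function.iterate_succ_apply'] at this
  have hμs : Sm μ := (Sm.radial hG).lapi _
  set D := KK n k * r ^ 2 * ∫ y, |f y| with hD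
  have ht : ∀ m : ℕ, 0 < 1 / ((m : ℝ) + 1) ∧ 1 / ((m : ℝ) + 1) ≤ 1 := by
    intro m
    refine ⟨by positivity, ?_⟩
    rw [div_le_one (by positivity)]
    linarith [(Nat.cast_nonneg m : (0 : ℝ) ≤ m)]
  choose c hc using fun m : ℕ => scaled_bd hkn hG h1 hμ hμ1 hg hfg r hfr hm0 hm1 C β hβ0 hβ hgr
    (1 / ((m : ℝ) + 1)) (ht m).1 (ht m).2
  have hlim : ∀ x, Tendsto (fun m : ℕ => ∫ y, μ y * g (x + (-(1 / ((m : ℝ) + 1))) • y)) atTop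
      (𝓝 ((∫ y, μ y) * g x)) := by
    intro x
    have a1 := (avg_deriv hg hμs.cont hμ1 x 0).continuousAt
    have a2 : Tendsto (fun m : ℕ => -(1 / ((m : ℝ) + 1))) atTop (𝓝 0) := by
      simpa using tendsto_one_div_add_atTop_nhds_zero_nat.neg (G := ℝ)
    have a3 := a1.tendsto.comp a2
    simp only [zero_smul, add_zero] at a3
    rw [integral_mul_const] at a3
    exact a3
  set R0 := max 2 (2 * r) with hR0
  have hR2 : 2 ≤ R0 := le_max_left _ _
  set x0 : EuclideanSpace ℝ (Fin n) := EuclideanSpace.single ⟨0, by omega⟩ R0 with hx0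
  have hx0n : ‖x0‖ = R0 := by
    rw [hx0, EuclideanSpace.norm_single, Real.norm_of_nonneg (by linarith)]
  obtain ⟨B, hB⟩ := (hlim x0).isBoundedUnder_le.isCoboundedUnder_ge |> fun _ =>
    (Metric.isBounded_range_of_tendsto _ (hlim x0)).exists_norm_le
  have hcb : ∀ m, c m ∈ Metric.closedBall (0 : ℝ) (B + |D * ‖x0‖ ^ ((2 * k : ℝ) - n)|) := by
    intro m
    have b1 := hc m x0 (by rw [hx0n]; exact hR2) (by rw [hx0n]; exact le_max_right _ _)
    have b2 := hB _ (Set.mem_range_self m)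
    rw [Real.norm_eq_abs] at b2
    rw [mem_closedBall_zero_iff, Real.norm_eq_abs]
    have b3 := le_abs_self (D * ‖x0‖ ^ ((2 * k : ℝ) - n))
    rw [abs_le] at *
    constructor <;> linarith [b1.1, b1.2, b2.1, b2.2]
  obtain ⟨c', -, φ, hφ, hcφ⟩ := tendsto_subseq_of_bounded Metric.isBounded_closedBall hcb
  refine ⟨c' / ∫ y, μ y, D / |∫ y, μ y|, R0, fun x hx => ?_⟩
  have b1 : |(∫ y, μ y) * g x - c'| ≤ D * ‖x‖ ^ ((2 * k : ℝ) - n) := by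
    refine le_of_tendsto ((((hlim x).comp hφ.tendsto_atTop).sub hcφ).abs) ?_
    refine Eventually.of_forall fun m => ?_
    exact hc (φ m) x (hR2.trans hx) ((le_max_right _ _).trans hx)
  have b2 : g x - c' / ∫ y, μ y = ((∫ y, μ y) * g x - c') / ∫ y, μ y := by
    field_simp
  rw [b2, abs_div, div_mul_eq_mul_div]
  gcongr

theorem moment_id {n N : ℕ} {g : Fin n → EuclideanSpace ℝ (Fin n) → ℝ} (hg : ∀ i, Sm (g i))
    (r : ℝ) (hf : ∀ i x, r < ‖x‖ → eucLap^[N] (g i) x = 0)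
    (hv : ∀ x, r < ‖x‖ → ∑ i, pd i (g i) x = 0)
    {p : EuclideanSpace ℝ (Fin n) → ℝ} (hp : Sm p) (hp0 : ∀ x, eucLap^[N] p x = 0) :
    ∑ i, ∫ y, pd i p y * eucLap^[N] (g i) y = 0 := by
  have hfc : ∀ i, HasCompactSupport (eucLap^[N] (g i)) := fun i => hcs_of_vanish r (hf i)
  have hvc : HasCompactSupport (fun x => ∑ i, pd i (g i) x) := hcs_of_vanish r hv
  have hvs : Sm (fun x => ∑ i, pd i (g i) x) := Sm.sum _ (fun i => (hg i).pd i)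
  have e1 : ∀ i, ∫ y, pd i p y * eucLap^[N] (g i) y
      = -∫ y, p y * pd i (eucLap^[N] (g i)) y := by
    intro i
    rw [ibp hp ((hg i).lapi N) (hfc i), neg_neg]
  simp only [e1]
  rw [Finset.sum_neg_distrib, ← integral_finsetSum _
    (fun i _ => int_mul hp.cont (((hg i).lapi N).pd i).cont (hcs_pd (hfc i) i))]
  have e2 : ∀ y, ∑ i, p y * pd i (eucLap^[N] (g i)) y
      = p y * eucLap^[N] (fun x => ∑ i, pd i (g i) x) y := by
    intro y
    rw [lapi_sum _ (fun i => (hg i).pd i), Finset.mul_sum]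
    refine Finset.sum_congr rfl fun i _ => ?_
    rw [pd_lapi (hg i)]
  simp only [e2]
  rw [ibp_lapi hp hvs hvc]
  simp [hp0]

theorem pd_coord {n : ℕ} (i m : Fin n) (y : EuclideanSpace ℝ (Fin n)) :
    pd i (fun y => y m) y = if i = m then 1 else 0 := by
  unfold pd
  rw [(hasFDerivAt_coord m y).fderiv]
  simp [eq_comm]

theorem pd_coord2 {n : ℕ} (i m l : Fin n) (y : EuclideanSpace ℝ (Fin n)) :
    pd i (fun y => y m * y l) y
      = (if i = m then 1 else 0) * y l + (if i = l then 1 else 0) * y m := by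
  unfold pd
  have e : HasFDerivAt (fun y : EuclideanSpace ℝ (Fin n) => y m * y l) _ y :=
    (hasFDerivAt_coord m y).mul (hasFDerivAt_coord l y)
  rw [e.fderiv]
  simp [eq_comm]
  ring

theorem pd_const {n : ℕ} (i : Fin n) (c : ℝ) (y : EuclideanSpace ℝ (Fin n)) :
    pd i (fun _ => c) y = 0 := by
  unfold pd
  simp

theorem lapi_const {n : ℕ} (c : ℝ) (m : ℕ) (y : EuclideanSpace ℝ (Fin n)) :
    eucLap^[m + 1] (fun _ => c) y = 0 := by
  have h1 : ∀ c : ℝ, eucLap (fun _ : EuclideanSpace ℝ (Fin n) => c) = fun _ => 0 := by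
    intro c
    rw [lap_eq]
    funext x
    refine Finset.sum_eq_zero fun i _ => ?_
    have : pd i (fun _ : EuclideanSpace ℝ (Fin n) => c) = fun _ => 0 := funext fun x => pd_const i c x
    rw [this, pd_const]
  induction m generalizing c with
  | zero => simp [h1]
  | succ m ih =>
    rw [Function.iterate_succ_apply, h1]
    exact ih 0

theorem sm_coord {n : ℕ} (m : Fin n) : Sm (fun y : EuclideanSpace ℝ (Fin n) => y m) := by
  unfold Sm
  fun_prop

theorem sm_coord2 {n : ℕ} (m l : Fin n) : Sm (fun y : EuclideanSpace ℝ (Fin n) => y m * y l) := by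
  unfold Sm
  fun_prop

theorem lap_coord {n : ℕ} (m : Fin n) :
    eucLap (fun y : EuclideanSpace ℝ (Fin n) => y m) = fun _ => 0 := by
  rw [lap_eq]
  funext x
  refine Finset.sum_eq_zero fun i _ => ?_
  rw [show pd i (fun y : EuclideanSpace ℝ (Fin n) => y m) = fun _ => if i = m then 1 else 0 from
    funext fun x => pd_coord i m x, pd_const]

theorem lap_coord2 {n : ℕ} (m l : Fin n) : ∃ c : ℝ,
    eucLap (fun y : EuclideanSpace ℝ (Fin n) => y m * y l) = fun _ => c := by
  refine ⟨∑ i : Fin n, ((if i = m then (1 : ℝ) else 0) * (if i = l then (1 : ℝ) else 0)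
    + (if i = l then (1 : ℝ) else 0) * (if i = m then (1 : ℝ) else 0)), ?_⟩
  · rw [lap_eq]
    funext x
    refine Finset.sum_congr rfl fun i _ => ?_
    have e : pd i (fun y : EuclideanSpace ℝ (Fin n) => y m * y l)
        = fun y => ∑ b : Bool, (if b then (fun y : EuclideanSpace ℝ (Fin n) =>
          (if i = m then (1 : ℝ) else 0) * y l) else
          (fun y => (if i = l then 1 else 0) * y m)) y := by
      funext y
      rw [pd_coord2]
      simp
    rw [e, pd_sum]
    · simp only [Fintype.sum_bool, if_true, Bool.false_eq_true, if_false]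
      rw [pd_const_mul (sm_coord l), pd_const_mul (sm_coord m)]
      simp only [pd_coord]
    · intro b
      cases b
      · simp only [Bool.false_eq_true, if_false]
        exact (sm_coord m).const_mul _
      · simp only [if_true]
        exact (sm_coord l).const_mul _

theorem moments {n k : ℕ} (hk : 1 ≤ k) {g : Fin n → Fin n → EuclideanSpace ℝ (Fin n) → ℝ}
    (hg : ∀ i j, Sm (g i j)) (hs : ∀ i j, g i j = g j i)
    (r : ℝ) (hf : ∀ i j x, r < ‖x‖ → eucLap^[k + 1] (g i j) x = 0)
    (hv : ∀ j x, r < ‖x‖ → ∑ i, pd i (g i j) x = 0) (i j : Fin n) :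
    ∫ y, eucLap^[k + 1] (g i j) y = 0 ∧ ∀ l, ∫ y, y l * eucLap^[k + 1] (g i j) y = 0 := by
  constructor
  · have := moment_id (fun i => hg i j) r (fun i => hf i j) (hv j) (sm_coord i) (fun x => by
      rw [Function.iterate_succ_apply, lap_coord]
      obtain ⟨k', rfl⟩ := Nat.exists_eq_add_of_le' hk
      exact lapi_const 0 _ x)
    simp only [pd_coord] at this
    rw [Finset.sum_eq_single i] at this
    · simpa using this
    · intro b _ hb
      simp [hb]
    · simp
  · have hA : ∀ m l j, (∫ y, y l * eucLap^[k + 1] (g m j) y)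
        + (∫ y, y m * eucLap^[k + 1] (g l j) y) = 0 := by
      intro m l j
      have := moment_id (fun i => hg i j) r (fun i => hf i j) (hv j) (sm_coord2 m l) (fun x => by
        obtain ⟨c, hc⟩ := lap_coord2 m l
        rw [Function.iterate_succ_apply, hc]
        obtain ⟨k', rfl⟩ := Nat.exists_eq_add_of_le' hk
        exact lapi_const c _ x)
      simp only [pd_coord2] at this
      have hi : ∀ (a i : Fin n), Integrable (fun y : EuclideanSpace ℝ (Fin n) =>
          y a * eucLap^[k + 1] (g i j) y) := fun a i =>
        int_mul (sm_coord a).cont ((hg i j).lapi _).cont (hcs_of_vanish r (hf i j))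
      have e : ∀ i, ∫ y : EuclideanSpace ℝ (Fin n), ((if i = m then 1 else 0) * y l
          + (if i = l then 1 else 0) * y m) * eucLap^[k + 1] (g i j) y
          = (if i = m then 1 else 0) * (∫ y, y l * eucLap^[k + 1] (g i j) y)
          + (if i = l then 1 else 0) * (∫ y, y m * eucLap^[k + 1] (g i j) y) := by
        intro i
        simp only [add_mul, mul_assoc]
        rw [integral_add ((hi l i).const_mul _) ((hi m i).const_mul _), integral_const_mul,
          integral_const_mul]
      simp only [e] at this
      rw [Finset.sum_add_distrib] at this
      simpa using this
    intro l
    have a1 := hA i l j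
    have a2 := hA l j i
    have a3 := hA j i l
    rw [hs j l, hs i l] at a3
    rw [hs l i] at a3
    rw [hs j i, hs l i] at a2
    linarith

/-- **Decay of divergence-free polyharmonic symmetric tensor fields.**
Let `n > 2` and let `k` satisfy `1 ≤ k ≤ n/2 - 1`, or `k = 1` when `n = 3`. If a smooth
symmetric-matrix-valued field `h` on `ℝⁿ ∖ B_ρ(0)` satisfies `Δ^{k+1} h = 0` componentwise,
is divergence-free (`∑ i, ∂ᵢ h i j = 0`), and `h = O(|x|^{1-ε})` at infinity for some
`ε > 0`, then `h = h_c + O(|x|^{2k-n})` for some constant symmetric matrix `h_c`. -/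
theorem polyharmonic_divergence_free_decay
    (n k : ℕ) (hn : 2 < n)
    (hk : (1 ≤ k ∧ 2 * k + 2 ≤ n) ∨ (n = 3 ∧ k = 1))
    (ρ : ℝ) (hρ : 0 < ρ)
    (h : EuclideanSpace ℝ (Fin n) → Fin n → Fin n → ℝ)
    (hsmooth : ContDiffOn ℝ (⊤ : ℕ∞) h {x | ρ < ‖x‖})
    (hsym : ∀ x i j, h x i j = h x j i)
    (hpoly : ∀ x : EuclideanSpace ℝ (Fin n), ρ < ‖x‖ →
      ∀ i j, (eucLap^[k + 1] (fun y => h y i j)) x = 0)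
    (hdiv : ∀ x : EuclideanSpace ℝ (Fin n), ρ < ‖x‖ → ∀ j,
      ∑ i, fderiv ℝ (fun y => h y i j) x (EuclideanSpace.single i 1) = 0)
    (hgrowth : ∃ ε : ℝ, 0 < ε ∧ ∃ C R : ℝ,
      ∀ x : EuclideanSpace ℝ (Fin n), R ≤ ‖x‖ →
        ∀ i j, |h x i j| ≤ C * ‖x‖ ^ ((1 : ℝ) - ε)) :
    ∃ hc : Fin n → Fin n → ℝ, (∀ i j, hc i j = hc j i) ∧ ∃ C R : ℝ,
      ∀ x : EuclideanSpace ℝ (Fin n), R ≤ ‖x‖ →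
        ∀ i j, |h x i j - hc i j| ≤ C * ‖x‖ ^ ((2 * k : ℝ) - n) := by
  have hk1 : 1 ≤ k := by omega
  have hkn : 2 * k < n := by omega
  obtain ⟨g, hgs, hgsym, hgh, hgle, hg0⟩ : ∃ g : Fin n → Fin n → EuclideanSpace ℝ (Fin n) → ℝ,
      (∀ i j, Sm (g i j)) ∧ (∀ i j, g i j = g j i) ∧
      (∀ i j x, ρ + 2 < ‖x‖ → g i j x = h x i j) ∧ (∀ i j x, |g i j x| ≤ |h x i j|) ∧
      True := by
    refine ⟨fun i j x => Real.smoothTransition (‖x‖ ^ 2 - (ρ + 1) ^ 2) * h x i j,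
      ?_, ?_, ?_, ?_, trivial⟩
    · intro i j
      refine contDiff_iff_contDiffAt.2 fun x => ?_
      by_cases hx : ‖x‖ < ρ + 1
      · have : (fun x => Real.smoothTransition (‖x‖ ^ 2 - (ρ + 1) ^ 2) * h x i j)
            =ᶠ[𝓝 x] fun _ => 0 := by
          filter_upwards [(isOpen_lt continuous_norm continuous_const).mem_nhds hx] with y hy
          rw [Real.smoothTransition.zero_of_nonpos, zero_mul]
          have : ‖y‖ < ρ + 1 := hy
          nlinarith [norm_nonneg y]
        exact contDiffAt_const.congr_of_eventuallyEq this
      · push Not at hx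
        have hxo : {x : EuclideanSpace ℝ (Fin n) | ρ < ‖x‖} ∈ 𝓝 x :=
          (isOpen_lt continuous_const continuous_norm).mem_nhds
            (show ρ < ‖x‖ by linarith)
        have a1 := hsmooth.contDiffAt hxo
        have a2 : ContDiffAt ℝ (⊤ : ℕ∞) (fun x => h x i j) x :=
          contDiffAt_pi.1 (contDiffAt_pi.1 a1 i) j
        refine ContDiffAt.mul ?_ a2
        exact (Real.smoothTransition.contDiff.comp
          ((contDiff_norm_sq ℝ).sub contDiff_const)).contDiffAt
    · intro i j
      funext x
      simp only
      rw [hsym]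
    · intro i j x hx
      simp only
      rw [Real.smoothTransition.one_of_one_le, one_mul]
      nlinarith
    · intro i j x
      simp only
      rw [abs_mul, abs_of_nonneg (Real.smoothTransition.nonneg _)]
      exact mul_le_of_le_one_left (abs_nonneg _) (Real.smoothTransition.le_one _)
  have hUo : IsOpen {x : EuclideanSpace ℝ (Fin n) | ρ + 2 < ‖x‖} :=
    isOpen_lt continuous_const continuous_norm
  have hf : ∀ i j x, ρ + 2 < ‖x‖ → eucLap^[k + 1] (g i j) x = 0 := by
    intro i j x hx
    rw [lapi_congr hUo (fun x hx => hgh i j x hx) (k + 1) x hx]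
    exact hpoly x (by linarith) i j
  have hv : ∀ j x, ρ + 2 < ‖x‖ → ∑ i, pd i (g i j) x = 0 := by
    intro j x hx
    rw [← hdiv x (by linarith) j]
    exact Finset.sum_congr rfl fun i _ => pd_congr hUo (fun x hx => hgh i j x hx) i x hx
  obtain ⟨ε, hε, C, R, hCR⟩ := hgrowth
  have hβ1 : max (1 - ε) 0 < 1 := max_lt (by linarith) one_pos
  have hβ0 : 0 ≤ max (1 - ε) 0 := le_max_right _ _
  have hgr : ∀ i j, ∃ C', ∀ x, |g i j x| ≤ C' * (1 + ‖x‖) ^ (max (1 - ε) 0) := by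
    intro i j
    obtain ⟨B, hB⟩ := (isCompact_closedBall (0 : EuclideanSpace ℝ (Fin n))
      (max R 1)).exists_bound_of_continuousOn (hgs i j).cont.continuousOn
    refine ⟨max |B| |C|, fun x => ?_⟩
    have h1x : 1 ≤ (1 + ‖x‖) ^ (max (1 - ε) 0) :=
      Real.one_le_rpow (by linarith [norm_nonneg x]) hβ0
    by_cases hx : ‖x‖ ≤ max R 1
    · calc |g i j x| ≤ B := hB x (by simpa using hx)
        _ ≤ max |B| |C| := (le_abs_self _).trans (le_max_left _ _)
        _ ≤ _ := le_mul_of_one_le_right ((abs_nonneg _).trans (le_max_left _ _)) h1x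
    · push Not at hx
      have hxR := (le_max_left _ _).trans hx.le
      have hx1 := (le_max_right _ _).trans hx.le
      have e1 : ‖x‖ ^ (1 - ε) ≤ (1 + ‖x‖) ^ (max (1 - ε) 0) :=
        calc ‖x‖ ^ (1 - ε) ≤ ‖x‖ ^ (max (1 - ε) 0) :=
              Real.rpow_le_rpow_of_exponent_le hx1 (le_max_left _ _)
          _ ≤ _ := Real.rpow_le_rpow (norm_nonneg _) (by linarith) hβ0
      calc |g i j x| ≤ C * ‖x‖ ^ (1 - ε) := (hgle i j x).trans (hCR x hxR i j)
        _ ≤ max |B| |C| * ‖x‖ ^ (1 - ε) :=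
            mul_le_mul_of_nonneg_right ((le_abs_self _).trans (le_max_right _ _)) (by positivity)
        _ ≤ _ := mul_le_mul_of_nonneg_left e1 ((abs_nonneg _).trans (le_max_left _ _))
  have hex : ∀ i j, ∃ c : ℝ, ∃ D R : ℝ, ∀ x, R ≤ ‖x‖ →
      |g i j x - c| ≤ D * ‖x‖ ^ ((2 * k : ℝ) - n) := by
    intro i j
    obtain ⟨C', hC'⟩ := hgr i j
    obtain ⟨m0, m1⟩ := moments hk1 hgs hgsym (ρ + 2) hf hv i j
    exact scalar_decay hk1 hkn hn (hgs i j) rfl (ρ + 2) (hf i j) m0 m1 C' _ hβ0 hβ1 hC'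
  let P : (EuclideanSpace ℝ (Fin n) → ℝ) → ℝ → Prop := fun u c => ∃ D R : ℝ, ∀ x, R ≤ ‖x‖ →
      |u x - c| ≤ D * ‖x‖ ^ ((2 * k : ℝ) - n)
  have hP : ∀ i j, P (g i j) (Classical.epsilon (P (g i j))) := fun i j =>
    Classical.epsilon_spec (hex i j)
  choose D R' hDR using hP
  refine ⟨fun i j => Classical.epsilon (P (g i j)), fun i j => by simp only [hgsym i j],
    ∑ i, ∑ j, |D i j|, (∑ i, ∑ j, |R' i j|) + (ρ + 3), fun x hx i j => ?_⟩
  have hsum : ∀ F : Fin n → Fin n → ℝ, F i j ≤ ∑ i, ∑ j, |F i j| := by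
    intro F
    calc F i j ≤ |F i j| := le_abs_self _
      _ ≤ ∑ j, |F i j| := Finset.single_le_sum (f := fun j => |F i j|)
          (fun j _ => abs_nonneg _) (Finset.mem_univ j)
      _ ≤ _ := Finset.single_le_sum (f := fun i => ∑ j, |F i j|)
          (fun i _ => Finset.sum_nonneg fun j _ => abs_nonneg _) (Finset.mem_univ i)
  have hR0 : 0 ≤ ∑ i, ∑ j, |R' i j| :=
    Finset.sum_nonneg fun i _ => Finset.sum_nonneg fun j _ => abs_nonneg _
  rw [← hgh i j x (by linarith)]
  refine (hDR i j x (by linarith [hsum R'])).trans ?_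
  exact mul_le_mul_of_nonneg_right (hsum D) (by positivity)
end

section
/- Let n > 2 and ρ > 0, and let h : ℝ^n ∖ B_ρ(0) → Sym(n, ℝ) be a smooth symmetric-matrix-valued function satisfying: (i) Δh = 0 componentwise (Euclidean Laplacian); (ii) Σ_i ∂_i h_{ij} = 0 for every j; (iii) tr(h) = Σ_i h_{ii} = 0 identically; (iv) |h(x)| = O(|x|^{1−ε}) as |x| → ∞ for some ε > 0. Then there exists a constant symmetric matrix h_c such that |h(x) − h_c| = O(|x|^{−n}) as |x| → ∞. -/
open MeasureTheory Filter Topology Set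

namespace HDF

abbrev V (n : ℕ) := EuclideanSpace ℝ (Fin n)

/-- coordinate derivative -/
noncomputable def D {n : ℕ} (i : Fin n) (f : V n → ℝ) : V n → ℝ :=
  fun x => fderiv ℝ f x (EuclideanSpace.single i 1)

abbrev Sm {n : ℕ} (f : V n → ℝ) : Prop := ContDiff ℝ (⊤ : ℕ∞) f

variable {n : ℕ}

lemma eucLap_eq (f : V n → ℝ) (x : V n) : eucLap f x = ∑ i, D i (D i f) x := rfl

lemma eucLap_eq' (f : V n → ℝ) : eucLap f = fun x => ∑ i, D i (D i f) x := rfl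

lemma Sm.D {f : V n → ℝ} (hf : Sm f) (i : Fin n) : Sm (D i f) := by
  unfold HDF.D
  exact (hf.fderiv_right (m := (⊤ : ℕ∞)) (by simp)).clm_apply contDiff_const

lemma Sm.lap {f : V n → ℝ} (hf : Sm f) : Sm (eucLap f) := by
  rw [eucLap_eq']
  exact ContDiff.sum (fun i _ => (hf.D i).D i)

lemma Sm.diff {f : V n → ℝ} (hf : Sm f) : Differentiable ℝ f := hf.differentiable (by simp)

lemma D_cs {f : V n → ℝ} (hf : HasCompactSupport f) (i : Fin n) : HasCompactSupport (D i f) :=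
  hf.fderiv_apply (𝕜 := ℝ) _

lemma lap_cs {f : V n → ℝ} (hf : HasCompactSupport f) : HasCompactSupport (eucLap f) := by
  rw [eucLap_eq']
  refine HasCompactSupport.intro' (K := tsupport f) hf (isClosed_tsupport f) ?_
  intro x hx
  refine Finset.sum_eq_zero fun i _ => ?_
  have h1 : tsupport (D i (D i f)) ⊆ tsupport f :=
    (tsupport_fderiv_apply_subset ℝ _).trans (tsupport_fderiv_apply_subset ℝ _)
  exact image_eq_zero_of_notMem_tsupport (fun h => hx (h1 h))

lemma D_comm {f : V n → ℝ} (hf : Sm f) (i j : Fin n) : D i (D j f) = D j (D i f) := by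
  have key : ∀ i j x, D i (D j f) x
      = fderiv ℝ (fderiv ℝ f) x (EuclideanSpace.single i 1) (EuclideanSpace.single j 1) := by
    intro i j x
    have hd : DifferentiableAt ℝ (fderiv ℝ f) x :=
      (hf.fderiv_right (m := (⊤ : ℕ∞)) (by simp)).differentiable (by simp) x
    unfold D
    rw [fderiv_clm_apply hd (by fun_prop)]
    simp
  funext x
  rw [key, key]
  have := (hf.contDiffAt (x := x)).isSymmSndFDerivAt (by simp; exact WithTop.coe_le_coe.2 le_top)
  exact this _ _

lemma D_sum {ι : Type*} (s : Finset ι) (f : ι → V n → ℝ) (hf : ∀ k ∈ s, Sm (f k)) (i : Fin n) :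
    D i (fun x => ∑ k ∈ s, f k x) = fun x => ∑ k ∈ s, D i (f k) x := by
  funext x
  unfold D
  rw [fderiv_fun_sum (fun k hk => (hf k hk).diff x)]
  simp

lemma D_lap {f : V n → ℝ} (hf : Sm f) (i : Fin n) : D i (eucLap f) = eucLap (D i f) := by
  rw [eucLap_eq', eucLap_eq', D_sum _ _ (fun k _ => (hf.D k).D k)]
  funext x
  refine Finset.sum_congr rfl fun k _ => ?_
  rw [D_comm (hf.D k) i k, D_comm hf i k]

lemma lap_sum {ι : Type*} (s : Finset ι) (f : ι → V n → ℝ) (hf : ∀ k ∈ s, Sm (f k)) :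
    eucLap (fun x => ∑ k ∈ s, f k x) = fun x => ∑ k ∈ s, eucLap (f k) x := by
  funext x
  rw [eucLap_eq]
  simp_rw [eucLap_eq]
  rw [Finset.sum_comm]
  refine Finset.sum_congr rfl fun i _ => ?_
  rw [D_sum s f hf, D_sum s _ (fun k hk => (hf k hk).D i)]

/-- integration by parts -/
lemma ibp {f g : V n → ℝ} (hf : Sm f) (hg : Sm g) (hc : HasCompactSupport f ∨ HasCompactSupport g)
    (i : Fin n) : ∫ x, f x * D i g x = - ∫ x, D i f x * g x := by
  refine integral_mul_fderiv_eq_neg_fderiv_mul_of_integrable ?_ ?_ ?_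
    (fun x _ => hf.diff x) (fun x _ => hg.diff x)
  · refine Continuous.integrable_of_hasCompactSupport
      ((hf.D i).continuous.mul hg.continuous) ?_
    rcases hc with hc | hc
    · exact (D_cs hc i).mul_right
    · exact hc.mul_left
  · refine Continuous.integrable_of_hasCompactSupport
      (hf.continuous.mul (hg.D i).continuous) ?_
    rcases hc with hc | hc
    · exact hc.mul_right
    · exact (D_cs hc i).mul_left
  · refine Continuous.integrable_of_hasCompactSupport
      (hf.continuous.mul hg.continuous) ?_
    rcases hc with hc | hc
    · exact hc.mul_right
    · exact hc.mul_left

lemma integrable_mul {f g : V n → ℝ} (hf : Continuous f) (hg : Continuous g)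
    (hc : HasCompactSupport f ∨ HasCompactSupport g) : Integrable (fun x => f x * g x) := by
  refine Continuous.integrable_of_hasCompactSupport (hf.mul hg) ?_
  rcases hc with hc | hc
  · exact hc.mul_right
  · exact hc.mul_left

lemma green1 {f g : V n → ℝ} (hf : Sm f) (hg : Sm g)
    (hc : HasCompactSupport f ∨ HasCompactSupport g) :
    ∫ x, f x * eucLap g x = - ∑ i, ∫ x, D i f x * D i g x := by
  simp_rw [eucLap_eq, Finset.mul_sum]
  rw [integral_finsetSum, ← Finset.sum_neg_distrib]
  · exact Finset.sum_congr rfl fun i _ => ibp hf (hg.D i) (hc.imp id (fun h => D_cs h i)) i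
  · exact fun i _ => integrable_mul hf.continuous ((hg.D i).D i).continuous
      (hc.imp id (fun h => D_cs (D_cs h i) i))

lemma green {f g : V n → ℝ} (hf : Sm f) (hg : Sm g)
    (hc : HasCompactSupport f ∨ HasCompactSupport g) :
    ∫ x, f x * eucLap g x = ∫ x, eucLap f x * g x := by
  rw [green1 hf hg hc]
  have := green1 hg hf hc.symm
  simp_rw [mul_comm (eucLap f _)]
  rw [this]
  simp_rw [mul_comm]

/-- moment identity -/
lemma moment {u : V n → Fin n → ℝ} (hu : ∀ i, Sm (fun x => u x i))
    (hf : ∀ i, HasCompactSupport (eucLap (fun x => u x i)))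
    (hw : HasCompactSupport (fun x => ∑ i, D i (fun y => u y i) x))
    {P : V n → ℝ} (hP : Sm P) (hPh : ∀ x, eucLap P x = 0) :
    ∑ i, ∫ x, eucLap (fun y => u y i) x * D i P x = 0 := by
  have h1 : ∀ i, ∫ x, eucLap (fun y => u y i) x * D i P x
      = - ∫ x, eucLap (D i (fun y => u y i)) x * P x := by
    intro i
    rw [ibp (hu i).lap hP (Or.inl (hf i)), D_lap (hu i)]
  simp_rw [h1]
  rw [Finset.sum_neg_distrib, ← integral_finsetSum]
  · simp_rw [← Finset.sum_mul]
    have h2 := lap_sum Finset.univ (fun i => D i (fun y => u y i)) (fun k _ => (hu k).D k)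
    have h3 : ∀ x, ∑ i, eucLap (D i (fun y => u y i)) x
      = eucLap (fun x => ∑ i, D i (fun y => u y i) x) x := fun x => (congrFun h2 x).symm
    simp_rw [h3]
    rw [← green (ContDiff.sum (fun i _ => (hu i).D i)) hP (Or.inl hw)]
    simp [hPh]
  · intro i _
    refine integrable_mul ((hu i).D i).lap.continuous hP.continuous (Or.inl ?_)
    rw [← D_lap (hu i)]
    exact D_cs (hf i) i

lemma D_scale {g : V n → ℝ} (hg : Sm g) (c s : ℝ) (x : V n) (i : Fin n) :
    D i (fun y => c * g (s • (y - x))) = fun y => (c * s) * D i g (s • (y - x)) := by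
  funext y
  unfold D
  have h1 : HasFDerivAt (fun y : V n => s • (y - x)) (s • ContinuousLinearMap.id ℝ (V n)) y :=
    ((hasFDerivAt_id y).sub_const x).const_smul s
  have h2 := ((hg.diff (s • (y - x))).hasFDerivAt.comp y h1).const_mul c
  have h3 := h2.fderiv
  simp only [Function.comp_def] at h3
  rw [h3]
  simp
  ring

lemma lap_scale {g : V n → ℝ} (hg : Sm g) (c s : ℝ) (x : V n) :
    eucLap (fun y => c * g (s • (y - x))) = fun y => (c * s * s) * eucLap g (s • (y - x)) := by
  funext y
  simp_rw [eucLap_eq, D_scale hg, D_scale (hg.D _), Finset.mul_sum]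

lemma lap_sub {f g : V n → ℝ} (hf : Sm f) (hg : Sm g) :
    eucLap (fun y => f y - g y) = fun y => eucLap f y - eucLap g y := by
  have hD : ∀ (f g : V n → ℝ) (i : Fin n), Sm f → Sm g →
      D i (fun y => f y - g y) = fun y => D i f y - D i g y := by
    intro f g i hf hg
    funext y
    unfold D
    rw [fderiv_fun_sub (hf.diff y) (hg.diff y)]
    simp
  funext y
  simp_rw [eucLap_eq, hD f g _ hf hg, hD _ _ _ (hf.D _) (hg.D _), Finset.sum_sub_distrib]

lemma D_radial {F : ℝ → ℝ} (hF : ContDiff ℝ (⊤ : ℕ∞) F) (i : Fin n) :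
    D i (fun z : V n => F (‖z‖ ^ 2)) = fun z => 2 * z i * deriv F (‖z‖ ^ 2) := by
  funext z
  unfold D
  have h1 : HasFDerivAt (fun z : V n => ‖z‖ ^ 2) _ z := (hasStrictFDerivAt_norm_sq z).hasFDerivAt
  have h2 : HasDerivAt F (deriv F (‖z‖ ^ 2)) (‖z‖ ^ 2) :=
    (hF.differentiable (by simp) _).hasDerivAt
  have h3 := (h2.comp_hasFDerivAt z h1).fderiv
  simp only [Function.comp_def] at h3
  rw [h3]
  simp [EuclideanSpace.inner_single_right]
  ring

lemma lap_radial {F : ℝ → ℝ} (hF : ContDiff ℝ (⊤ : ℕ∞) F) (z : V n) :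
    eucLap (fun z : V n => F (‖z‖ ^ 2)) z
      = 4 * ‖z‖ ^ 2 * deriv (deriv F) (‖z‖ ^ 2) + 2 * n * deriv F (‖z‖ ^ 2) := by
  have hF' : ContDiff ℝ (⊤ : ℕ∞) (deriv F) := by
    exact hF.deriv' 
  have key : ∀ i, D i (fun z : V n => 2 * z i * deriv F (‖z‖ ^ 2)) z
      = 2 * deriv F (‖z‖ ^ 2) + 4 * (z i) ^ 2 * deriv (deriv F) (‖z‖ ^ 2) := by
    intro i
    have hG : Sm (fun z : V n => deriv F (‖z‖ ^ 2)) := hF'.comp (contDiff_norm_sq ℝ)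
    have h0 := congrFun (D_radial hF' i) z
    unfold D at h0 ⊢
    have hl : HasFDerivAt (fun z : V n => 2 * z i) ((2:ℝ) • (EuclideanSpace.proj i : V n →L[ℝ] ℝ)) z :=
      ((EuclideanSpace.proj i : V n →L[ℝ] ℝ).hasFDerivAt).const_mul 2
    rw [fderiv_fun_mul hl.differentiableAt (hG.diff z), hl.fderiv]
    simp only [add_apply, smul_apply, h0, smul_eq_mul]
    simp
    ring
  rw [eucLap_eq]
  simp_rw [D_radial hF, key, Finset.sum_add_distrib, ← Finset.sum_mul, ← Finset.mul_sum]
  rw [EuclideanSpace.real_norm_sq_eq]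
  simp
  ring

lemma Sm_radial {F : ℝ → ℝ} (hF : ContDiff ℝ (⊤ : ℕ∞) F) : Sm (fun z : V n => F (‖z‖ ^ 2)) :=
  hF.comp (contDiff_norm_sq ℝ)
lemma exists_F (p : ℝ) (hp : p < 0) : ∃ F : ℝ → ℝ, ContDiff ℝ (⊤ : ℕ∞) F ∧
    (∀ t, 1 ≤ t → F t = t ^ p) ∧ ∃ M, ∀ t, 0 ≤ t → |F t| ≤ M := by
  set F : ℝ → ℝ := fun t => t ^ p * Real.smoothTransition (2 * t - 1) with hFdef
  have hF : ContDiff ℝ (⊤ : ℕ∞) F := by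
    rw [contDiff_iff_contDiffAt]
    intro t
    rcases lt_or_ge t (1/2) with ht | ht
    · have : F =ᶠ[𝓝 t] fun _ => 0 := by
        filter_upwards [Iio_mem_nhds ht] with s hs
        simp only [hFdef]
        rw [Real.smoothTransition.zero_of_nonpos (by simp at hs; linarith), mul_zero]
      exact contDiffAt_const.congr_of_eventuallyEq this
    · have h1 : ContDiffAt ℝ (⊤ : ℕ∞) (fun t : ℝ => t ^ p) t :=
        Real.contDiffAt_rpow_const_of_ne (by linarith)
      have h2 : ContDiffAt ℝ (⊤ : ℕ∞) (fun t : ℝ => Real.smoothTransition (2 * t - 1)) t :=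
        (Real.smoothTransition.contDiff (n := ⊤)).contDiffAt.comp t
          (by fun_prop)
      exact h1.mul h2
  have h1 : ∀ t, 1 ≤ t → F t = t ^ p := by
    intro t ht
    simp only [hFdef]
    rw [Real.smoothTransition.one_of_one_le (by linarith), mul_one]
  refine ⟨F, hF, h1, ?_⟩
  obtain ⟨M, hM⟩ := (isCompact_Icc (a := (0:ℝ)) (b := 1)).exists_bound_of_continuousOn
    hF.continuous.continuousOn
  refine ⟨max M 1, fun t ht => ?_⟩
  rcases le_total t 1 with h | h
  · exact (hM t ⟨ht, h⟩).trans (le_max_left _ _)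
  · rw [h1 t h, abs_of_nonneg (by positivity)]
    exact (Real.rpow_le_one_of_one_le_of_nonpos h hp.le).trans (le_max_right _ _)

lemma lap_G_zero {F : ℝ → ℝ} (hF : ContDiff ℝ (⊤ : ℕ∞) F)
    (h1 : ∀ t, 1 ≤ t → F t = t ^ ((2 - n : ℝ) / 2)) {z : V n} (hz : 1 < ‖z‖) :
    eucLap (fun z : V n => F (‖z‖ ^ 2)) z = 0 := by
  rw [lap_radial hF]
  set p : ℝ := (2 - n : ℝ) / 2 with hp
  have ht : 1 < ‖z‖ ^ 2 := by nlinarith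
  set t := ‖z‖ ^ 2
  have hd : ∀ s, 1 < s → deriv F s = p * s ^ (p - 1) := by
    intro s hs
    have : F =ᶠ[𝓝 s] fun s => s ^ p := by
      filter_upwards [Ioi_mem_nhds hs] with r hr
      exact h1 r (le_of_lt hr)
    rw [this.deriv_eq, Real.deriv_rpow_const]
  have hd2 : deriv (deriv F) t = p * ((p - 1) * t ^ (p - 1 - 1)) := by
    have : deriv F =ᶠ[𝓝 t] fun s => p * s ^ (p - 1) := by
      filter_upwards [Ioi_mem_nhds ht] with r hr
      exact hd r hr
    rw [this.deriv_eq, deriv_const_mul_field, Real.deriv_rpow_const]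
  rw [hd2, hd t ht, Real.rpow_sub_one (by linarith) (p - 1)]
  have : t ≠ 0 := by linarith
  field_simp
  have : (n : ℝ) = 2 - 2 * p := by rw [hp]; ring
  rw [this]
  ring

lemma lap_G_cs {F : ℝ → ℝ} (hF : ContDiff ℝ (⊤ : ℕ∞) F)
    (h1 : ∀ t, 1 ≤ t → F t = t ^ ((2 - n : ℝ) / 2)) :
    HasCompactSupport (eucLap (fun z : V n => F (‖z‖ ^ 2))) := by
  refine HasCompactSupport.intro (K := Metric.closedBall 0 1) (isCompact_closedBall _ _) ?_
  intro z hz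
  exact lap_G_zero hF h1 (by simpa using hz)

lemma integral_lap_G (hn : 2 < n) {F : ℝ → ℝ} (hF : ContDiff ℝ (⊤ : ℕ∞) F)
    (h1 : ∀ t, 1 ≤ t → F t = t ^ ((2 - n : ℝ) / 2)) :
    ∫ z, eucLap (fun z : V n => F (‖z‖ ^ 2)) z ≠ 0 := by
  set p : ℝ := (2 - n : ℝ) / 2 with hp
  have hp0 : p < 0 := by
    have : (2:ℝ) < n := by exact_mod_cast hn
    rw [hp]; linarith
  set θ : ℝ → ℝ := fun t => 1 - Real.smoothTransition (t - 1) with hθdef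
  have hθ : ContDiff ℝ (⊤ : ℕ∞) θ := by
    have : ContDiff ℝ (⊤ : ℕ∞) (fun t : ℝ => Real.smoothTransition (t - 1)) :=
      (Real.smoothTransition.contDiff (n := ⊤)).comp (by fun_prop)
    exact contDiff_const.sub this
  have hθ1 : ∀ t, t ≤ 1 → θ t = 1 := fun t ht => by
    simp only [hθdef]; rw [Real.smoothTransition.zero_of_nonpos (by linarith)]; simp
  have hθ2 : ∀ t, 2 ≤ t → θ t = 0 := fun t ht => by
    simp only [hθdef]; rw [Real.smoothTransition.one_of_one_le (by linarith)]; simp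
  have hanti : Antitone θ := fun a b hab => by
    simp only [hθdef]
    have := Real.smoothTransition.monotone (show a - 1 ≤ b - 1 by linarith)
    linarith
  have hθ'le : ∀ t, deriv θ t ≤ 0 := fun t => hanti.deriv_nonpos
  have hθ'0 : ∀ t, t < 1 → deriv θ t = 0 := by
    intro t ht
    have : θ =ᶠ[𝓝 t] fun _ => 1 := by
      filter_upwards [Iio_mem_nhds ht] with r hr
      exact hθ1 r (le_of_lt hr)
    rw [this.deriv_eq]; simp
  have hd1 : ∀ s, 1 < s → deriv F s = p * s ^ (p - 1) := by
    intro s hs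
    have : F =ᶠ[𝓝 s] fun s => s ^ p := by
      filter_upwards [Ioi_mem_nhds hs] with r hr
      exact h1 r (le_of_lt hr)
    rw [this.deriv_eq, Real.deriv_rpow_const]
  have hFc : Continuous (deriv F) := hF.continuous_deriv (by simp)
  have hθc : Continuous (deriv θ) := hθ.continuous_deriv (by simp)
  have hd1' : ∀ s, 1 ≤ s → deriv F s ≤ 0 := by
    intro s hs
    have hcl : s ∈ closure (Ioi (1:ℝ)) := by rw [closure_Ioi]; exact hs
    have hsub : closure (Ioi (1:ℝ)) ⊆ {s | deriv F s ≤ 0} := by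
      refine closure_minimal ?_ (isClosed_le hFc continuous_const)
      intro r hr
      have hr' : (1:ℝ) < r := hr
      show deriv F r ≤ 0
      rw [hd1 r hr]
      have : 0 < r ^ (p - 1) := Real.rpow_pos_of_pos (by linarith) _
      nlinarith
    exact hsub hcl
  obtain ⟨t, ht, hts⟩ : ∃ t ∈ Ioo (1:ℝ) 2, deriv θ t = (θ 2 - θ 1) / (2 - 1) :=
    exists_deriv_eq_slope θ (by norm_num) hθ.continuous.continuousOn
      (hθ.differentiable (by simp)).differentiableOn
  rw [hθ1 1 le_rfl, hθ2 2 le_rfl] at hts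
  set G : V n → ℝ := fun z => F (‖z‖ ^ 2) with hG
  set χ : V n → ℝ := fun z => θ (‖z‖ ^ 2) with hχ
  have hχs : Sm χ := Sm_radial hθ
  have hGs : Sm G := Sm_radial hF
  have hχc : HasCompactSupport χ := by
    refine HasCompactSupport.intro (K := Metric.closedBall 0 2) (isCompact_closedBall _ _) ?_
    intro z hz
    have : 2 < ‖z‖ := by simpa using hz
    exact hθ2 _ (by nlinarith)
  have e1 : ∫ z, eucLap G z = ∫ z, χ z * eucLap G z := by
    congr 1
    funext z
    rcases le_or_gt ‖z‖ 1 with h | h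
    · have : χ z = 1 := hθ1 _ (by nlinarith [norm_nonneg z])
      rw [this, one_mul]
    · rw [lap_G_zero hF h1 h, mul_zero]
  have e2 : ∀ z, ∑ i, D i χ z * D i G z = 4 * ‖z‖ ^ 2 * (deriv θ (‖z‖ ^ 2) * deriv F (‖z‖ ^ 2)) := by
    intro z
    simp_rw [hχ, hG, D_radial hF, D_radial hθ]
    have : ∀ i, 2 * z i * deriv θ (‖z‖ ^ 2) * (2 * z i * deriv F (‖z‖ ^ 2))
      = (z i) ^ 2 * (4 * (deriv θ (‖z‖ ^ 2) * deriv F (‖z‖ ^ 2))) := fun i => by ring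
    simp_rw [this, ← Finset.sum_mul]
    rw [← EuclideanSpace.real_norm_sq_eq]
    ring
  rw [e1, green1 hχs hGs (Or.inl hχc), ← integral_finsetSum]
  · simp_rw [e2]
    obtain ⟨z0, hz0⟩ : ∃ z0 : V n, ‖z0‖ ^ 2 = t := by
      refine ⟨EuclideanSpace.single ⟨0, by omega⟩ (Real.sqrt t), ?_⟩
      have : 0 ≤ t := by linarith [ht.1]
      simp [Real.sq_sqrt this]
    have hpos : 0 < ∫ z : V n, 4 * ‖z‖ ^ 2 * (deriv θ (‖z‖ ^ 2) * deriv F (‖z‖ ^ 2)) := by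
      refine Continuous.integral_pos_of_hasCompactSupport_nonneg_nonzero (x := z0) ?_ ?_ ?_ ?_
      · fun_prop
      · refine HasCompactSupport.intro (K := Metric.closedBall 0 2) (isCompact_closedBall _ _) ?_
        intro z hz
        have h2 : 2 < ‖z‖ := by simpa using hz
        have : θ =ᶠ[𝓝 (‖z‖ ^ 2)] fun _ => 0 := by
          filter_upwards [Ioi_mem_nhds (show 2 < ‖z‖ ^ 2 by nlinarith)] with r hr
          exact hθ2 r (le_of_lt hr)
        rw [this.deriv_eq]; simp
      · intro z
        show 0 ≤ 4 * ‖z‖ ^ 2 * (deriv θ (‖z‖ ^ 2) * deriv F (‖z‖ ^ 2))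
        rcases lt_or_ge (‖z‖ ^ 2) 1 with h | h
        · rw [hθ'0 _ h]; simp
        · have := mul_nonneg_of_nonpos_of_nonpos (hθ'le (‖z‖ ^ 2)) (hd1' _ h)
          positivity
      · simp only [hz0]
        rw [hts, hd1 t ht.1]
        have : 0 < t ^ (p - 1) := Real.rpow_pos_of_pos (by linarith [ht.1]) _
        have h3 : t ≠ 0 := by linarith [ht.1]
        have h4 := hp0.ne
        have h5 := this.ne'
        norm_num
        exact ⟨h3, h4, h5⟩
    linarith
  · intro i _
    exact integrable_mul (hχs.D i).continuous (hGs.D i).continuous (Or.inl (D_cs hχc i))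
lemma pow_scale {s : ℝ} (hs : 0 < s) :
    (s ^ 2) ^ ((2 - n : ℝ) / 2) * s⁻¹ * s⁻¹ * s ^ n = 1 := by
  have h1 : (s ^ 2) ^ ((2 - n : ℝ) / 2) = s ^ (2 - n : ℝ) := by
    rw [← Real.rpow_natCast s 2, ← Real.rpow_mul hs.le]
    congr 1
    push_cast
    ring
  rw [h1, Real.rpow_sub hs, Real.rpow_natCast]
  have : s ≠ 0 := hs.ne'
  norm_num
  field_simp

lemma subst_int {u φ : V n → ℝ} {s : ℝ} (hs : 0 < s) (x : V n) :
    ∫ y, u y * φ (s⁻¹ • (y - x)) = s ^ n * ∫ z, u (x + s • z) * φ z := by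
  have h1 := Measure.integral_comp_inv_smul_of_nonneg (volume : Measure (V n))
    (fun z => u (x + s • z) * φ z) hs.le
  rw [← integral_add_right_eq_self _ x]
  simp only [add_sub_cancel_right]
  simp only [smul_smul, mul_inv_cancel₀ hs.ne', one_smul] at h1
  simp only [finrank_euclideanSpace, Fintype.card_fin, smul_eq_mul] at h1
  rw [← h1]
  simp_rw [add_comm x]

lemma A_diff {F : ℝ → ℝ} (hF : ContDiff ℝ (⊤ : ℕ∞) F)
    (h1 : ∀ t, 1 ≤ t → F t = t ^ ((2 - n : ℝ) / 2)) {G : V n → ℝ} (hG : G = fun z => F (‖z‖ ^ 2))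
    {u : V n → ℝ} (hu : Sm u) {s R : ℝ} (hs : 0 < s) (hR : 0 < R) (x : V n) :
    (∫ z, u (x + s • z) * eucLap G z) - ∫ z, u (x + R • z) * eucLap G z
    = ∫ y, eucLap u y * ((s ^ 2) ^ ((2 - n : ℝ) / 2) * G (s⁻¹ • (y - x))
        - (R ^ 2) ^ ((2 - n : ℝ) / 2) * G (R⁻¹ • (y - x))) := by
  have hGs : Sm G := by rw [hG]; exact Sm_radial hF
  have hsm : ∀ s c : ℝ, Sm (fun y => c * G (s • (y - x))) := fun s c =>
    contDiff_const.mul (hGs.comp (by fun_prop))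
  have hval : ∀ s : ℝ, 0 < s → ∀ w : V n, s ≤ ‖w‖ →
      (s ^ 2) ^ ((2 - n : ℝ) / 2) * G (s⁻¹ • w) = (‖w‖ ^ 2) ^ ((2 - n : ℝ) / 2) := by
    intro s hs w hw
    have hn : ‖s⁻¹ • w‖ ^ 2 = ‖w‖ ^ 2 / s ^ 2 := by
      rw [norm_smul, norm_inv, Real.norm_eq_abs, abs_of_pos hs]
      field_simp
    rw [hG]
    simp only [hn]
    rw [h1, ← Real.mul_rpow (by positivity) (by positivity)]
    · congr 1
      field_simp
    · rw [one_le_div (by positivity)]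
      exact pow_le_pow_left₀ hs.le hw 2
  have hcs : HasCompactSupport (fun y => (s ^ 2) ^ ((2 - n : ℝ) / 2) * G (s⁻¹ • (y - x))
        - (R ^ 2) ^ ((2 - n : ℝ) / 2) * G (R⁻¹ • (y - x))) := by
    refine HasCompactSupport.intro (K := Metric.closedBall x (max s R)) (isCompact_closedBall _ _) ?_
    intro y hy
    have h2 : max s R < ‖y - x‖ := by simpa [dist_eq_norm] using hy
    rw [hval s hs _ ((le_max_left _ _).trans h2.le), hval R hR _ ((le_max_right _ _).trans h2.le)]
    simp
  rw [← green hu ((hsm _ _).sub (hsm _ _)) (Or.inr hcs), lap_sub (hsm _ _) (hsm _ _),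
    lap_scale hGs, lap_scale hGs]
  have hL : HasCompactSupport (eucLap G) := by rw [hG]; exact lap_G_cs hF h1
  have hint : ∀ s : ℝ, 0 < s → ∀ c : ℝ,
      Integrable (fun y => u y * (c * eucLap G (s⁻¹ • (y - x)))) := by
    intro s hs c
    refine integrable_mul hu.continuous ?_ (Or.inr ?_)
    · have := hGs.lap.continuous
      fun_prop
    · refine HasCompactSupport.intro (K := Metric.closedBall x s) (isCompact_closedBall _ _) ?_
      intro y hy
      have h2 : s < ‖y - x‖ := by simpa [dist_eq_norm] using hy
      rw [hG, lap_G_zero hF h1, mul_zero]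
      rw [norm_smul, norm_inv, Real.norm_eq_abs, abs_of_pos hs, ← div_eq_inv_mul]
      exact (one_lt_div hs).2 h2
  simp only [mul_sub]
  rw [integral_sub (hint s hs _) (hint R hR _)]
  simp only [mul_left_comm (u _)]
  rw [integral_const_mul, integral_const_mul, subst_int hs, subst_int hR, ← mul_assoc, ← mul_assoc,
    pow_scale hs, pow_scale hR, one_mul, one_mul]

lemma A_zero {F : ℝ → ℝ} (hF : ContDiff ℝ (⊤ : ℕ∞) F)
    (h1 : ∀ t, 1 ≤ t → F t = t ^ ((2 - n : ℝ) / 2)) {G : V n → ℝ} (hG : G = fun z => F (‖z‖ ^ 2))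
    {u : V n → ℝ} (hu : Sm u) {K : ℝ} (hf : ∀ y, K < ‖y‖ → eucLap u y = 0)
    (x : V n) (hx : K + 1 < ‖x‖) :
    (∫ z, u (x + (1:ℝ) • z) * eucLap G z) = u x * ∫ z, eucLap G z := by
  have hGs : Sm G := by rw [hG]; exact Sm_radial hF
  have hconst : ∀ s ∈ Ioc (0:ℝ) 1, (∫ z, u (x + s • z) * eucLap G z)
      = ∫ z, u (x + (1:ℝ) • z) * eucLap G z := by
    intro s hs
    have := A_diff hF h1 hG hu hs.1 one_pos x
    rw [← sub_eq_zero, this]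
    rw [← integral_zero (V n) ℝ]
    congr 1
    funext y
    rcases lt_or_ge K ‖y‖ with h | h
    · rw [hf y h, zero_mul]
    · have hyx : 1 ≤ ‖y - x‖ := by
        have := norm_sub_norm_le x y
        rw [norm_sub_rev] at this
        linarith
      have hval : ∀ s : ℝ, 0 < s → s ≤ ‖y - x‖ →
          (s ^ 2) ^ ((2 - n : ℝ) / 2) * G (s⁻¹ • (y - x)) = (‖y - x‖ ^ 2) ^ ((2 - n : ℝ) / 2) := by
        intro s hs hw
        have hn : ‖s⁻¹ • (y - x)‖ ^ 2 = ‖y - x‖ ^ 2 / s ^ 2 := by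
          rw [norm_smul, norm_inv, Real.norm_eq_abs, abs_of_pos hs]
          field_simp
        rw [hG]
        simp only [hn]
        rw [h1, ← Real.mul_rpow (by positivity) (by positivity)]
        · congr 1
          field_simp
        · rw [one_le_div (by positivity)]
          exact pow_le_pow_left₀ hs.le hw 2
      rw [hval s hs.1 (hs.2.trans hyx), hval 1 one_pos hyx]
      simp
  have hset : ∀ s : ℝ, (∫ z in Metric.closedBall (0 : V n) 1, u (x + s • z) * eucLap G z)
      = ∫ z, u (x + s • z) * eucLap G z := by
    intro s
    refine setIntegral_eq_integral_of_forall_compl_eq_zero ?_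
    intro z hz
    rw [hG, lap_G_zero hF h1 (by simpa using hz), mul_zero]
  have hcont : Continuous (fun s : ℝ => ∫ z, u (x + s • z) * eucLap G z) := by
    simp_rw [← hset]
    refine continuous_parametric_integral_of_continuous (f := fun (s : ℝ) z => u (x + s • z) * eucLap G z) ?_ (isCompact_closedBall _ _)
    have h2 := hGs.lap.continuous
    have h3 := hu.continuous
    simp only [Function.uncurry_def]
    fun_prop
  have hlim : Tendsto (fun s : ℝ => ∫ z, u (x + s • z) * eucLap G z) (𝓝[>] 0)
      (𝓝 (∫ z, u (x + (0:ℝ) • z) * eucLap G z)) := (hcont.tendsto 0).mono_left nhdsWithin_le_nhds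
  have hlim2 : Tendsto (fun s : ℝ => ∫ z, u (x + s • z) * eucLap G z) (𝓝[>] 0)
      (𝓝 (∫ z, u (x + (1:ℝ) • z) * eucLap G z)) := by
    refine tendsto_const_nhds.congr' ?_
    filter_upwards [Ioc_mem_nhdsGT (show (0:ℝ) < 1 by norm_num)] with s hs
    exact (hconst s hs).symm
  rw [tendsto_nhds_unique hlim2 hlim]
  simp only [zero_smul, add_zero]
  rw [integral_const_mul]

lemma A_lim {φ : V n → ℝ} (hφ : Sm φ) (hφ1 : ∀ z, 1 < ‖z‖ → φ z = 0)
    {u : V n → ℝ} (hu : Sm u) {C a : ℝ} (ha0 : 0 ≤ a) (ha : a < 1)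
    (hg : ∀ x, |u x| ≤ C * (1 + ‖x‖) ^ a) (x x0 : V n) :
    Tendsto (fun R : ℝ => (∫ z, u (x + R • z) * φ z) - ∫ z, u (x0 + R • z) * φ z) atTop (𝓝 0) := by
  have hcs : HasCompactSupport φ := by
    refine HasCompactSupport.intro (K := Metric.closedBall 0 1) (isCompact_closedBall _ _) ?_
    intro z hz
    exact hφ1 z (by simpa using hz)
  obtain ⟨L, hL⟩ := ContDiff.lipschitzWith_of_hasCompactSupport hcs hφ (by simp)
  have hC : 0 ≤ C := by
    have := hg 0
    simp at this
    exact (abs_nonneg _).trans this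
  set W : ℝ := volume.real (Metric.closedBall (0 : V n) 2) with hW
  have key : ∀ R : ℝ, max 1 ‖x0 - x‖ ≤ R →
      ‖(∫ z, u (x + R • z) * φ z) - ∫ z, u (x0 + R • z) * φ z‖
        ≤ (C * (4 + ‖x0‖) ^ a * (L * ‖x0 - x‖) * W) * R ^ (-(1 - a)) := by
    intro R hR
    have hR1 : 1 ≤ R := (le_max_left _ _).trans hR
    have hR2 : ‖x0 - x‖ ≤ R := (le_max_right _ _).trans hR
    have hR0 : 0 < R := by linarith
    set e : V n := R⁻¹ • (x0 - x) with he
    have hen : ‖e‖ = ‖x0 - x‖ / R := by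
      rw [he, norm_smul, norm_inv, Real.norm_eq_abs, abs_of_pos hR0, div_eq_inv_mul]
    have he1 : ‖e‖ ≤ 1 := by rw [hen]; exact (div_le_one hR0).2 hR2
    have e1 : (∫ z, u (x + R • z) * φ z) = ∫ z, u (x0 + R • z) * φ (z + e) := by
      rw [← integral_add_right_eq_self _ e]
      congr 1
      funext z
      congr 2
      rw [he, smul_add, smul_smul, mul_inv_cancel₀ hR0.ne', one_smul]
      abel
    have huc := hu.continuous
    have hφc := hφ.continuous
    have hcs' : HasCompactSupport (fun z => φ (z + e)) :=
      hcs.comp_homeomorph (Homeomorph.addRight e)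
    rw [e1, ← integral_sub (integrable_mul (by fun_prop) (by fun_prop) (Or.inr hcs'))
      (integrable_mul (by fun_prop) (by fun_prop) (Or.inr hcs))]
    rw [← setIntegral_eq_integral_of_forall_compl_eq_zero (s := Metric.closedBall (0 : V n) 2)]
    · refine (norm_setIntegral_le_of_norm_le_const
        (C := (C * (4 + ‖x0‖) ^ a * (L * ‖x0 - x‖)) * R ^ (-(1 - a))) ?_ ?_).trans (le_of_eq ?_)
      · exact (isCompact_closedBall _ _).measure_lt_top
      · intro z hz
        have hz2 : ‖z‖ ≤ 2 := by simpa using hz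
        rw [← mul_sub, norm_mul, Real.norm_eq_abs]
        have b1 : |u (x0 + R • z)| ≤ C * ((4 + ‖x0‖) ^ a * R ^ a) := by
          refine (hg _).trans (mul_le_mul_of_nonneg_left ?_ hC)
          rw [← Real.mul_rpow (by positivity) hR0.le]
          refine Real.rpow_le_rpow (by positivity) ?_ ha0
          have h3 : ‖x0 + R • z‖ ≤ ‖x0‖ + R * 2 := by
            refine (norm_add_le _ _).trans ?_
            rw [norm_smul, Real.norm_eq_abs, abs_of_pos hR0]
            gcongr
          nlinarith [norm_nonneg x0]
        have b2 : ‖φ (z + e) - φ z‖ ≤ L * (‖x0 - x‖ / R) := by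
          have := hL.dist_le_mul (z + e) z
          rw [dist_eq_norm, dist_eq_norm, add_sub_cancel_left, hen] at this
          exact this
        refine (mul_le_mul b1 b2 (norm_nonneg _) (by positivity)).trans (le_of_eq ?_)
        have h4 : R ^ (-(1 - a)) = R ^ a / R := by
          rw [show -(1 - a) = a - 1 by ring, Real.rpow_sub_one hR0.ne']
        rw [h4]
        ring
      · rw [← hW]; ring
    · intro z hz
      have hz2 : 2 < ‖z‖ := by simpa using hz
      have : 1 < ‖z + e‖ := by
        have h5 := norm_sub_norm_le z (-e)
        rw [sub_neg_eq_add, norm_neg] at h5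
        linarith
      rw [hφ1 _ this, hφ1 _ (by linarith)]
      simp
  refine squeeze_zero_norm' (a := fun R => (C * (4 + ‖x0‖) ^ a * (L * ‖x0 - x‖) * W) * R ^ (-(1 - a))) ?_ ?_
  · filter_upwards [eventually_ge_atTop (max 1 ‖x0 - x‖)] with R hR using key R hR
  · have := (tendsto_rpow_neg_atTop (show 0 < 1 - a by linarith)).const_mul
      (C * (4 + ‖x0‖) ^ a * (L * ‖x0 - x‖) * W)
    simpa using this

lemma pot_lim (hn : 2 < n) {G : V n → ℝ} {f : V n → ℝ} (hf : Integrable f) {M : ℝ}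
    (hM : ∀ z, |G z| ≤ M) (x : V n) :
    Tendsto (fun R : ℝ => ∫ y, f y * ((R ^ 2) ^ ((2 - n : ℝ) / 2) * G (R⁻¹ • (y - x))))
      atTop (𝓝 0) := by
  have hn' : (2:ℝ) < n := by exact_mod_cast hn
  refine squeeze_zero_norm'
    (a := fun R : ℝ => R ^ (-((n:ℝ) - 2)) * (M * ∫ y, ‖f y‖)) ?_ ?_
  · filter_upwards [eventually_gt_atTop (0:ℝ)] with R hR
    have hp : (R ^ 2) ^ ((2 - n : ℝ) / 2) = R ^ (-((n:ℝ) - 2)) := by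
      rw [← Real.rpow_natCast R 2, ← Real.rpow_mul hR.le]
      congr 1
      push_cast
      ring
    rw [hp]
    rw [← integral_const_mul, ← integral_const_mul]
    refine norm_integral_le_of_norm_le ((hf.norm.const_mul _).const_mul _) ?_
    refine ae_of_all _ fun y => ?_
    have h0 : 0 < R ^ (-((n:ℝ) - 2)) := Real.rpow_pos_of_pos hR _
    rw [norm_mul, norm_mul, Real.norm_eq_abs (R ^ _), abs_of_pos h0]
    have := hM (R⁻¹ • (y - x))
    rw [← Real.norm_eq_abs] at this
    calc ‖f y‖ * (R ^ (-((n:ℝ) - 2)) * ‖G (R⁻¹ • (y - x))‖)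
        ≤ ‖f y‖ * (R ^ (-((n:ℝ) - 2)) * M) := by gcongr
      _ = _ := by ring
  · have := (tendsto_rpow_neg_atTop (show 0 < (n:ℝ) - 2 by linarith)).mul_const
      (M * ∫ y, ‖f y‖)
    simpa using this

lemma rep (hn : 2 < n) {u : V n → ℝ} (hu : Sm u) {K : ℝ} (hK : 0 ≤ K)
    (hf : ∀ y, K < ‖y‖ → eucLap u y = 0)
    {C a : ℝ} (ha0 : 0 ≤ a) (ha : a < 1) (hg : ∀ x, |u x| ≤ C * (1 + ‖x‖) ^ a) :
    ∃ c κ : ℝ, ∀ x : V n, K + 1 < ‖x‖ →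
      u x = c + κ * ∫ y, eucLap u y * (‖y - x‖ ^ 2) ^ ((2 - n : ℝ) / 2) := by
  have hn' : (2:ℝ) < n := by exact_mod_cast hn
  obtain ⟨F, hF, h1, M, hM⟩ := exists_F ((2 - n : ℝ) / 2) (by linarith)
  set G : V n → ℝ := fun z => F (‖z‖ ^ 2) with hG
  have hGs : Sm G := Sm_radial hF
  have hc0 : ∫ z, eucLap G z ≠ 0 := integral_lap_G hn hF h1
  set c0 := ∫ z, eucLap G z with hc0def
  have hfc : HasCompactSupport (eucLap u) := by
    refine HasCompactSupport.intro (K := Metric.closedBall 0 K) (isCompact_closedBall _ _) ?_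
    intro z hz
    exact hf z (by simpa using hz)
  have hfi : Integrable (eucLap u) := hu.lap.continuous.integrable_of_hasCompactSupport hfc
  set N : V n → ℝ := fun x => ∫ y, eucLap u y * (‖y - x‖ ^ 2) ^ ((2 - n : ℝ) / 2) with hN
  have hGi : ∀ (c s : ℝ) (x : V n), Integrable (fun y => eucLap u y * (c * G (s • (y - x)))) := by
    intro c s x
    have := hGs.continuous
    exact integrable_mul hu.lap.continuous (by fun_prop) (Or.inl hfc)
  have hA : ∀ x, K + 1 < ‖x‖ → ∀ R : ℝ, 0 < R →
      u x * c0 - N x = (∫ z, u (x + R • z) * eucLap G z)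
        - ∫ y, eucLap u y * ((R ^ 2) ^ ((2 - n : ℝ) / 2) * G (R⁻¹ • (y - x))) := by
    intro x hx R hR
    have e1 := A_diff hF h1 hG hu one_pos hR x
    rw [A_zero hF h1 hG hu hf x hx] at e1
    simp only [mul_sub] at e1
    rw [integral_sub (hGi _ _ _) (hGi _ _ _)] at e1
    have e2 : ∫ y, eucLap u y * (((1:ℝ) ^ 2) ^ ((2 - n : ℝ) / 2) * G ((1:ℝ)⁻¹ • (y - x))) = N x := by
      rw [hN]
      congr 1
      funext y
      rcases lt_or_ge K ‖y‖ with h | h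
      · rw [hf y h, zero_mul, zero_mul]
      · have hyx : 1 ≤ ‖y - x‖ := by
          have := norm_sub_norm_le x y
          rw [norm_sub_rev] at this
          linarith
        simp only [hG, inv_one, one_smul, one_pow, Real.one_rpow, one_mul]
        rw [h1 _ (by nlinarith)]
    rw [e2] at e1
    linarith
  obtain ⟨x0, hx0⟩ : ∃ x0 : V n, K + 1 < ‖x0‖ := by
    refine ⟨EuclideanSpace.single ⟨0, by omega⟩ (K + 2), ?_⟩
    simp only [PiLp.norm_single, Real.norm_eq_abs]
    rw [abs_of_nonneg (by linarith)]
    linarith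
  have hmain : ∀ x, K + 1 < ‖x‖ → u x * c0 - N x = u x0 * c0 - N x0 := by
    intro x hx
    have l1 := A_lim (φ := eucLap G) hGs.lap (fun z hz => lap_G_zero hF h1 hz) hu ha0 ha hg x x0
    have hGM : ∀ z, |G z| ≤ M := fun z => hM _ (by positivity)
    have l2 := pot_lim hn hfi hGM x
    have l3 := pot_lim hn hfi hGM x0
    have l4 := (l1.sub l2).add l3
    have l5 : Tendsto (fun R : ℝ => (u x * c0 - N x) - (u x0 * c0 - N x0)) atTop
        (𝓝 (0 - 0 + 0)) := by
      refine l4.congr' ?_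
      filter_upwards [eventually_gt_atTop (0:ℝ)] with R hR
      rw [hA x hx R hR, hA x0 hx0 R hR]
      ring
    have l6 := tendsto_nhds_unique l5 tendsto_const_nhds
    linarith
  refine ⟨(u x0 * c0 - N x0) / c0, 1 / c0, fun x hx => ?_⟩
  have := hmain x hx
  show u x = _ + _ * N x
  field_simp
  linarith

/-- scalar second order Taylor bound -/
lemma taylor_rpow (p : ℝ) : ∃ B, 0 ≤ B ∧ ∀ s : ℝ, |s| ≤ 1/2 → |(1 + s) ^ p - 1 - p * s| ≤ B * s ^ 2 := by
  -- second derivative bound on `[1/2, 3/2]`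
  obtain ⟨B, hB⟩ := (isCompact_Icc (a := (1/2:ℝ)) (b := 3/2)).exists_bound_of_continuousOn
    (f := fun t : ℝ => p * ((p - 1) * t ^ (p - 1 - 1)))
    (by
      intro t ht
      have : t ≠ 0 := by linarith [ht.1]
      exact ContinuousAt.continuousWithinAt
        (continuousAt_const.mul (continuousAt_const.mul (Real.continuousAt_rpow_const _ _ (Or.inl this)))))
  have hB0 : 0 ≤ B := (norm_nonneg _).trans (hB 1 (by norm_num))
  refine ⟨B, hB0, fun s hs => ?_⟩
  have hs' := abs_le.1 hs
  have hmem : ∀ t : ℝ, t ∈ Icc (-|s|) |s| → |t| ≤ |s| := fun t ht => abs_le.2 ht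
  have hd : ∀ t : ℝ, |t| ≤ |s| → HasDerivAt (fun t : ℝ => p * (1 + t) ^ (p - 1) - p)
      (p * ((p - 1) * (1 + t) ^ (p - 1 - 1))) t := by
    intro t ht
    have ht' := abs_le.1 (ht.trans hs)
    have h1 : HasDerivAt (fun t : ℝ => 1 + t) 1 t := (hasDerivAt_id t).const_add 1
    have h2 := ((h1.rpow_const (p := p - 1) (Or.inl (by linarith))).const_mul p).sub_const p
    rwa [one_mul] at h2
  have hd2 : ∀ t : ℝ, |t| ≤ |s| → HasDerivAt (fun t : ℝ => (1 + t) ^ p - 1 - p * t)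
      (p * (1 + t) ^ (p - 1) - p) t := by
    intro t ht
    have ht' := abs_le.1 (ht.trans hs)
    have h1 : HasDerivAt (fun t : ℝ => 1 + t) 1 t := (hasDerivAt_id t).const_add 1
    have h2 := ((h1.rpow_const (p := p) (Or.inl (by linarith))).sub_const 1).sub
      ((hasDerivAt_id t).const_mul p)
    rw [one_mul, mul_one] at h2
    exact h2
  have hconv : Convex ℝ (Icc (-|s|) |s|) := convex_Icc _ _
  have h0m : (0:ℝ) ∈ Icc (-|s|) |s| := ⟨by simp, by simp⟩
  have b1 : ∀ t : ℝ, |t| ≤ |s| → |p * (1 + t) ^ (p - 1) - p| ≤ B * |s| := by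
    intro t ht
    have := hconv.norm_image_sub_le_of_norm_hasDerivWithin_le (f := fun t : ℝ => p * (1 + t) ^ (p - 1) - p)
      (C := B) (x := 0) (y := t) (fun r hr => (hd r (hmem r hr)).hasDerivWithinAt)
      (fun r hr => hB (1 + r) (by
        have hr' := abs_le.1 (le_trans (hmem r hr) hs)
        constructor <;> linarith [hr'.1, hr'.2])) h0m (abs_le.1 ht)
    simp at this
    exact this.trans (by gcongr)
  have := hconv.norm_image_sub_le_of_norm_hasDerivWithin_le (f := fun t : ℝ => (1 + t) ^ p - 1 - p * t)
      (C := B * |s|) (x := 0) (y := s) (fun r hr => (hd2 r (hmem r hr)).hasDerivWithinAt)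
      (fun r hr => b1 r (hmem r hr)) h0m (abs_le.1 (le_refl _))
  simp at this
  rw [← sq_abs s]
  calc _ ≤ _ := this
    _ = _ := by ring

lemma kernel_bound (n : ℕ) {K : ℝ} (hK : 1 ≤ K) : ∃ B, 0 ≤ B ∧ ∀ x y : V n, ‖y‖ ≤ K → 8 * K ^ 2 ≤ ‖x‖ →
    |(‖y - x‖ ^ 2) ^ ((2 - n : ℝ) / 2) - (‖x‖ ^ 2) ^ ((2 - n : ℝ) / 2)
      - (n - 2) * ‖x‖ ^ (-(n:ℝ)) * inner ℝ x y| ≤ B * ‖x‖ ^ (-(n:ℝ)) := by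
  set p : ℝ := (2 - n : ℝ) / 2 with hp
  obtain ⟨B, hB0, hB⟩ := taylor_rpow p
  refine ⟨B * (9 * K ^ 4) + |p| * K ^ 2, by positivity, fun x y hy hx => ?_⟩
  have hx1 : 8 ≤ ‖x‖ := by nlinarith
  have hx0 : 0 < ‖x‖ := by linarith
  set r := ‖x‖ with hr
  set q : ℝ := inner ℝ x y with hq
  have hqb : |q| ≤ r * K := (abs_real_inner_le_norm x y).trans (by gcongr)
  set s : ℝ := (‖y‖ ^ 2 - 2 * q) / r ^ 2 with hs
  have hnorm : ‖y - x‖ ^ 2 = r ^ 2 * (1 + s) := by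
    rw [norm_sub_sq_real, real_inner_comm, ← hq, hs]
    field_simp
    ring
  have hy2 : ‖y‖ ^ 2 ≤ K ^ 2 := pow_le_pow_left₀ (norm_nonneg y) hy 2
  have hsb : |s| ≤ 3 * K ^ 2 / r := by
    rw [hs, abs_div, abs_of_pos (show 0 < r ^ 2 by positivity), div_le_div_iff₀ (by positivity) hx0]
    have h1 : |‖y‖ ^ 2 - 2 * q| ≤ K ^ 2 + 2 * (r * K) := by
      have := abs_sub (‖y‖ ^ 2) (2 * q)
      rw [abs_mul, abs_of_nonneg (show 0 ≤ ‖y‖ ^ 2 by positivity), abs_two] at this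
      linarith
    have h2 : K ^ 2 + 2 * (r * K) ≤ 3 * K ^ 2 * r := by nlinarith [mul_nonneg hx0.le (show 0 ≤ K * (K - 1) by nlinarith), mul_nonneg (sq_nonneg K) (show 0 ≤ r - 1 by linarith)]
    calc _ ≤ (K ^ 2 + 2 * (r * K)) * r := by gcongr
      _ ≤ (3 * K ^ 2 * r) * r := by gcongr
      _ = _ := by ring
  have hs2 : |s| ≤ 1/2 := by
    refine hsb.trans ?_
    rw [div_le_iff₀ hx0]
    nlinarith
  have hsq : s ^ 2 ≤ 9 * K ^ 4 / r ^ 2 := by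
    rw [← sq_abs]
    calc |s| ^ 2 ≤ (3 * K ^ 2 / r) ^ 2 := by gcongr
      _ = _ := by ring
  have hrp : (r ^ 2) ^ p = r ^ 2 * r ^ (-(n:ℝ)) := by
    rw [← Real.rpow_natCast r 2, ← Real.rpow_mul hx0.le, ← Real.rpow_add hx0]
    congr 1
    push_cast
    rw [hp]
    ring
  have h1s : 0 ≤ 1 + s := by linarith [(abs_le.1 hs2).1]
  have hT := hB s hs2
  rw [hnorm, Real.mul_rpow (by positivity) h1s, hrp]
  set m := r ^ (-(n:ℝ)) with hm
  have hm0 : 0 < m := Real.rpow_pos_of_pos hx0 _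
  have hn2 : (n:ℝ) - 2 = - 2 * p := by rw [hp]; ring
  have hrs : r ^ 2 * s = ‖y‖ ^ 2 - 2 * q := by rw [hs]; field_simp
  have e : r ^ 2 * m * (1 + s) ^ p - r ^ 2 * m - (n - 2) * m * q
      = m * (r ^ 2 * ((1 + s) ^ p - 1 - p * s)) + m * (p * ‖y‖ ^ 2) := by
    rw [hn2]
    linear_combination m * p * hrs
  rw [e]
  refine (abs_add_le _ _).trans ?_
  rw [abs_mul, abs_mul, abs_mul, abs_mul, abs_of_pos hm0, abs_of_nonneg (show 0 ≤ r ^ 2 by positivity),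
    abs_of_nonneg (show 0 ≤ ‖y‖ ^ 2 by positivity)]
  have f1 : r ^ 2 * |(1 + s) ^ p - 1 - p * s| ≤ B * (9 * K ^ 4) := by
    calc _ ≤ r ^ 2 * (B * (9 * K ^ 4 / r ^ 2)) := by gcongr; exact hT.trans (by gcongr)
      _ = _ := by field_simp
  have f2 : |p| * ‖y‖ ^ 2 ≤ |p| * K ^ 2 := by gcongr
  calc _ ≤ m * (B * (9 * K ^ 4)) + m * (|p| * K ^ 2) := by gcongr
    _ = _ := by ring
lemma decay (hn : 2 < n) {u : V n → ℝ} (hu : Sm u) {K : ℝ} (hK : 1 ≤ K)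
    (hf : ∀ y, K < ‖y‖ → eucLap u y = 0)
    {C a : ℝ} (ha0 : 0 ≤ a) (ha : a < 1) (hg : ∀ x, |u x| ≤ C * (1 + ‖x‖) ^ a)
    (m0 : ∫ y, eucLap u y = 0) (m1 : ∀ k, ∫ y, eucLap u y * y k = 0) :
    ∃ c B R : ℝ, ∀ x : V n, R ≤ ‖x‖ → |u x - c| ≤ B * ‖x‖ ^ (-(n:ℝ)) := by
  obtain ⟨c, κ, hrep⟩ := rep hn hu (by linarith) hf ha0 ha hg
  obtain ⟨B, hB0, hB⟩ := kernel_bound n hK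
  have hfc : HasCompactSupport (eucLap u) := by
    refine HasCompactSupport.intro (K := Metric.closedBall 0 K) (isCompact_closedBall _ _) ?_
    intro z hz
    exact hf z (by simpa using hz)
  have hlc := hu.lap.continuous
  have hfi : Integrable (eucLap u) := hlc.integrable_of_hasCompactSupport hfc
  refine ⟨c, |κ| * (B * ∫ y, ‖eucLap u y‖), 8 * K ^ 2 + K + 2, fun x hx => ?_⟩
  have hx1 : K + 1 < ‖x‖ := by nlinarith [sq_nonneg K]
  have hx2 : 8 * K ^ 2 ≤ ‖x‖ := by linarith
  rw [hrep x hx1, add_sub_cancel_left, abs_mul, mul_assoc]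
  refine mul_le_mul_of_nonneg_left ?_ (abs_nonneg κ)
  set p : ℝ := (2 - n : ℝ) / 2 with hp
  set m : ℝ := ‖x‖ ^ (-(n:ℝ)) with hm
  have hin : ∫ y, eucLap u y * inner ℝ x y = 0 := by
    have : ∀ y : V n, eucLap u y * inner ℝ x y = ∑ k, x k * (eucLap u y * y k) := by
      intro y
      rw [PiLp.inner_apply, Finset.mul_sum]
      refine Finset.sum_congr rfl fun k _ => ?_
      simp
      ring
    simp_rw [this]
    rw [integral_finsetSum]
    · simp_rw [integral_const_mul, m1]
      simp
    · intro k _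
      exact (integrable_mul hlc (by fun_prop) (Or.inl hfc)).const_mul _
  have hii : Integrable (fun y => eucLap u y * inner ℝ x y) :=
    integrable_mul hlc (by fun_prop) (Or.inl hfc)
  have hpt : ∀ y, |eucLap u y * ((‖y - x‖ ^ 2) ^ p - (‖x‖ ^ 2) ^ p - (n - 2) * m * inner ℝ x y)|
      ≤ (B * m) * ‖eucLap u y‖ := by
    intro y
    rw [abs_mul, Real.norm_eq_abs, mul_comm]
    rcases lt_or_ge K ‖y‖ with h | h
    · rw [hf y h]; simp
    · gcongr
      exact hB x y h hx2
  have hker : Integrable (fun y =>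
      eucLap u y * ((‖y - x‖ ^ 2) ^ p - (‖x‖ ^ 2) ^ p - (n - 2) * m * inner ℝ x y)) := by
    refine (hfi.norm.const_mul (B * m)).mono' ?_ (ae_of_all _ hpt)
    refine Measurable.aestronglyMeasurable ?_
    have := hlc.measurable
    fun_prop
  have e : ∫ y, eucLap u y * (‖y - x‖ ^ 2) ^ p
      = ∫ y, eucLap u y * ((‖y - x‖ ^ 2) ^ p - (‖x‖ ^ 2) ^ p - (n - 2) * m * inner ℝ x y) := by
    have : ∀ y, eucLap u y * (‖y - x‖ ^ 2) ^ p
      = eucLap u y * ((‖y - x‖ ^ 2) ^ p - (‖x‖ ^ 2) ^ p - (n - 2) * m * inner ℝ x y)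
        + ((‖x‖ ^ 2) ^ p * eucLap u y + ((n - 2) * m) * (eucLap u y * inner ℝ x y)) := by
      intro y; ring
    simp_rw [this]
    have hsum : Integrable (fun y => (‖x‖ ^ 2) ^ p * eucLap u y
        + ((n - 2) * m) * (eucLap u y * inner ℝ x y)) :=
      (hfi.const_mul _).add (hii.const_mul _)
    rw [integral_add hker hsum,
      integral_add (hfi.const_mul _) (hii.const_mul _), integral_const_mul, integral_const_mul, m0, hin]
    simp
  rw [e, ← Real.norm_eq_abs]
  refine (norm_integral_le_of_norm_le (hfi.norm.const_mul (B * m)) (ae_of_all _ hpt)).trans ?_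
  rw [integral_const_mul]
  exact le_of_eq (by ring)

lemma Sm_coord (k : Fin n) : Sm (fun x : V n => x k) :=
  (EuclideanSpace.proj k : V n →L[ℝ] ℝ).contDiff

lemma D_coord (i k : Fin n) : D i (fun x : V n => x k) = fun _ => if k = i then 1 else 0 := by
  funext x
  unfold D
  have : HasFDerivAt (fun x : V n => x k) (EuclideanSpace.proj k : V n →L[ℝ] ℝ) x :=
    (EuclideanSpace.proj k : V n →L[ℝ] ℝ).hasFDerivAt
  rw [this.fderiv]
  simp [Pi.single_apply]

lemma D_const (i : Fin n) (c : ℝ) : D i (fun _ : V n => c) = fun _ => 0 := by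
  funext x
  unfold D
  simp

lemma D_mul {f g : V n → ℝ} (hf : Sm f) (hg : Sm g) (i : Fin n) :
    D i (fun x => f x * g x) = fun x => f x * D i g x + g x * D i f x := by
  funext x
  unfold D
  rw [fderiv_fun_mul (hf.diff x) (hg.diff x)]
  simp

lemma D_add {f g : V n → ℝ} (hf : Sm f) (hg : Sm g) (i : Fin n) :
    D i (fun x => f x + g x) = fun x => D i f x + D i g x := by
  funext x
  unfold D
  rw [fderiv_fun_add (hf.diff x) (hg.diff x)]
  simp

lemma lap_coord (k : Fin n) (x : V n) : eucLap (fun x : V n => x k) x = 0 := by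
  rw [eucLap_eq]
  simp_rw [D_coord, D_const]
  simp

lemma D_quad (i k l : Fin n) : D i (fun x : V n => x k * x l)
    = fun x => x k * (if l = i then 1 else 0) + x l * (if k = i then 1 else 0) := by
  rw [D_mul (Sm_coord k) (Sm_coord l), D_coord, D_coord]

lemma lap_quad (k l : Fin n) (x : V n) : eucLap (fun x : V n => x k * x l) x
    = if k = l then 2 else 0 := by
  rw [eucLap_eq]
  have : ∀ i : Fin n, D i (D i (fun x : V n => x k * x l)) x
      = 2 * ((if l = i then 1 else 0) * (if k = i then 1 else 0)) := by
    intro i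
    have h1 : ∀ (k : Fin n) (c : ℝ), Sm (fun x : V n => x k * c) := fun k c =>
      (Sm_coord k).mul contDiff_const
    rw [D_quad, D_add (h1 _ _) (h1 _ _), D_mul (Sm_coord k) contDiff_const,
      D_mul (Sm_coord l) contDiff_const]
    simp only [D_coord, D_const]
    ring
  simp_rw [this]
  by_cases h : k = l
  · subst h
    simp
  · simp [h, eq_comm]

lemma b_zero (hn : 2 < n) (b : Fin n → Fin n → Fin n → ℝ) (hsym : ∀ i j k, b i j k = b j i k)
    (htr : ∀ k, ∑ i, b i i k = 0) (h1 : ∀ j k l, k ≠ l → b k j l + b l j k = 0)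
    (h2 : ∀ j k l, b k j k = b l j l) : ∀ i j k, b i j k = 0 := by
  have hβ : ∀ j k, b k j k = 0 := by
    have hd : ∀ k j, k ≠ j → b k k j = - b j j j := by
      intro k j hkj
      have e1 := h1 k k j hkj
      have e2 := hsym j k k
      have e3 := h2 j k j
      linarith
    intro j k
    rw [h2 j k j]
    have := htr j
    rw [← Finset.add_sum_erase _ _ (Finset.mem_univ j)] at this
    rw [Finset.sum_congr rfl (fun i hi => hd i j (Finset.ne_of_mem_erase hi))] at this
    rw [Finset.sum_const, Finset.card_erase_of_mem (Finset.mem_univ j)] at this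
    simp only [Finset.card_univ, Fintype.card_fin, nsmul_eq_mul] at this
    rw [Nat.cast_sub (by omega)] at this
    have hn' : (2:ℝ) < n := by exact_mod_cast hn
    have h3 : ((n:ℝ) - 2) * b j j j = 0 := by push_cast at this; linarith
    rcases mul_eq_zero.1 h3 with h | h
    · linarith
    · exact h
  intro i j k
  by_cases hik : i = k
  · subst hik; exact hβ j i
  by_cases hjk : j = k
  · subst hjk; rw [hsym]; exact hβ i j
  by_cases hij : i = j
  · subst hij
    have := h1 i i k hik
    rw [hsym k i i, hβ] at this
    linarith
  have a1 := h1 j i k hik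
  have a2 := hsym k j i
  have a3 := h1 k j i (Ne.symm hij)
  have a4 := hsym i k j
  have a5 := h1 i k j (Ne.symm hjk)
  have a6 := hsym j i k
  linarith

lemma global (hn : 2 < n) {u : V n → Fin n → Fin n → ℝ} (hu : ∀ i j, Sm (fun x => u x i j))
    {K : ℝ} (hK : 1 ≤ K)
    (hf : ∀ i j y, K < ‖y‖ → eucLap (fun x => u x i j) y = 0)
    (hw : ∀ j y, K < ‖y‖ → ∑ i, D i (fun x => u x i j) y = 0)
    (hsym : ∀ x i j, u x i j = u x j i) (htr : ∀ x, ∑ i, u x i i = 0)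
    {a : ℝ} (ha0 : 0 ≤ a) (ha : a < 1) (hg : ∀ i j, ∃ C, ∀ x, |u x i j| ≤ C * (1 + ‖x‖) ^ a)
    (i j : Fin n) :
    ∃ c B R : ℝ, ∀ x : V n, R ≤ ‖x‖ → |u x i j - c| ≤ B * ‖x‖ ^ (-(n:ℝ)) := by
  have cs : ∀ f : V n → ℝ, (∀ y, K < ‖y‖ → f y = 0) → HasCompactSupport f := by
    intro f hf
    refine HasCompactSupport.intro (K := Metric.closedBall 0 K) (isCompact_closedBall _ _) ?_
    intro z hz
    exact hf z (by simpa using hz)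
  have hfc : ∀ i j, HasCompactSupport (eucLap (fun x => u x i j)) := fun i j => cs _ (hf i j)
  have hmom : ∀ j (P : V n → ℝ), Sm P → (∀ x, eucLap P x = 0) →
      ∑ i, ∫ x, eucLap (fun y => u y i j) x * D i P x = 0 := fun j P hP hPh =>
    moment (u := fun x i => u x i j) (fun i => hu i j) (fun i => hfc i j) (cs _ (hw j)) hP hPh
  have hint : ∀ i j (g : V n → ℝ), Continuous g →
      Integrable (fun x => eucLap (fun y => u y i j) x * g x) := fun i j g hgc =>
    integrable_mul (hu i j).lap.continuous hgc (Or.inl (hfc i j))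
  have m0 : ∀ k j, ∫ x, eucLap (fun y => u y k j) x = 0 := by
    intro k j
    have := hmom j _ (Sm_coord k) (lap_coord k)
    simp only [D_coord] at this
    rw [Finset.sum_eq_single k] at this
    · simpa using this
    · intro i _ hi
      simp [Ne.symm hi]
    · simp
  set b : Fin n → Fin n → Fin n → ℝ := fun i j k => ∫ x, eucLap (fun y => u y i j) x * x k with hb
  have hquad : ∀ j k l, ∑ i, ∫ x, eucLap (fun y => u y i j) x * D i (fun x : V n => x k * x l) x
      = b l j k + b k j l := by
    intro j k l
    simp only [D_quad, mul_add]
    have : ∀ i, ∫ x : V n, (eucLap (fun y => u y i j) x * (x k * (if l = i then 1 else 0))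
        + eucLap (fun y => u y i j) x * (x l * (if k = i then 1 else 0)))
        = (if l = i then b i j k else 0) + (if k = i then b i j l else 0) := by
      intro i
      rw [integral_add (hint i j _ (by fun_prop)) (hint i j _ (by fun_prop))]
      congr 1
      · by_cases h : l = i <;> simp [h, hb]
      · by_cases h : k = i <;> simp [h, hb]
    simp_rw [this, Finset.sum_add_distrib]
    simp
  have b1 : ∀ j k l, k ≠ l → b k j l + b l j k = 0 := by
    intro j k l hkl
    have := hmom j _ ((Sm_coord k).mul (Sm_coord l)) (fun x => by rw [lap_quad]; simp [hkl])
    rw [hquad] at this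
    linarith
  have b2 : ∀ j k l, b k j k = b l j l := by
    intro j k l
    have hs : ∀ k : Fin n, Sm (fun x : V n => x k * x k) := fun k => (Sm_coord k).mul (Sm_coord k)
    have hs' : Sm (fun x : V n => (-1) * (x l * x l)) := contDiff_const.mul (hs l)
    have hDn : ∀ i : Fin n, ∀ f : V n → ℝ, Sm f → D i (fun x => (-1) * f x) = fun x => (-1) * D i f x := by
      intro i f hf
      rw [D_mul contDiff_const hf, D_const]
      simp
    have hP : ∀ x, eucLap (fun x : V n => x k * x k + (-1) * (x l * x l)) x = 0 := by
      intro x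
      have q1 := lap_quad k k x
      have q2 := lap_quad l l x
      rw [eucLap_eq] at q1 q2 ⊢
      have : ∀ i : Fin n, D i (D i (fun x : V n => x k * x k + (-1) * (x l * x l))) x
        = D i (D i (fun x : V n => x k * x k)) x + (-1) * D i (D i (fun x : V n => x l * x l)) x := by
        intro i
        rw [D_add (hs k) hs', hDn i _ (hs l), D_add ((hs k).D i) (contDiff_const.mul ((hs l).D i)),
          hDn i _ ((hs l).D i)]
      simp_rw [this, Finset.sum_add_distrib, ← Finset.mul_sum]
      rw [q1, q2]
      simp
    have := hmom j _ ((hs k).add hs') hP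
    have e : ∀ i, ∫ x, eucLap (fun y => u y i j) x * D i (fun x : V n => x k * x k + (-1) * (x l * x l)) x
      = (∫ x, eucLap (fun y => u y i j) x * D i (fun x : V n => x k * x k) x)
        + (-1) * ∫ x, eucLap (fun y => u y i j) x * D i (fun x : V n => x l * x l) x := by
      intro i
      rw [D_add (hs k) hs', hDn i _ (hs l), ← integral_const_mul,
        ← integral_add (hint i j _ ((hs k).D i).continuous) ((hint i j _ ((hs l).D i).continuous).const_mul _)]
      congr 1
      funext x
      ring
    simp_rw [e, Finset.sum_add_distrib, ← Finset.mul_sum] at this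
    rw [hquad, hquad] at this
    linarith
  have bsym : ∀ i j k, b i j k = b j i k := by
    intro i j k
    simp only [hb]
    have : (fun y => u y i j) = (fun y => u y j i) := by funext y; exact hsym y i j
    rw [this]
  have btr : ∀ k, ∑ i, b i i k = 0 := by
    intro k
    simp only [hb]
    rw [← integral_finsetSum _ (fun i _ => hint i i _ (by fun_prop))]
    simp_rw [← Finset.sum_mul]
    have h2 := lap_sum Finset.univ (fun i (y : V n) => u y i i) (fun k _ => hu k k)
    have h3 : ∀ x, ∑ i, eucLap (fun y => u y i i) x = 0 := by
      intro x
      rw [← congrFun h2 x]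
      simp_rw [htr]
      rw [eucLap_eq]
      simp [D_const]
    simp [h3]
  obtain ⟨C, hC⟩ := hg i j
  exact decay hn (hu i j) hK (hf i j) ha0 ha hC (m0 i j)
    (fun k => b_zero hn b bsym btr b1 b2 i j k)

end HDF
/-- **Decay of divergence-free trace-free harmonic symmetric tensor fields (`k = 0` case).**
Let `n > 2`. If a smooth symmetric-matrix-valued field `h` on `ℝⁿ ∖ B_ρ(0)` is harmonic
componentwise, divergence-free, trace-free, and `h = O(|x|^{1-ε})` at infinity for some
`ε > 0`, then `h = h_c + O(|x|^{-n})` for some constant symmetric matrix `h_c`. -/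
theorem harmonic_divergence_free_trace_free_decay
    (n : ℕ) (hn : 2 < n)
    (ρ : ℝ) (hρ : 0 < ρ)
    (h : EuclideanSpace ℝ (Fin n) → Fin n → Fin n → ℝ)
    (hsmooth : ContDiffOn ℝ (⊤ : ℕ∞) h {x | ρ < ‖x‖})
    (hsym : ∀ x i j, h x i j = h x j i)
    (hharm : ∀ x : EuclideanSpace ℝ (Fin n), ρ < ‖x‖ →
      ∀ i j, eucLap (fun y => h y i j) x = 0)
    (hdiv : ∀ x : EuclideanSpace ℝ (Fin n), ρ < ‖x‖ → ∀ j,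
      ∑ i, fderiv ℝ (fun y => h y i j) x (EuclideanSpace.single i 1) = 0)
    (htr : ∀ x : EuclideanSpace ℝ (Fin n), ρ < ‖x‖ → ∑ i, h x i i = 0)
    (hgrowth : ∃ ε : ℝ, 0 < ε ∧ ∃ C R : ℝ,
      ∀ x : EuclideanSpace ℝ (Fin n), R ≤ ‖x‖ →
        ∀ i j, |h x i j| ≤ C * ‖x‖ ^ ((1 : ℝ) - ε)) :
    ∃ hc : Fin n → Fin n → ℝ, (∀ i j, hc i j = hc j i) ∧ ∃ C R : ℝ,
      ∀ x : EuclideanSpace ℝ (Fin n), R ≤ ‖x‖ →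
        ∀ i j, |h x i j - hc i j| ≤ C * ‖x‖ ^ (-(n : ℝ)) := by
  classical
  obtain ⟨ε, hε, C, R, hCR⟩ := hgrowth
  set χ : EuclideanSpace ℝ (Fin n) → ℝ := fun x => Real.smoothTransition (‖x‖ ^ 2 - (ρ + 1) ^ 2) with hχ
  have hχs : HDF.Sm χ := (Real.smoothTransition.contDiff (n := ⊤)).comp
    ((contDiff_norm_sq ℝ).sub contDiff_const)
  have hχ0 : ∀ x, ‖x‖ ≤ ρ + 1 → χ x = 0 := by
    intro x hx
    refine Real.smoothTransition.zero_of_nonpos ?_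
    nlinarith [norm_nonneg x]
  have hχ1 : ∀ x, ρ + 2 ≤ ‖x‖ → χ x = 1 := by
    intro x hx
    refine Real.smoothTransition.one_of_one_le ?_
    nlinarith [norm_nonneg x]
  set u : EuclideanSpace ℝ (Fin n) → Fin n → Fin n → ℝ := fun x i j => χ x * h x i j with hu
  have hopen : IsOpen {x : EuclideanSpace ℝ (Fin n) | ρ < ‖x‖} :=
    isOpen_lt continuous_const continuous_norm
  have hus : ∀ i j, HDF.Sm (fun x => u x i j) := by
    intro i j
    rw [HDF.Sm, contDiff_iff_contDiffAt]
    intro x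
    rcases lt_or_ge ρ ‖x‖ with hx | hx
    · have h1 : ContDiffAt ℝ (⊤ : ℕ∞) h x := hsmooth.contDiffAt (hopen.mem_nhds hx)
      have h2 : ContDiffAt ℝ (⊤ : ℕ∞) (fun x => h x i j) x :=
        contDiffAt_pi.1 (contDiffAt_pi.1 h1 i) j
      exact hχs.contDiffAt.mul h2
    · have : (fun x => u x i j) =ᶠ[nhds x] fun _ => 0 := by
        have ho : IsOpen {y : EuclideanSpace ℝ (Fin n) | ‖y‖ < ρ + 1} :=
          isOpen_lt continuous_norm continuous_const
        filter_upwards [ho.mem_nhds (show ‖x‖ < ρ + 1 by linarith)] with y hy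
        have hy' : ‖y‖ < ρ + 1 := hy
        simp only [hu]
        rw [hχ0 y hy'.le, zero_mul]
      exact contDiffAt_const.congr_of_eventuallyEq this
  have hev : ∀ x : EuclideanSpace ℝ (Fin n), ρ + 2 < ‖x‖ → ∀ i j,
      (fun x => u x i j) =ᶠ[nhds x] fun x => h x i j := by
    intro x hx i j
    have ho : IsOpen {y : EuclideanSpace ℝ (Fin n) | ρ + 2 < ‖y‖} :=
      isOpen_lt continuous_const continuous_norm
    filter_upwards [ho.mem_nhds hx] with y hy
    have hy' : ρ + 2 < ‖y‖ := hy
    simp only [hu]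
    rw [hχ1 y hy'.le, one_mul]
  have hf : ∀ i j (y : EuclideanSpace ℝ (Fin n)), ρ + 2 < ‖y‖ →
      eucLap (fun x => u x i j) y = 0 := by
    intro i j y hy
    rw [← hharm y (by linarith) i j]
    unfold eucLap
    refine Finset.sum_congr rfl fun k _ => ?_
    have h1 : (fun z => fderiv ℝ (fun x => u x i j) z (EuclideanSpace.single k 1))
        =ᶠ[nhds y] fun z => fderiv ℝ (fun x => h x i j) z (EuclideanSpace.single k 1) := by
      filter_upwards [(hev y hy i j).fderiv (𝕜 := ℝ)] with z hz
      rw [hz]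
    rw [h1.fderiv_eq]
  have hw : ∀ j (y : EuclideanSpace ℝ (Fin n)), ρ + 2 < ‖y‖ →
      ∑ i, HDF.D i (fun x => u x i j) y = 0 := by
    intro j y hy
    rw [← hdiv y (by linarith) j]
    refine Finset.sum_congr rfl fun k _ => ?_
    unfold HDF.D
    rw [(hev y hy k j).fderiv_eq]
  have husym : ∀ x i j, u x i j = u x j i := by
    intro x i j
    simp only [hu]
    rw [hsym]
  have hutr : ∀ x, ∑ i, u x i i = 0 := by
    intro x
    simp only [hu]
    rw [← Finset.mul_sum]
    rcases lt_or_ge ρ ‖x‖ with hx | hx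
    · rw [htr x hx, mul_zero]
    · rw [hχ0 x (by linarith), zero_mul]
  set a : ℝ := max (1 - ε) 0 with ha
  have ha0 : 0 ≤ a := le_max_right _ _
  have ha1 : a < 1 := max_lt (by linarith) one_pos
  have hg : ∀ i j, ∃ C, ∀ x, |u x i j| ≤ C * (1 + ‖x‖) ^ a := by
    intro i j
    obtain ⟨M, hM⟩ := (isCompact_closedBall (0 : EuclideanSpace ℝ (Fin n)) (max R 1)).exists_bound_of_continuousOn
      (hus i j).continuous.continuousOn
    refine ⟨max |C| |M|, fun x => ?_⟩
    rcases le_total ‖x‖ (max R 1) with hx | hx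
    · have h1 : |u x i j| ≤ M := hM x (by simpa using hx)
      have h2 : (1:ℝ) ≤ (1 + ‖x‖) ^ a :=
        Real.one_le_rpow (by linarith [norm_nonneg x]) ha0
      calc |u x i j| ≤ max |C| |M| := h1.trans ((le_abs_self M).trans (le_max_right _ _))
        _ = max |C| |M| * 1 := by ring
        _ ≤ _ := by gcongr
    · have hx1 : 1 ≤ ‖x‖ := (le_max_right _ _).trans hx
      have h1 := hCR x ((le_max_left _ _).trans hx) i j
      have h2 : |u x i j| ≤ |h x i j| := by
        simp only [hu]
        rw [abs_mul]
        have h3 : |χ x| ≤ 1 := by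
          rw [abs_of_nonneg (Real.smoothTransition.nonneg _)]
          exact Real.smoothTransition.le_one _
        exact mul_le_of_le_one_left (abs_nonneg _) h3
      calc |u x i j| ≤ C * ‖x‖ ^ ((1:ℝ) - ε) := h2.trans h1
        _ ≤ |C| * ‖x‖ ^ ((1:ℝ) - ε) := by gcongr; exact le_abs_self C
        _ ≤ |C| * ‖x‖ ^ a := by
          gcongr
          exact le_max_left _ _
        _ ≤ |C| * (1 + ‖x‖) ^ a := by gcongr; linarith
        _ ≤ _ := by gcongr; exact le_max_left _ _
  have hmain := fun i j => HDF.global hn hus (show 1 ≤ ρ + 2 by linarith) hf hw husym hutr ha0 ha1 hg i j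
  choose c B S hcB using hmain
  refine ⟨fun i j => (c i j + c j i) / 2, fun i j => by ring, ∑ i, ∑ j, |B i j|,
    ρ + 2 + ∑ i, ∑ j, |S i j|, fun x hx i j => ?_⟩
  have hle : ∀ (T : Fin n → Fin n → ℝ) i j, T i j ≤ ∑ i, ∑ j, |T i j| := by
    intro T i j
    calc T i j ≤ |T i j| := le_abs_self _
      _ ≤ ∑ j, |T i j| := Finset.single_le_sum (f := fun j => |T i j|)
          (fun _ _ => abs_nonneg _) (Finset.mem_univ j)
      _ ≤ _ := Finset.single_le_sum (f := fun i => ∑ j, |T i j|)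
          (fun _ _ => Finset.sum_nonneg fun _ _ => abs_nonneg _) (Finset.mem_univ i)
  have hS0 : 0 ≤ ∑ i, ∑ j, |S i j| :=
    Finset.sum_nonneg fun _ _ => Finset.sum_nonneg fun _ _ => abs_nonneg _
  have hux : ∀ i j, u x i j = h x i j := by
    intro i j
    simp only [hu]
    rw [hχ1 x (by linarith), one_mul]
  have hm : 0 ≤ ‖x‖ ^ (-(n:ℝ)) := by positivity
  have k : ∀ i j, |h x i j - c i j| ≤ (∑ i, ∑ j, |B i j|) * ‖x‖ ^ (-(n:ℝ)) := by
    intro i j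
    have h1 := hcB i j x (by linarith [hle S i j])
    rw [hux] at h1
    exact h1.trans (mul_le_mul_of_nonneg_right (hle B i j) hm)
  have k1 := abs_le.1 (k i j)
  have k2 := k j i
  rw [← hsym x i j] at k2
  have k2 := abs_le.1 k2
  rw [abs_le]
  constructor <;> linarith [k1.1, k1.2, k2.1, k2.2]
end

section
/- Let n ≥ 3 and let k be an integer with 1 ≤ k and 2k < n. Let A : {1,…,n}^3 → ℝ be a family of real numbers, written A_{ijl}, which is symmetric in its first two indices (A_{ijl} = A_{jil} for all i, j, l). Suppose that for every index j and every x ∈ ℝ^n one has (n − 2k) · Σ_{i=1}^n Σ_{l=1}^n A_{ijl} x_i x_l = |x|^2 · Σ_{i=1}^n A_{iji}. Then A_{ijl} = 0 for all i, j, l. -/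
/-- **Vanishing of the coefficients of a divergence-free homogeneous term.**
Let `n ≥ 3` and `1 ≤ k` with `2k < n`. If `A_{ijl}` is symmetric in `i, j` and satisfies
`(n - 2k) ∑_{i,l} A_{ijl} x_i x_l = |x|² ∑_i A_{iji}` for every `j` and every `x ∈ ℝⁿ`,
then all `A_{ijl}` vanish. -/
theorem divergence_free_linear_coefficients_vanish
    (n k : ℕ) (hn : 3 ≤ n) (hk : 1 ≤ k) (hkn : 2 * k < n)
    (A : Fin n → Fin n → Fin n → ℝ)
    (hsym : ∀ i j l, A i j l = A j i l)
    (heq : ∀ (j : Fin n) (x : Fin n → ℝ),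
      ((n : ℝ) - 2 * k) * ∑ i, ∑ l, A i j l * x i * x l =
        (∑ i, x i ^ 2) * ∑ i, A i j i) :
    ∀ i j l, A i j l = 0 := by
  have hc : ((n : ℝ) - 2 * k) ≠ 0 := by
    have : (2 * k : ℝ) < n := by exact_mod_cast hkn
    linarith
  have hkpos : (1 : ℝ) ≤ k := by exact_mod_cast hk
  have h1 : ∀ j a, ((n : ℝ) - 2 * k) * A a j a = ∑ i, A i j i := by
    intro j a
    have h := heq j (Pi.single a 1)
    simpa [Pi.single_apply, Finset.sum_ite_eq] using h
  have hT : ∀ j, ∑ i, A i j i = 0 := by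
    intro j
    have h : ∑ a : Fin n, ((n : ℝ) - 2 * k) * A a j a = ∑ _a : Fin n, ∑ i, A i j i :=
      Finset.sum_congr rfl (fun a _ => h1 j a)
    rw [← Finset.mul_sum] at h
    simp only [Finset.sum_const, Finset.card_univ, Fintype.card_fin, nsmul_eq_mul] at h
    have h2 : (k : ℝ) * ∑ i, A i j i = 0 := by linarith
    rcases mul_eq_zero.mp h2 with h3 | h3
    · linarith
    · exact h3
  have hd : ∀ j a, A a j a = 0 := by
    intro j a
    have h := h1 j a
    rw [hT j] at h
    exact (mul_eq_zero.mp h).resolve_left hc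
  have ha : ∀ j a b, A a j b = - A b j a := by
    intro j a b
    have h := heq j (Pi.single a 1 + Pi.single b 1)
    rw [hT j, mul_zero] at h
    have h := (mul_eq_zero.mp h).resolve_left hc
    simp only [Pi.add_apply, mul_add, add_mul, Finset.sum_add_distrib, Pi.single_apply,
      mul_ite, ite_mul, mul_one, mul_zero, zero_mul, Finset.sum_ite_eq', Finset.mem_univ,
      if_true] at h
    simp [hd] at h
    linarith
  intro i j l
  have e1 := ha j i l
  have e2 := hsym l j i
  have e3 := ha l j i
  have e4 := hsym i l j
  have e5 := ha i l j
  have e6 := hsym j i l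
  linarith
end

section
/- Let n ≥ 2, let X : ℝ^n → ℝ^n be a smooth vector field whose components are homogeneous of degree 2 (X(λp) = λ^2 X(p) for all λ > 0 and p ∈ ℝ^n), and let r_0 > 0. Suppose φ : [0,1] × B_{r_0}(0) → ℝ^n is a C^2 map satisfying φ(0, p) = p and ∂_t φ(t, p) = X(φ(t, p)) for all (t, p), and let K(p) = φ(1, p) be the time-one flow map. Then there exist constants C > 0 and 0 < r_1 ≤ r_0 such that for all p with |p| ≤ r_1 and all indices i, j: | Σ_{k=1}^n ∂_i K_k(p) · ∂_j K_k(p) − δ_{ij} − ∂_i X_j(p) − ∂_j X_i(p) | ≤ C |p|^2. -/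
open Set Metric Filter Topology

lemma aux_lip {n : ℕ} {k : ℕ}
    (f : EuclideanSpace ℝ (Fin n) → EuclideanSpace ℝ (Fin n))
    (hf : ContDiff ℝ 1 f)
    (hhom : ∀ lam : ℝ, 0 < lam → ∀ p, f (lam • p) = lam ^ (k + 1) • f p) :
    ∃ L : ℝ, 0 ≤ L ∧ ∀ r : ℝ, 0 < r → ∀ x y, ‖x‖ ≤ r → ‖y‖ ≤ r →
      ‖f x - f y‖ ≤ L * r ^ k * ‖x - y‖ := by
  have hc : Continuous (fderiv ℝ f) := hf.continuous_fderiv (by norm_num)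
  obtain ⟨L, hL⟩ := (isCompact_closedBall (0 : EuclideanSpace ℝ (Fin n)) 1).exists_bound_of_continuousOn
    hc.continuousOn
  have hL0 : 0 ≤ L := (norm_nonneg _).trans (hL 0 (by simp))
  refine ⟨L, hL0, ?_⟩
  intro r hr x y hx hy
  have key : ∀ z : EuclideanSpace ℝ (Fin n), f z = r ^ (k+1) • f (r⁻¹ • z) := by
    intro z
    rw [← hhom r hr, smul_smul, mul_inv_cancel₀ hr.ne', one_smul]
  have hin : ∀ z : EuclideanSpace ℝ (Fin n), ‖z‖ ≤ r →
      r⁻¹ • z ∈ closedBall (0 : EuclideanSpace ℝ (Fin n)) 1 := by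
    intro z hz
    rw [mem_closedBall_zero_iff, norm_smul, norm_inv, Real.norm_of_nonneg hr.le,
      inv_mul_le_iff₀ hr]
    simpa using hz
  have h1 := (convex_closedBall (0 : EuclideanSpace ℝ (Fin n)) 1).norm_image_sub_le_of_norm_fderiv_le
    (f := f) (𝕜 := ℝ) (fun z _ => (hf.differentiable (by norm_num)) z) hL (hin y hy) (hin x hx)
  rw [key x, key y, ← smul_sub, norm_smul, norm_pow, Real.norm_of_nonneg hr.le]
  rw [← smul_sub, norm_smul, norm_inv, Real.norm_of_nonneg hr.le] at h1
  calc _ ≤ r ^ (k+1) * (L * (r⁻¹ * ‖x - y‖)) := by gcongr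
    _ = r ^ k * L * ‖x - y‖ * (r * r⁻¹) := by ring
    _ = _ := by rw [mul_inv_cancel₀ hr.ne']; ring

lemma aux_fderiv {n : ℕ} {k : ℕ}
    (f : EuclideanSpace ℝ (Fin n) → EuclideanSpace ℝ (Fin n)) (L R : ℝ) (hL : 0 ≤ L)
    (h : ∀ r : ℝ, 0 < r → r ≤ R → ∀ x y, ‖x‖ ≤ r → ‖y‖ ≤ r →
      ‖f x - f y‖ ≤ L * r ^ k * ‖x - y‖) (p : EuclideanSpace ℝ (Fin n)) (hp : ‖p‖ < R) :
    ‖fderiv ℝ f p‖ ≤ L * ‖p‖ ^ k := by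
  have ht : Tendsto (fun r : ℝ => L * r ^ k) (𝓝[>] ‖p‖) (𝓝 (L * ‖p‖ ^ k)) :=
    ((by fun_prop : Continuous (fun r : ℝ => L * r ^ k)).tendsto _).mono_left nhdsWithin_le_nhds
  refine ge_of_tendsto ht ?_
  filter_upwards [Ioc_mem_nhdsGT hp] with r hr
  have hr0 : 0 < r := (norm_nonneg p).trans_lt hr.1
  refine norm_fderiv_le_of_lip' ℝ (by positivity) ?_
  have : ∀ᶠ x in 𝓝 p, ‖x‖ < r := continuous_norm.continuousAt.eventually_lt_const hr.1
  filter_upwards [this] with x hx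
  exact h r hr0 hr.2 x p hx.le hr.1.le

lemma aux_flow (n : ℕ)
    (X : EuclideanSpace ℝ (Fin n) → EuclideanSpace ℝ (Fin n))
    (hX : ContDiff ℝ (⊤ : ℕ∞) X)
    (hhom : ∀ lam : ℝ, 0 < lam → ∀ p, X (lam • p) = lam ^ 2 • X p)
    (r₀ : ℝ) (hr₀ : 0 < r₀)
    (φ : ℝ → EuclideanSpace ℝ (Fin n) → EuclideanSpace ℝ (Fin n))
    (hφC : ContinuousOn
      (fun q : ℝ × EuclideanSpace ℝ (Fin n) => φ q.1 q.2)
      (Set.Icc (0 : ℝ) 1 ×ˢ Metric.ball (0 : EuclideanSpace ℝ (Fin n)) r₀))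
    (hφ0 : ∀ p ∈ Metric.ball (0 : EuclideanSpace ℝ (Fin n)) r₀, φ 0 p = p)
    (hflow : ∀ t ∈ Set.Icc (0 : ℝ) 1,
      ∀ p ∈ Metric.ball (0 : EuclideanSpace ℝ (Fin n)) r₀,
        HasDerivWithinAt (fun s => φ s p) (X (φ t p)) (Set.Icc 0 1) t) :
    ∃ C : ℝ, 0 ≤ C ∧ ∀ r : ℝ, 0 < r → r ≤ r₀ / 2 → ∀ x y, ‖x‖ ≤ r → ‖y‖ ≤ r →
      ‖(φ 1 x - x - X x) - (φ 1 y - y - X y)‖ ≤ C * r ^ 2 * ‖x - y‖ := by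
  have hXd : Differentiable ℝ X := hX.differentiable (by simp)
  obtain ⟨L, hL0, hL⟩ := aux_lip (k := 1) X (hX.of_le (by exact_mod_cast le_top)) hhom
  have hDhom : ∀ lam : ℝ, 0 < lam → ∀ p, fderiv ℝ X (lam • p) = lam • fderiv ℝ X p := by
    intro lam hl p
    have h1 : fderiv ℝ (fun q => X (lam • q)) p = lam • fderiv ℝ X (lam • p) :=
      fderiv_comp_smul (f := X) lam
    have h2 : (fun q => X (lam • q)) = fun q => lam ^ 2 • X q := funext (hhom lam hl)
    rw [h2, fderiv_fun_const_smul (hXd p)] at h1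
    have h3 := congrArg (fun T => lam⁻¹ • T) h1
    simp only [smul_smul, inv_mul_cancel₀ hl.ne', one_smul] at h3
    rw [← h3]
    congr 1
    field_simp
  have hYc : ContDiff ℝ 1 (fun p => fderiv ℝ X p (X p)) := by
    have h1 : ContDiff ℝ 1 (fderiv ℝ X) := hX.fderiv_right (by norm_cast)
    exact h1.clm_apply (hX.of_le (by exact_mod_cast le_top))
  obtain ⟨L', hL'0, hL'⟩ := aux_lip (k := 2) (fun p => fderiv ℝ X p (X p)) hYc (by
    intro lam hl p
    simp only [hhom lam hl, hDhom lam hl, map_smul, ContinuousLinearMap.smul_apply, smul_smul]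
    congr 1)
  have hX0 : X 0 = 0 := by
    have h := hhom 2 (by norm_num) 0
    rw [smul_zero] at h
    have h' : (3 : ℝ) • X 0 = 0 := by
      have : (3 : ℝ) • X 0 = (2 : ℝ) ^ 2 • X 0 - X 0 := by module
      rw [this, ← h, sub_self]
    simpa using h'
  have hsub : ∀ x : EuclideanSpace ℝ (Fin n), ‖x‖ ≤ r₀ / 2 →
      x ∈ ball (0 : EuclideanSpace ℝ (Fin n)) r₀ := by
    intro x hx
    rw [mem_ball_zero_iff]; linarith
  obtain ⟨R, hR⟩ := ((isCompact_Icc (a := (0 : ℝ)) (b := 1)).prod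
    (isCompact_closedBall (0 : EuclideanSpace ℝ (Fin n)) (r₀ / 2))).exists_bound_of_continuousOn
    (hφC.mono (prod_mono le_rfl fun x hx => hsub x (by simpa using hx)))
  have hR' : ∀ t ∈ Icc (0 : ℝ) 1, ∀ x, ‖x‖ ≤ r₀ / 2 → ‖φ t x‖ ≤ |R| + 1 := by
    intro t ht x hx
    have := hR (t, x) ⟨ht, by simpa using hx⟩
    have h2 := le_abs_self R
    simp only at this
    linarith
  set S := |R| + 1 with hS
  have hS0 : 0 < S := by positivity
  have hlipS : LipschitzOnWith (L * S).toNNReal X (closedBall 0 S) := by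
    refine LipschitzOnWith.of_dist_le_mul fun x hx y hy => ?_
    rw [Real.coe_toNNReal _ (by positivity), dist_eq_norm, dist_eq_norm]
    simpa using hL S hS0 x y (by simpa using hx) (by simpa using hy)
  have hder : ∀ x, ‖x‖ ≤ r₀ / 2 → ∀ t ∈ Ico (0 : ℝ) 1,
      HasDerivWithinAt (fun s => φ s x) (X (φ t x)) (Ici t) t := by
    intro x hx t ht
    refine (hflow t (Ico_subset_Icc_self ht) x (hsub x hx)).mono_of_mem_nhdsWithin ?_
    exact mem_of_superset (Icc_mem_nhdsGE ht.2) (Icc_subset_Icc_left ht.1)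
  have hcont : ∀ x, ‖x‖ ≤ r₀ / 2 → ContinuousOn (fun s => φ s x) (Icc 0 1) :=
    fun x hx t ht => (hflow t ht x (hsub x hx)).continuousWithinAt
  set M := Real.exp (L * S) with hM
  have hM0 : 0 < M := Real.exp_pos _
  have hexp : ∀ t ∈ Icc (0 : ℝ) 1, Real.exp (((L * S).toNNReal : ℝ) * (t - 0)) ≤ M := by
    intro t ht
    rw [Real.coe_toNNReal _ (by positivity), hM]
    apply Real.exp_le_exp.2
    have : 0 ≤ L * S := by positivity
    nlinarith [ht.1, ht.2]
  have hdist : ∀ x y, ‖x‖ ≤ r₀ / 2 → ‖y‖ ≤ r₀ / 2 → ∀ t ∈ Icc (0 : ℝ) 1,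
      ‖φ t x - φ t y‖ ≤ M * ‖x - y‖ := by
    intro x y hx hy t ht
    have := dist_le_of_trajectories_ODE_of_mem (v := fun _ => X) (s := fun _ => closedBall 0 S)
      (a := 0) (b := 1) (δ := ‖x - y‖)
      (fun _ _ => hlipS) (hcont x hx) (hder x hx)
      (fun t ht => by simpa using hR' t (Ico_subset_Icc_self ht) x hx)
      (hcont y hy) (hder y hy)
      (fun t ht => by simpa using hR' t (Ico_subset_Icc_self ht) y hy)
      (by simp only [hφ0 x (hsub x hx), hφ0 y (hsub y hy), dist_eq_norm]; exact le_rfl) t ht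
    rw [dist_eq_norm] at this
    refine this.trans ?_
    rw [mul_comm]
    gcongr
    exact hexp t ht
  have hnorm : ∀ x, ‖x‖ ≤ r₀ / 2 → ∀ t ∈ Icc (0 : ℝ) 1, ‖φ t x‖ ≤ M * ‖x‖ := by
    intro x hx t ht
    have := dist_le_of_trajectories_ODE_of_mem (v := fun _ => X) (s := fun _ => closedBall 0 S)
      (a := 0) (b := 1) (δ := ‖x‖) (g := fun _ => 0)
      (fun _ _ => hlipS) (hcont x hx) (hder x hx)
      (fun t ht => by simpa using hR' t (Ico_subset_Icc_self ht) x hx)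
      continuousOn_const (fun t _ => by simpa [hX0] using hasDerivWithinAt_const t (Ici t) (0 : EuclideanSpace ℝ (Fin n)))
      (fun t ht => by simpa using hS0.le)
      (by simp [hφ0 x (hsub x hx)]) t ht
    rw [dist_zero_right] at this
    refine this.trans ?_
    rw [mul_comm]
    gcongr
    exact hexp t ht
  refine ⟨L' * M ^ 2 * M, by positivity, ?_⟩
  intro r hr hrr x y hx hy
  have hx' := hx.trans hrr
  have hy' := hy.trans hrr
  have hg : ∀ t ∈ Icc (0 : ℝ) 1, ‖(X (φ t x) - X (φ t y)) - (X x - X y)‖ ≤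
      L' * M ^ 2 * M * r ^ 2 * ‖x - y‖ := by
    intro t ht
    have hd : ∀ z, ‖z‖ ≤ r₀ / 2 → ∀ s ∈ Icc (0 : ℝ) 1, HasDerivWithinAt (fun s => X (φ s z))
        (fderiv ℝ X (φ s z) (X (φ s z))) (Icc 0 1) s := fun z hz s hs =>
      (hXd (φ s z)).hasFDerivAt.comp_hasDerivWithinAt s (hflow s hs z (hsub z hz))
    have := norm_image_sub_le_of_norm_deriv_le_segment'
      (f := fun s => X (φ s x) - X (φ s y)) (a := 0) (b := 1)
      (C := L' * M ^ 2 * M * r ^ 2 * ‖x - y‖)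
      (fun s hs => (hd x hx' s hs).sub (hd y hy' s hs)) (by
        intro s hs
        have hs := Ico_subset_Icc_self hs
        have h1 := hL' (M * r) (by positivity) (φ s x) (φ s y)
          ((hnorm x hx' s hs).trans (by gcongr)) ((hnorm y hy' s hs).trans (by gcongr))
        refine h1.trans ?_
        calc _ ≤ L' * (M * r) ^ 2 * (M * ‖x - y‖) := by gcongr; exact hdist x y hx' hy' s hs
          _ = _ := by ring) t ht
    simp only [hφ0 x (hsub x hx'), hφ0 y (hsub y hy')] at this
    refine this.trans ?_
    have h0 : 0 ≤ L' * M ^ 2 * M * r ^ 2 * ‖x - y‖ := by positivity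
    nlinarith [ht.1, ht.2]
  have hd : ∀ z, ‖z‖ ≤ r₀ / 2 → ∀ s ∈ Icc (0 : ℝ) 1,
      HasDerivWithinAt (fun s => φ s z - s • X z) (X (φ s z) - X z) (Icc 0 1) s := by
    intro z hz s hs
    refine (hflow s hs z (hsub z hz)).sub ?_
    simpa using (hasDerivWithinAt_id s (Icc (0:ℝ) 1)).smul_const (X z)
  have := norm_image_sub_le_of_norm_deriv_le_segment_01'
      (f := fun s => (φ s x - s • X x) - (φ s y - s • X y))
      (C := L' * M ^ 2 * M * r ^ 2 * ‖x - y‖)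
      (fun s hs => (hd x hx' s hs).sub (hd y hy' s hs)) (by
        intro s hs
        have h := hg s (Ico_subset_Icc_self hs)
        rwa [sub_sub_sub_comm] at h)
  simp only [hφ0 x (hsub x hx'), hφ0 y (hsub y hy'), one_smul, zero_smul] at this
  have e : (φ 1 x - x - X x) - (φ 1 y - y - X y) =
      φ 1 x - X x - (φ 1 y - X y) - (x - 0 - (y - 0)) := by
    rw [sub_zero, sub_zero]; abel
  rw [e]
  exact this


/-- **Second-order Taylor estimate for the pullback of the flat metric by the time-one flow
of a quadratic vector field.** Let `X` be a smooth vector field on `ℝⁿ` whose components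
are homogeneous of degree `2`, and let `φ` be a `C²` flow of `X` on `[0,1] × B_{r₀}(0)` with
`φ(0,p) = p`, and `K p = φ(1,p)` its time-one map. Then
`(K^* g₀)_{ij} - δ_{ij} - ∂ᵢ X_j - ∂_j X_i = O(|p|²)` as `p → 0`. -/
theorem time_one_flow_pullback_estimate
    (n : ℕ) (hn : 2 ≤ n)
    (X : EuclideanSpace ℝ (Fin n) → EuclideanSpace ℝ (Fin n))
    (hX : ContDiff ℝ (⊤ : ℕ∞) X)
    (hhom : ∀ lam : ℝ, 0 < lam → ∀ p, X (lam • p) = lam ^ 2 • X p)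
    (r₀ : ℝ) (hr₀ : 0 < r₀)
    (φ : ℝ → EuclideanSpace ℝ (Fin n) → EuclideanSpace ℝ (Fin n))
    (hφC2 : ContDiffOn ℝ 2
      (fun q : ℝ × EuclideanSpace ℝ (Fin n) => φ q.1 q.2)
      (Set.Icc (0 : ℝ) 1 ×ˢ Metric.ball (0 : EuclideanSpace ℝ (Fin n)) r₀))
    (hφ0 : ∀ p ∈ Metric.ball (0 : EuclideanSpace ℝ (Fin n)) r₀, φ 0 p = p)
    (hflow : ∀ t ∈ Set.Icc (0 : ℝ) 1,
      ∀ p ∈ Metric.ball (0 : EuclideanSpace ℝ (Fin n)) r₀,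
        HasDerivWithinAt (fun s => φ s p) (X (φ t p)) (Set.Icc 0 1) t) :
    ∃ C : ℝ, 0 < C ∧ ∃ r₁ : ℝ, 0 < r₁ ∧ r₁ ≤ r₀ ∧
      ∀ p : EuclideanSpace ℝ (Fin n), ‖p‖ ≤ r₁ → ∀ i j : Fin n,
        |(∑ k, fderiv ℝ (fun q => φ 1 q k) p (EuclideanSpace.single i 1) *
              fderiv ℝ (fun q => φ 1 q k) p (EuclideanSpace.single j 1))
            - (if i = j then (1 : ℝ) else 0)
            - fderiv ℝ (fun q => X q j) p (EuclideanSpace.single i 1)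
            - fderiv ℝ (fun q => X q i) p (EuclideanSpace.single j 1)| ≤ C * ‖p‖ ^ 2 := by
  have hXd : Differentiable ℝ X := hX.differentiable (by simp)
  obtain ⟨C, hC0, hC⟩ := aux_flow n X hX hhom r₀ hr₀ φ hφC2.continuousOn hφ0 hflow
  obtain ⟨L, hL0, hL⟩ := aux_lip (k := 1) X (hX.of_le (by exact_mod_cast le_top)) hhom
  refine ⟨2 * C + (L + C) ^ 2 + 1, by positivity, min (r₀ / 4) 1, by positivity,
    (min_le_left _ _).trans (by linarith), ?_⟩
  intro p hp i j
  have hp1 : ‖p‖ ≤ 1 := hp.trans (min_le_right _ _)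
  have hp2 : ‖p‖ < r₀ / 2 := (hp.trans (min_le_left _ _)).trans_lt (by linarith)
  have hKd : DifferentiableAt ℝ (φ 1) p := by
    have h1 : ContDiffOn ℝ 2 (fun q => φ 1 q) (ball (0 : EuclideanSpace ℝ (Fin n)) r₀) :=
      hφC2.comp (f := fun q : EuclideanSpace ℝ (Fin n) => ((1 : ℝ), q))
        (by fun_prop) (fun q hq => ⟨by simp, hq⟩)
    exact (h1.differentiableOn (by norm_num)).differentiableAt
      (isOpen_ball.mem_nhds (by rw [mem_ball_zero_iff]; linarith))
  have hE := aux_fderiv (k := 2) (fun q => φ 1 q - q - X q) C (r₀ / 2) hC0 hC p hp2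
  have hD := aux_fderiv (k := 1) X L (r₀ / 2) hL0 (fun r hr _ => hL r hr) p hp2
  have hEeq : fderiv ℝ (fun q => φ 1 q - q - X q) p =
      fderiv ℝ (φ 1) p - ContinuousLinearMap.id ℝ _ - fderiv ℝ X p :=
    ((hKd.hasFDerivAt.sub (hasFDerivAt_id p)).sub (hXd p).hasFDerivAt).fderiv
  have hcoord : ∀ (f : EuclideanSpace ℝ (Fin n) → EuclideanSpace ℝ (Fin n)),
      DifferentiableAt ℝ f p → ∀ k v, fderiv ℝ (fun q => f q k) p v = (fderiv ℝ f p v) k := by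
    intro f hf k v
    have := ((EuclideanSpace.proj k : EuclideanSpace ℝ (Fin n) →L[ℝ] ℝ).hasFDerivAt.comp p
      hf.hasFDerivAt).fderiv
    exact congrArg (fun T => T v) this
  simp only [hcoord _ hKd, hcoord _ (hXd p)]
  set E := fderiv ℝ (fun q => φ 1 q - q - X q) p with hEdef
  set D := fderiv ℝ X p with hDdef
  have hK : ∀ v, fderiv ℝ (φ 1) p v = v + (D v + E v) := by
    intro v
    rw [hEeq]
    simp only [ContinuousLinearMap.sub_apply, ContinuousLinearMap.id_apply]
    abel
  set ei : EuclideanSpace ℝ (Fin n) := EuclideanSpace.single i 1 with hei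
  set ej : EuclideanSpace ℝ (Fin n) := EuclideanSpace.single j 1 with hej
  have hni : ‖ei‖ = 1 := by simp [hei]
  have hnj : ‖ej‖ = 1 := by simp [hej]
  have hsum : ∑ k, fderiv ℝ (φ 1) p ei k * fderiv ℝ (φ 1) p ej k =
      inner ℝ (fderiv ℝ (φ 1) p ei) (fderiv ℝ (φ 1) p ej) := by
    simp [PiLp.inner_apply, mul_comm]
  have hδ : (if i = j then (1 : ℝ) else 0) = inner ℝ ei ej := by
    simp [hei, hej, EuclideanSpace.inner_single_left, Pi.single_apply]
  have h1 : D ei j = inner ℝ (D ei) ej := by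
    simp [hej, EuclideanSpace.inner_single_right]
  have h2 : D ej i = inner ℝ ei (D ej) := by
    simp [hei, EuclideanSpace.inner_single_left]
  rw [hsum, hδ, h1, h2, hK, hK]
  have hexpand : inner ℝ (ei + (D ei + E ei)) (ej + (D ej + E ej)) - inner ℝ ei ej
      - inner ℝ (D ei) ej - inner ℝ ei (D ej) =
      inner ℝ (E ei) ej + inner ℝ ei (E ej) + inner ℝ (D ei + E ei) (D ej + E ej) := by
    simp only [inner_add_left, inner_add_right]; ring
  rw [hexpand]
  have hEv : ∀ v : EuclideanSpace ℝ (Fin n), ‖v‖ = 1 → ‖E v‖ ≤ C * ‖p‖ ^ 2 := by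
    intro v hv
    have := E.le_opNorm v
    rw [hv, mul_one] at this
    exact this.trans hE
  have hDv : ∀ v : EuclideanSpace ℝ (Fin n), ‖v‖ = 1 → ‖D v‖ ≤ L * ‖p‖ := by
    intro v hv
    have := D.le_opNorm v
    rw [hv, mul_one] at this
    simpa using this.trans hD
  have hDE : ∀ v : EuclideanSpace ℝ (Fin n), ‖v‖ = 1 → ‖D v + E v‖ ≤ (L + C) * ‖p‖ := by
    intro v hv
    refine (norm_add_le _ _).trans ?_
    have h3 := hEv v hv
    have h4 := hDv v hv
    have h5 : C * ‖p‖ ^ 2 ≤ C * ‖p‖ := by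
      gcongr
      nlinarith [norm_nonneg p]
    linarith
  have a1 : |inner ℝ (E ei) ej| ≤ C * ‖p‖ ^ 2 := by
    have := abs_real_inner_le_norm (E ei) ej
    rw [hnj, mul_one] at this
    exact this.trans (hEv ei hni)
  have a2 : |inner ℝ ei (E ej)| ≤ C * ‖p‖ ^ 2 := by
    have := abs_real_inner_le_norm ei (E ej)
    rw [hni, one_mul] at this
    exact this.trans (hEv ej hnj)
  have a3 : |inner ℝ (D ei + E ei) (D ej + E ej)| ≤ ((L + C) * ‖p‖) * ((L + C) * ‖p‖) := by
    refine (abs_real_inner_le_norm _ _).trans ?_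
    gcongr
    · exact hDE ei hni
    · exact hDE ej hnj
  have a4 := abs_add_three (inner ℝ (E ei) ej) (inner ℝ ei (E ej))
    (inner ℝ (D ei + E ei) (D ej + E ej))
  nlinarith [sq_nonneg ‖p‖]
end
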